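/- Let V be a nontrivial irreducible Harish-Chandra module over the map full toroidal Lie algebra τ(B). Then either V is cuspidal, or V is a highest weight module, i.e. there exist a subgroup M of ℤ^n and β ∈ ℤ^n with ℤ^n = M ⊕ ℤβ and a nonzero vector v ∈ V such that τ(B)^+_M·v = 0 and U(τ(B))·v = V. Moreover, in either case V is a single point evaluation module: there exists a maximal ideal 𝔐 of B with (τ ⊗ 𝔐)·V = 0. -/

import Mathlib

open scoped TensorProduct

namespace MT

/-- Presentation of the full toroidal Lie algebra `τ` of rank `n` associated with the
finite-dimensional simple complex Lie algebra `𝔤`, the invariant form `κ` and the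
2-cocycle `φ = c₁ • φ₁ + c₂ • φ₂`.  Here `E m x` stands for `x ⊗ t^m`, `K m i` for
`t^m K_i` (the image in the space of Kähler differentials `𝒦 = Ω/dA_n`), and
`W m i` for `t^m d_i`. -/
structure IsFullToroidal (n : ℕ) (𝔤 : Type) [LieRing 𝔤] [LieAlgebra ℂ 𝔤]
    (τ : Type) [LieRing τ] [LieAlgebra ℂ τ]
    (κ : 𝔤 →ₗ[ℂ] 𝔤 →ₗ[ℂ] ℂ) (c₁ c₂ : ℂ)
    (E : (Fin n → ℤ) → 𝔤 →ₗ[ℂ] τ) (K W : (Fin n → ℤ) → Fin n → τ) : Prop where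
  κ_symm : ∀ x y, κ x y = κ y x
  κ_invariant : ∀ x y z, κ ⁅x, y⁆ z = κ x ⁅y, z⁆
  κ_nondeg : ∀ x, (∀ y, κ x y = 0) → x = 0
  span_eq_top : Submodule.span ℂ
      ({z : τ | ∃ m x, z = E m x} ∪ {z : τ | ∃ m i, z = K m i} ∪
        {z : τ | ∃ m i, z = W m i}) = ⊤
  K_rel : ∀ m : Fin n → ℤ, (∑ i, (m i : ℂ) • K m i) = 0
  lie_E_E : ∀ m k x y, ⁅E m x, E k y⁆
      = E (m + k) ⁅x, y⁆ + κ x y • ∑ i, (m i : ℂ) • K (m + k) i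
  lie_E_K : ∀ m x k j, ⁅E m x, K k j⁆ = 0
  lie_K_K : ∀ m i k j, ⁅K m i, K k j⁆ = 0
  lie_W_E : ∀ m i k x, ⁅W m i, E k x⁆ = (k i : ℂ) • E (m + k) x
  lie_W_K : ∀ m i k j, ⁅W m i, K k j⁆
      = (k i : ℂ) • K (m + k) j + (if i = j then ∑ p, (m p : ℂ) • K (m + k) p else 0)
  lie_W_W : ∀ m i k j, ⁅W m i, W k j⁆
      = (k i : ℂ) • W (m + k) j - (m j : ℂ) • W (m + k) i
        + (c₁ * (-((k i : ℂ) * (m j : ℂ))) + c₂ * ((m i : ℂ) * (k j : ℂ)))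
          • ∑ p, (m p : ℂ) • K (m + k) p

/-- The map algebra `τ(B) = τ ⊗ B` is a complex Lie algebra. -/
noncomputable instance mapLieAlgebra (B τ : Type) [CommRing B] [Algebra ℂ B]
    [LieRing τ] [LieAlgebra ℂ τ] : LieAlgebra ℂ (B ⊗[ℂ] τ) :=
  { (inferInstance : Module ℂ (B ⊗[ℂ] τ)) with
    lie_smul := fun c x y => by
      rw [← algebraMap_smul B c y, lie_smul, algebraMap_smul] }

/-- The simultaneous eigenspace ("weight space") of the commuting family of
operators `d` for the eigenvalue function `l`. -/
def weightSpace {n : ℕ} {L V : Type*} [LieRing L] [LieAlgebra ℂ L] [AddCommGroup V]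
    [Module ℂ V] [LieRingModule L V] [LieModule ℂ L V]
    (d : Fin n → L) (l : Fin n → ℂ) : Submodule ℂ V where
  carrier := {v | ∀ i, ⁅d i, v⁆ = l i • v}
  add_mem' := by
    intro a b ha hb i
    rw [lie_add, ha i, hb i, smul_add]
  zero_mem' := by
    intro i
    rw [lie_zero, smul_zero]
  smul_mem' := by
    intro c a ha i
    rw [lie_smul, ha i, smul_comm]

/-- `V` is a Harish-Chandra module with respect to the degree operators `d`:
the sum of the weight spaces is all of `V` and each weight space is finite
dimensional. -/
def IsHarishChandra {n : ℕ} {L V : Type*} [LieRing L] [LieAlgebra ℂ L] [AddCommGroup V]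
    [Module ℂ V] [LieRingModule L V] [LieModule ℂ L V] (d : Fin n → L) : Prop :=
  (⨆ l : Fin n → ℂ, weightSpace (V := V) d l) = ⊤ ∧
    ∀ l : Fin n → ℂ, FiniteDimensional ℂ (weightSpace (V := V) d l)

/-- `V` is cuspidal (uniformly bounded): a Harish-Chandra module whose weight
space dimensions admit a uniform bound. -/
def IsCuspidal {n : ℕ} {L V : Type*} [LieRing L] [LieAlgebra ℂ L] [AddCommGroup V]
    [Module ℂ V] [LieRingModule L V] [LieModule ℂ L V] (d : Fin n → L) : Prop :=
  IsHarishChandra (V := V) d ∧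
    ∃ N : ℕ, ∀ l : Fin n → ℂ, Module.finrank ℂ (weightSpace (V := V) d l) ≤ N

/-- The degree operators `d_i ⊗ 1` inside `τ(B)`. -/
noncomputable def dOp {n : ℕ} (B : Type) [CommRing B] [Algebra ℂ B] {τ : Type}
    [LieRing τ] [LieAlgebra ℂ τ] (W : (Fin n → ℤ) → Fin n → τ) (i : Fin n) :
    B ⊗[ℂ] τ :=
  (1 : B) ⊗ₜ[ℂ] W 0 i

variable {n : ℕ} {𝔤 : Type} [LieRing 𝔤] [LieAlgebra ℂ 𝔤]
variable {τ : Type} [LieRing τ] [LieAlgebra ℂ τ]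

/-- The set of homogeneous generators of `τ` of degree `m`. -/
def genOfDeg (E : (Fin n → ℤ) → 𝔤 →ₗ[ℂ] τ) (K W : (Fin n → ℤ) → Fin n → τ)
    (m : Fin n → ℤ) : Set τ :=
  Set.range (E m) ∪ Set.range (K m) ∪ Set.range (W m)

/-- The homogeneous generators of `τ` of degree lying in the subgroup `M`,
i.e. generators of `τ_M`. -/
def tauMGens (E : (Fin n → ℤ) → 𝔤 →ₗ[ℂ] τ) (K W : (Fin n → ℤ) → Fin n → τ)
    (M : AddSubgroup (Fin n → ℤ)) : Set τ :=
  {Y | ∃ m ∈ M, Y ∈ genOfDeg E K W m}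

/-- The graded piece `τ_m`. -/
def gradedPiece (E : (Fin n → ℤ) → 𝔤 →ₗ[ℂ] τ) (K W : (Fin n → ℤ) → Fin n → τ)
    (m : Fin n → ℤ) : Submodule ℂ τ :=
  Submodule.span ℂ (genOfDeg E K W m)

/-- The subalgebra `τ(B)_M = ⊕_{m ∈ M} τ_m ⊗ B` of `τ(B)`. -/
noncomputable def tauBM (B : Type) [CommRing B] [Algebra ℂ B]
    (E : (Fin n → ℤ) → 𝔤 →ₗ[ℂ] τ) (K W : (Fin n → ℤ) → Fin n → τ)
    (M : AddSubgroup (Fin n → ℤ)) : LieSubalgebra ℂ (B ⊗[ℂ] τ) :=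
  LieSubalgebra.lieSpan ℂ (B ⊗[ℂ] τ)
    {z | ∃ (a : B) (Y : τ), Y ∈ tauMGens E K W M ∧ z = a ⊗ₜ[ℂ] Y}

/-- The degree operators `d_i ⊗ 1` as elements of `τ(B)_M` (note `0 ∈ M`). -/
noncomputable def dOpM (B : Type) [CommRing B] [Algebra ℂ B]
    (E : (Fin n → ℤ) → 𝔤 →ₗ[ℂ] τ) (K W : (Fin n → ℤ) → Fin n → τ)
    (M : AddSubgroup (Fin n → ℤ)) (i : Fin n) : ↥(tauBM B E K W M) :=
  ⟨(1 : B) ⊗ₜ[ℂ] W 0 i,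
    LieSubalgebra.subset_lieSpan
      ⟨1, W 0 i, ⟨0, M.zero_mem, Or.inr ⟨i, rfl⟩⟩, rfl⟩⟩

/-- `(τ ⊗ I)·V = 0`. -/
def annTensor (τ : Type) [LieRing τ] [LieAlgebra ℂ τ] (B : Type) [CommRing B]
    [Algebra ℂ B] (I : Ideal B) (V : Type) [AddCommGroup V] [Module ℂ V]
    [LieRingModule (B ⊗[ℂ] τ) V] : Prop :=
  ∀ X : τ, ∀ a ∈ I, ∀ v : V, ⁅a ⊗ₜ[ℂ] X, v⁆ = 0

/-- The action of `τ(B)` on `V` is by evaluation at the algebra homomorphism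
`ψ : B → ℂ`:  `(X ⊗ b)·v = ψ(b) (X ⊗ 1)·v`. -/
def evalActs (τ : Type) [LieRing τ] [LieAlgebra ℂ τ] (B : Type) [CommRing B]
    [Algebra ℂ B] (ψ : B →ₐ[ℂ] ℂ) (V : Type) [AddCommGroup V] [Module ℂ V]
    [LieRingModule (B ⊗[ℂ] τ) V] : Prop :=
  ∀ (X : τ) (b : B) (v : V), ⁅b ⊗ₜ[ℂ] X, v⁆ = ψ b • ⁅(1 : B) ⊗ₜ[ℂ] X, v⁆

/-- `v` is annihilated by `τ(B)^+_M = ⊕_{m ∈ M, r ≥ 1} τ(B)_{m + rβ}`. -/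
def annPlus (B : Type) [CommRing B] [Algebra ℂ B]
    (E : (Fin n → ℤ) → 𝔤 →ₗ[ℂ] τ) (K W : (Fin n → ℤ) → Fin n → τ)
    (M : AddSubgroup (Fin n → ℤ)) (β : Fin n → ℤ) {V : Type} [AddCommGroup V]
    [Module ℂ V] [LieRingModule (B ⊗[ℂ] τ) V] (v : V) : Prop :=
  ∀ m₀ ∈ M, ∀ r : ℕ, 0 < r → ∀ a : B,
    (∀ x : 𝔤, ⁅a ⊗ₜ[ℂ] E (m₀ + (r : ℤ) • β) x, v⁆ = 0) ∧
    (∀ i : Fin n, ⁅a ⊗ₜ[ℂ] K (m₀ + (r : ℤ) • β) i, v⁆ = 0) ∧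
    (∀ i : Fin n, ⁅a ⊗ₜ[ℂ] W (m₀ + (r : ℤ) • β) i, v⁆ = 0)

/-- Successive action of a list of Lie algebra elements on a module vector:
`actList [x₁, …, x_r] v = x₁ · (x₂ ⋯ (x_r · v))`. -/
def actList {L V : Type*} [LieRing L] [AddCommGroup V] [LieRingModule L V] :
    List L → V → V
  | [], v => v
  | x :: xs, v => ⁅x, actList xs v⁆

/-- `V` is a highest weight module for `τ(B)`:  there are `M ≤ ℤⁿ` and `β ∈ ℤⁿ`
with `ℤⁿ = M ⊕ ℤβ` and a nonzero `v ∈ V` with `τ(B)^+_M · v = 0` which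
generates `V` over `U(τ(B))`. -/
def IsHighestWeightModule (B : Type) [CommRing B] [Algebra ℂ B]
    (E : (Fin n → ℤ) → 𝔤 →ₗ[ℂ] τ) (K W : (Fin n → ℤ) → Fin n → τ)
    (V : Type) [AddCommGroup V] [Module ℂ V] [LieRingModule (B ⊗[ℂ] τ) V]
    [LieModule ℂ (B ⊗[ℂ] τ) V] : Prop :=
  ∃ (M : AddSubgroup (Fin n → ℤ)) (β : Fin n → ℤ),
    IsCompl M (AddSubgroup.zmultiples β) ∧
    ∃ v : V, v ≠ 0 ∧ annPlus B E K W M β v ∧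
      LieSubmodule.lieSpan ℂ (B ⊗[ℂ] τ) {v} = ⊤

/-- Linear independence properties of the generators of the full toroidal Lie
algebra: the only linear relations among the homogeneous generators are the
Kähler relations `∑ᵢ mᵢ t^m K_i = 0`. -/
structure FreeGens (E : (Fin n → ℤ) → 𝔤 →ₗ[ℂ] τ) (K W : (Fin n → ℤ) → Fin n → τ) :
    Prop where
  K_indep : ∀ (m : Fin n → ℤ) (c : Fin n → ℂ), (∑ i, c i • K m i) = 0 →
      ∃ t : ℂ, ∀ i, c i = t * (m i : ℂ)
  W_indep : ∀ (m : Fin n → ℤ) (c : Fin n → ℂ), (∑ i, c i • W m i) = 0 → ∀ i, c i = 0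
  E_inj : ∀ (m : Fin n → ℤ) (x : 𝔤), E m x = 0 → x = 0
  EKW_indep : ∀ (m : Fin n → ℤ) (x : 𝔤) (c d : Fin n → ℂ),
      E m x + (∑ i, c i • K m i) + (∑ i, d i • W m i) = 0 →
      x = 0 ∧ (∀ i, d i = 0) ∧ ∃ t : ℂ, ∀ i, c i = t * (m i : ℂ)
  graded_indep : ∀ m : Fin n → ℤ,
      gradedPiece E K W m ⊓ (⨆ k : Fin n → ℤ, ⨆ _ : k ≠ m, gradedPiece E K W k) = ⊥

end MT

namespace Tor

/-- A Lie algebra with finite-dimensional homogeneous subspaces `g m`, `m ∈ ℤ^r`, in which distinct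
degrees generate, graded by degree operators `D` through an embedding `ι` of lattices. -/
structure GAlg (r n : ℕ) (τ : Type) [LieRing τ] [LieAlgebra ℂ τ] where
  g : (Fin r → ℤ) → Submodule ℂ τ
  D : Fin n → τ
  ι : (Fin r → ℤ) →+ (Fin n → ℤ)
  q : ℕ
  inj : Function.Injective ι
  fd : ∀ m, ∃ s : Fin q → τ, Submodule.span ℂ (Set.range s) = g m
  lie_mem : ∀ {m k X Y}, X ∈ g m → Y ∈ g k → ⁅X, Y⁆ ∈ g (m + k)
  gen : ∀ {m k} (N : Submodule ℂ τ), m ≠ k → (∀ X ∈ g m, ∀ Y ∈ g k, ⁅X, Y⁆ ∈ N) → g (m + k) ≤ N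
  D_mem : ∀ i, D i ∈ g 0
  lie_D : ∀ {m X} i, X ∈ g m → ⁅D i, X⁆ = (ι m i : ℂ) • X

variable {r n : ℕ} {τ : Type} [LieRing τ] [LieAlgebra ℂ τ]

/-- The degree of `m` as a complex weight. -/
def GAlg.ic (A : GAlg r n τ) : (Fin r → ℤ) →+ (Fin n → ℂ) where
  toFun m := fun i => (A.ι m i : ℂ)
  map_zero' := by ext i; simp
  map_add' a b := by ext i; simp

theorem GAlg.ic_apply (A : GAlg r n τ) (m : Fin r → ℤ) (i : Fin n) : A.ic m i = (A.ι m i : ℂ) := rfl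

theorem GAlg.ic_inj (A : GAlg r n τ) : Function.Injective A.ic := by
  intro a b h
  apply A.inj
  ext i
  have := congrFun h i
  simpa [GAlg.ic_apply] using this

/-- Operators attached to `τ ⊗ B` on `V`, satisfying the commutation law on homogeneous elements. -/
structure GRep (A : GAlg r n τ) (B : Type) [CommRing B] [Algebra ℂ B] (V : Type)
    [AddCommGroup V] [Module ℂ V] where
  ρ : B →ₗ[ℂ] τ →ₗ[ℂ] V →ₗ[ℂ] V
  comm : ∀ {m k X Y}, X ∈ A.g m → Y ∈ A.g k → ∀ b c v,
    ρ b X (ρ c Y v) = ρ c Y (ρ b X v) + ρ (b * c) ⁅X, Y⁆ v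

variable {A : GAlg r n τ} {B : Type} [CommRing B] [Algebra ℂ B] {V : Type}
    [AddCommGroup V] [Module ℂ V]

/-- Weight spaces. -/
def GRep.wsp (R : GRep A B V) (l : Fin n → ℂ) : Submodule ℂ V :=
  ⨅ i, LinearMap.ker (R.ρ 1 (A.D i) - algebraMap ℂ (Module.End ℂ V) (l i))

theorem GRep.mem_wsp {R : GRep A B V} {l : Fin n → ℂ} {v : V} :
    v ∈ R.wsp l ↔ ∀ i, R.ρ 1 (A.D i) v = l i • v := by
  simp [GRep.wsp, sub_eq_zero, Module.algebraMap_end_apply]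

theorem GRep.shift {R : GRep A B V} {l : Fin n → ℂ} {v : V} (hv : v ∈ R.wsp l) {m X}
    (hX : X ∈ A.g m) (b : B) : R.ρ b X v ∈ R.wsp (l + A.ic m) := by
  rw [GRep.mem_wsp] at hv ⊢
  intro i
  rw [R.comm (A.D_mem i) hX, hv i, A.lie_D i hX]
  simp [GAlg.ic_apply, add_smul]

theorem GRep.shift' {R : GRep A B V} {l l' : Fin n → ℂ} {v : V} (hv : v ∈ R.wsp l) {m X}
    (hX : X ∈ A.g m) (b : B) (h : l' = l + A.ic m) : R.ρ b X v ∈ R.wsp l' := h ▸ R.shift hv hX b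

theorem GRep.indep (R : GRep A B V) : iSupIndep R.wsp := by
  have h := Module.End.independent_iInf_maxGenEigenspace_of_forall_mapsTo
    (R := ℂ) (M := V) (fun i => R.ρ 1 (A.D i)) ?_
  · refine h.mono ?_
    intro l
    refine iInf_mono fun i => ?_
    intro v hv
    refine (Module.End.mem_maxGenEigenspace _ _ _).2 ⟨1, ?_⟩
    simpa [Algebra.algebraMap_eq_smul_one] using hv
  · intro i j φ
    apply Module.End.mapsTo_maxGenEigenspace_of_comm
    ext v
    have := R.comm (A.D_mem j) (A.D_mem i) 1 1 v
    rw [A.lie_D j (A.D_mem i)] at this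
    simpa using this

/-- Irreducible representations with finite-dimensional weight spaces, nontrivial, on which every
direction carries a copy of the relations of `sl₂`. -/
structure GRep.Good (R : GRep A B V) : Prop where
  irr : ∀ W : Submodule ℂ V, (∀ b m, ∀ X ∈ A.g m, ∀ v ∈ W, R.ρ b X v ∈ W) → W = ⊥ ∨ W = ⊤
  top : ⨆ l, R.wsp l = ⊤
  fin : ∀ l, FiniteDimensional ℂ (R.wsp l)
  nt : ∃ b m, ∃ X ∈ A.g m, ∃ v, R.ρ b X v ≠ 0
  sl2 : ∀ k, k ≠ 0 → ∀ μ : Fin n → ℂ, ∃ e ∈ A.g k, ∃ f ∈ A.g (-k), ∃ ζ : ℂ, ∀ x : ℤ,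
    ∀ v ∈ R.wsp (μ + A.ic (x • k)), R.ρ 1 ⁅e, f⁆ v = -(2 * (x : ℂ) + ζ) • v

/-- A vector is killed by the `ε`-part of degree `m`. -/
def GRep.Kills (R : GRep A B V) (ε : B) (m : Fin r → ℤ) (v : V) : Prop :=
  ∀ b, ∀ X ∈ A.g m, R.ρ (ε * b) X v = 0

/-- `ε` acts as an idempotent. -/
def GRep.Idem (R : GRep A B V) (ε : B) : Prop := ∀ b m, ∀ X ∈ A.g m, R.ρ (ε * ε * b) X = R.ρ (ε * b) X

theorem GRep.idem_one (R : GRep A B V) : R.Idem 1 := by intro b m X _; simp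

theorem GRep.kills_one {R : GRep A B V} {m v} : R.Kills 1 m v ↔ ∀ b, ∀ X ∈ A.g m, R.ρ b X v = 0 := by
  simp [GRep.Kills]

theorem GRep.gen_kill (R : GRep A B V) {m k : Fin r → ℤ} (hmk : m ≠ k) (b : B) (v : V)
    (h : ∀ X ∈ A.g m, ∀ Y ∈ A.g k, R.ρ b ⁅X, Y⁆ v = 0) {Z} (hZ : Z ∈ A.g (m + k)) :
    R.ρ b Z v = 0 := by
  have := A.gen (LinearMap.ker ((R.ρ b).flip v)) hmk (fun X hX Y hY => by simpa using h X hX Y hY) hZ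
  simpa using this

theorem GRep.lie_act (R : GRep A B V) {m k X Y} (hX : X ∈ A.g m) (hY : Y ∈ A.g k) (b c : B) (v : V) :
    R.ρ (b * c) ⁅X, Y⁆ v = R.ρ b X (R.ρ c Y v) - R.ρ c Y (R.ρ b X v) := by
  rw [R.comm hX hY]; abel

theorem GRep.kills_add {R : GRep A B V} {ε : B} (hε : R.Idem ε) {m k : Fin r → ℤ} (hmk : m ≠ k) {v : V}
    (h1 : R.Kills ε m v) (h2 : R.Kills ε k v) : R.Kills ε (m + k) v := by
  intro b Z hZ
  refine R.gen_kill hmk _ v ?_ hZ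
  intro X hX Y hY
  rw [← hε b _ _ (A.lie_mem hX hY), show ε * ε * b = (ε * 1) * (ε * b) by ring, R.lie_act hX hY, h1 1 X hX,
    h2 b Y hY]
  simp

theorem GRep.box_kills {R : GRep A B V} {ε : B} (hε : R.Idem ε) (hr : 1 ≤ r) {m : Fin r → ℤ} {v : V}
    (h : ∀ s : Fin r → ℤ, (∀ i, |s i| ≤ 2) → R.Kills ε (m + s) v) (x : ℕ) :
    ∀ s : Fin r → ℤ, (∀ i, |s i| ≤ x + 1) → R.Kills ε (((x : ℤ) + 1) • m + s) v := by
  induction x with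
  | zero =>
    intro s hs
    have := h s (fun i => (hs i).trans (by norm_num))
    simpa using this
  | succ x ih =>
    intro s hs
    set t : Fin r → ℤ := fun i => if 0 < s i then s i - 1 else if s i < 0 then s i + 1 else 0 with ht
    set i0 : Fin r := ⟨0, hr⟩
    set t' : Fin r → ℤ := fun i => if i = i0 then
      (if 0 < s i then s i - 2 else if s i < 0 then s i + 2 else 1) else t i with ht'
    have hb : ∀ i, |t i| ≤ x + 1 ∧ |s i - t i| ≤ 2 := by
      intro i
      have := hs i
      push_cast at this
      simp only [ht]
      rw [abs_le] at this
      constructor <;> rw [abs_le] <;> split_ifs <;> omega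
    have hb' : ∀ i, |t' i| ≤ x + 1 ∧ |s i - t' i| ≤ 2 := by
      intro i
      simp only [ht']
      by_cases hi : i = i0
      · have := hs i
        push_cast at this
        rw [if_pos hi]
        rw [abs_le] at this
        constructor <;> rw [abs_le] <;> split_ifs <;> omega
      · rw [if_neg hi]; exact hb i
    have key : ∀ u : Fin r → ℤ, (∀ i, |u i| ≤ x + 1 ∧ |s i - u i| ≤ 2) →
        ((x : ℤ) + 1) • m + u ≠ m + (s - u) → R.Kills ε ((((x + 1 : ℕ) : ℤ) + 1) • m + s) v := by
      intro u hu hne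
      have := kills_add hε hne (ih u (fun i => (hu i).1)) (h (s - u) (fun i => (hu i).2))
      convert this using 1
      push_cast
      module
    by_cases h1 : ((x : ℤ) + 1) • m + t ≠ m + (s - t)
    · exact key t hb h1
    · refine key t' hb' ?_
      intro h2
      push Not at h1
      have e1 := congrFun h1 i0
      have e2 := congrFun h2 i0
      simp only [Pi.add_apply, Pi.sub_apply] at e1 e2
      have : t i0 = t' i0 := by linarith
      simp only [ht, ht', if_true] at this
      split_ifs at this <;> omega

/-- Cluster index: a sign and a vector of the box of radius two. -/
abbrev CI (r : ℕ) := Bool × {s : Fin r → ℤ // s ∈ Finset.Icc (fun _ => (-2 : ℤ)) (fun _ => 2)}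

/-- Cluster points `±N e_j + s₀`. -/
def cs (N : ℤ) (j : Fin r) (c : CI r) : Fin r → ℤ :=
  Pi.single j (if c.1 then N else -N) + c.2.1

theorem ci_bound (c : CI r) (i : Fin r) : |c.2.1 i| ≤ 2 := by
  have := Finset.mem_Icc.1 c.2.2
  exact abs_le.2 ⟨this.1 i, this.2 i⟩

theorem cs_same (N : ℤ) (j : Fin r) (c : CI r) : cs N j c j = (if c.1 then N else -N) + c.2.1 j := by
  simp [cs]

theorem cs_ne (N : ℤ) {i j : Fin r} (h : i ≠ j) (c : CI r) : cs N j c i = c.2.1 i := by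
  simp [cs, h]

theorem GRep.cluster_kills {R : GRep A B V} {ε : B} (hε : R.Idem ε) {m : Fin r → ℤ} {v : V}
    {N : ℤ} (hN : 2 < N) (j : Fin r) (h : ∀ c, R.Kills ε (m + cs N j c) v)
    (s : Fin r → ℤ) (hs : ∀ i, |s i| ≤ 4) : R.Kills ε ((2 : ℤ) • m + s) v := by
  have e : ∀ i, |s i / 2| ≤ 2 ∧ |s i - s i / 2| ≤ 2 := by
    intro i
    have := abs_le.1 (hs i)
    constructor <;> rw [abs_le] <;> omega
  let c1 : CI r := (true, ⟨fun i => s i / 2, Finset.mem_Icc.2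
    ⟨fun i => (abs_le.1 (e i).1).1, fun i => (abs_le.1 (e i).1).2⟩⟩)
  let c2 : CI r := (false, ⟨fun i => s i - s i / 2, Finset.mem_Icc.2
    ⟨fun i => (abs_le.1 (e i).2).1, fun i => (abs_le.1 (e i).2).2⟩⟩)
  have hne : m + cs N j c1 ≠ m + cs N j c2 := by
    intro h0
    have h1 := congrFun h0 j
    simp only [Pi.add_apply, cs_same] at h1
    simp only [c1, c2, if_true, Bool.false_eq_true, if_false] at h1
    have := abs_le.1 (hs j)
    omega
  have := kills_add hε hne (h c1) (h c2)
  convert this using 1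
  ext i
  by_cases hi : i = j
  · subst hi
    simp [cs, c1, c2]
    ring
  · simp [cs, c1, c2, hi]
    ring

end Tor

namespace Tor

/-- In a graded `sl₂`-situation with locally nilpotent raising operator the degrees are bounded above. -/
theorem sl2_bounded {P : Type} [AddCommGroup P] [Module ℂ P] (e f : P →ₗ[ℂ] P) (U : ℤ → Submodule ℂ P)
    (hfin : ∀ x, FiniteDimensional ℂ (U x)) (he : ∀ x, ∀ v ∈ U x, e v ∈ U (x + 1))
    (hf : ∀ x, ∀ v ∈ U x, f v ∈ U (x - 1)) (ζ : ℂ)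
    (h : ∀ x, ∀ v ∈ U x, e (f v) - f (e v) = -(2 * (x : ℂ) + ζ) • v)
    (hn : ∀ x, ∀ v ∈ U x, ∃ i, (e ^ i) v = 0) : ∃ x0, ∀ x ≥ x0, U x = ⊥ := by
  have hpow : ∀ (i : ℕ) x, ∀ v ∈ U x, (e ^ i) v ∈ U (x + i) := by
    intro i
    induction i with
    | zero => intro x v hv; simpa using hv
    | succ i ih =>
      intro x v hv
      rw [pow_succ', Module.End.mul_apply]
      have := he _ _ (ih x v hv)
      push_cast
      rwa [← add_assoc]
  have hcomm : ∀ (i : ℕ) x, ∀ v ∈ U x,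
      f ((e ^ (i + 1)) v) = (e ^ (i + 1)) (f v) + ((i + 1 : ℂ) * (2 * (x : ℂ) + i + ζ)) • (e ^ i) v := by
    intro i
    induction i with
    | zero =>
      intro x v hv
      have := h x v hv
      simp only [zero_add, pow_one, pow_zero, Module.End.one_apply]
      rw [sub_eq_iff_eq_add] at this
      rw [this]
      push_cast
      module
    | succ i ih =>
      intro x v hv
      have h1 := h _ _ (hpow (i + 1) x v hv)
      rw [sub_eq_iff_eq_add, ih x v hv, map_add, map_smul] at h1
      rw [pow_succ' e (i + 1), Module.End.mul_apply, Module.End.mul_apply]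
      have h2 : e ((e ^ i) v) = (e ^ (i + 1)) v := by rw [pow_succ', Module.End.mul_apply]
      rw [h2] at h1
      have h3 : f (e ((e ^ (i + 1)) v)) = e ((e ^ (i + 1)) (f v)) +
          ((i + 1 : ℂ) * (2 * (x : ℂ) + i + ζ)) • (e ^ (i + 1)) v
          + (2 * ((x + (i + 1 : ℕ) : ℤ) : ℂ) + ζ) • (e ^ (i + 1)) v := by
        rw [h1]; module
      rw [h3]
      push_cast
      module
  obtain ⟨X, hX⟩ : ∃ X : ℤ, ∀ x ≥ X, ∀ i : ℕ, ((i + 1 : ℂ) * (2 * (x : ℂ) + i + ζ)) ≠ 0 := by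
    refine ⟨⌈‖ζ‖⌉ + 1, fun x hx i => mul_ne_zero (by exact_mod_cast Nat.succ_ne_zero i) ?_⟩
    intro h0
    have h1 := congrArg Complex.re h0
    simp at h1
    have h2 := Complex.abs_re_le_norm ζ
    have h3 := (abs_le.1 h2).1
    have h4 : (‖ζ‖ : ℝ) + 1 ≤ x := by
      have : ((⌈‖ζ‖⌉ + 1 : ℤ) : ℝ) ≤ x := by exact_mod_cast hx
      push_cast at this
      linarith [Int.le_ceil (‖ζ‖)]
    have : (0 : ℝ) ≤ i := by positivity
    have := norm_nonneg ζ
    linarith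
  have hz : ∀ x ≥ X, ∀ v ∈ U x, e (f v) = 0 → v = 0 := by
    intro x hx v hv hef
    have : ∀ i : ℕ, (e ^ i) v = 0 → v = 0 := by
      intro i
      induction i with
      | zero => intro h; simpa using h
      | succ i ih =>
        intro hi
        have := hcomm i x v hv
        rw [hi, map_zero, pow_succ, Module.End.mul_apply, hef, map_zero, zero_add] at this
        exact ih ((smul_eq_zero.1 this.symm).resolve_left (hX x hx i))
    obtain ⟨i, hi⟩ := hn x v hv
    exact this i hi
  let F : ∀ x, U x →ₗ[ℂ] U (x - 1) := fun x => f.restrict (hf x)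
  have hF : ∀ x ≥ X, Function.Injective (F x) := by
    intro x hx
    rw [← LinearMap.ker_eq_bot, LinearMap.ker_eq_bot']
    intro v hv
    have : f v.1 = 0 := congrArg Subtype.val hv
    exact Subtype.ext (hz x hx v.1 v.2 (by rw [this, map_zero]))
  have hle : ∀ x ≥ X, Module.finrank ℂ (U x) ≤ Module.finrank ℂ (U (x - 1)) := fun x hx =>
    have := hfin (x - 1)
    LinearMap.finrank_le_finrank_of_injective (hF x hx)
  let a : ℕ → ℕ := fun i => Module.finrank ℂ (U (X + i))
  have ha : Antitone a := by
    apply antitone_nat_of_succ_le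
    intro i
    have := hle (X + (i + 1 : ℕ)) (by push_cast; linarith)
    rw [show X + ((i + 1 : ℕ) : ℤ) - 1 = X + i by push_cast; ring] at this
    exact this
  obtain ⟨_, ⟨N, rfl⟩, hN⟩ := (wellFounded_lt (α := ℕ)).has_min (Set.range a) ⟨_, 0, rfl⟩
  have hN' : ∀ m ≥ N, a N = a m := by
    intro m hm
    have h1 := ha hm
    have h2 := hN (a m) ⟨m, rfl⟩
    omega
  refine ⟨X + N, fun x hx => ?_⟩
  by_contra hne
  obtain ⟨v, hv, hv0⟩ := Submodule.exists_mem_ne_zero_of_ne_bot hne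
  obtain ⟨w, y, hy, hw, hw0, hew⟩ : ∃ w, ∃ y ≥ X + N, w ∈ U y ∧ w ≠ 0 ∧ e w = 0 := by
    classical
    have hex := hn x v hv
    have hs := Nat.find_spec hex
    rcases hq : Nat.find hex with _ | j
    · rw [hq] at hs; exact absurd (by simpa using hs) hv0
    · rw [hq] at hs
      refine ⟨(e ^ j) v, x + j, by omega, hpow j x v hv, ?_, ?_⟩
      · exact Nat.find_min hex (by omega)
      · rwa [pow_succ', Module.End.mul_apply] at hs
  obtain ⟨j, rfl⟩ : ∃ j : ℕ, y = X + j := ⟨(y - X).toNat, by omega⟩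
  have hj : N ≤ j := by omega
  have hr : Module.finrank ℂ (U (X + j + 1)) = Module.finrank ℂ (U (X + j + 1 - 1)) := by
    have h1 := hN' j hj
    have h2 := hN' (j + 1) (by omega)
    simp only [a] at h1 h2
    rw [show X + (j : ℤ) + 1 - 1 = X + j by ring]
    push_cast at h2
    rw [show X + (j : ℤ) + 1 = X + (j + 1) by ring]
    omega
  have := hfin (X + j + 1)
  have := hfin (X + j + 1 - 1)
  have hsurj : Function.Surjective (F (X + j + 1)) :=
    (LinearMap.injective_iff_surjective_of_finrank_eq_finrank hr).1 (hF _ (by omega))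
  obtain ⟨w', hw'⟩ := hsurj ⟨w, by simpa using hw⟩
  have h5 : f w'.1 = w := congrArg Subtype.val hw'
  have := hz _ (by omega) w'.1 w'.2 (by rw [h5, hew])
  rw [this, map_zero] at h5
  exact hw0 h5.symm

variable {r n : ℕ} {τ : Type} [LieRing τ] [LieAlgebra ℂ τ]
variable {A : GAlg r n τ} {B : Type} [CommRing B] [Algebra ℂ B] {V : Type}
    [AddCommGroup V] [Module ℂ V]

/-- Vectors killed deep inside the cone around `m`. -/
def GRep.deep (R : GRep A B V) (ε : B) (m : Fin r → ℤ) : Submodule ℂ V where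
  carrier := {v | ∃ N : ℤ, ∀ x : ℤ, ∀ s : Fin r → ℤ, (∀ i, |s i| + N ≤ x) → R.Kills ε (x • m + s) v}
  zero_mem' := ⟨0, fun _ _ _ b X _ => map_zero _⟩
  add_mem' := by
    rintro v w ⟨N, hN⟩ ⟨N', hN'⟩
    refine ⟨max N N', fun x s h b X hX => ?_⟩
    rw [map_add, hN x s (fun i => le_trans (by simp) (h i)) b X hX,
      hN' x s (fun i => le_trans (by simp) (h i)) b X hX, add_zero]
  smul_mem' := by
    rintro c v ⟨N, hN⟩
    refine ⟨N, fun x s h b X hX => ?_⟩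
    rw [map_smul, hN x s h b X hX, smul_zero]

theorem GRep.kills_lie {R : GRep A B V} {ε : B} {k j : Fin r → ℤ} {v : V} (h1 : R.Kills ε k v)
    (h2 : R.Kills ε (k + j) v) (b : B) {X} (hX : X ∈ A.g j) : R.Kills ε k (R.ρ b X v) := by
  intro c Y hY
  rw [R.comm hY hX, h1 c Y hY, mul_assoc, h2 _ _ (A.lie_mem hY hX)]
  simp

theorem exists_bound (j : Fin r → ℤ) : ∃ C : ℤ, ∀ i, |j i| ≤ C :=
  ⟨∑ i, |j i|, fun i => Finset.single_le_sum (f := fun i => |j i|) (fun _ _ => abs_nonneg _)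
    (Finset.mem_univ i)⟩

theorem GRep.deep_stable (R : GRep A B V) (ε : B) (m : Fin r → ℤ) (b : B) {j X} (hX : X ∈ A.g j) {v}
    (hv : v ∈ R.deep ε m) : R.ρ b X v ∈ R.deep ε m := by
  obtain ⟨N, hN⟩ := hv
  obtain ⟨C, hC⟩ := exists_bound j
  refine ⟨max N (N + C), fun x s hs => ?_⟩
  refine kills_lie (hN x s fun i => (hs i).trans' (by simp)) ?_ b hX
  rw [add_assoc]
  refine hN x (s + j) fun i => ?_
  have := hs i
  have h1 := hC i
  have h2 := abs_add_le (s i) (j i)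
  have h3 := le_max_right N (N + C)
  simp only [Pi.add_apply]
  linarith

/-- The cone around `m`. -/
def cone (m : Fin r → ℤ) : Set (Fin r → ℤ) := {k | ∃ (x : ℤ) (s : Fin r → ℤ), k = x • m + s ∧ 0 < x ∧ ∀ i, |s i| < x}

theorem GRep.nil_stable (R : GRep A B V) (m : Fin r → ℤ) {k} (hk : k ∈ cone m) {Y} (hY : Y ∈ A.g k)
    (b : B) {j X} (hX : X ∈ A.g j) {v} (hv : v ∈ R.deep 1 m) {p : ℕ} (hp : ((R.ρ 1 Y) ^ p) v = 0) :
    ∃ p', ((R.ρ 1 Y) ^ p') (R.ρ b X v) = 0 := by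
  obtain ⟨x0, s0, rfl, hx0, hs0⟩ := hk
  set e := R.ρ 1 Y with he
  have hev : ∀ t : ℕ, (e ^ t) v ∈ R.deep 1 m := by
    intro t
    induction t with
    | zero => simpa using hv
    | succ t ih => rw [pow_succ', Module.End.mul_apply]; exact R.deep_stable 1 m 1 hY ih
  choose N hN using hev
  obtain ⟨C, hC⟩ := exists_bound j
  obtain ⟨a0, ha0⟩ : ∃ a0 : ℕ, ∀ t < p, N t + C ≤ a0 := by
    refine ⟨∑ t ∈ Finset.range p, (N t + C).toNat, fun t ht => ?_⟩
    have := Finset.single_le_sum (f := fun t => (N t + C).toNat) (fun _ _ => Nat.zero_le _)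
      (Finset.mem_range.2 ht)
    zify at this
    refine le_trans (Int.self_le_toNat _) ?_
    simpa using this
  have base : ∀ (t a : ℕ), a0 + p ≤ a + t → ∀ b, ∀ X ∈ A.g (j + (a : ℤ) • (x0 • m + s0)), R.ρ b X ((e ^ t) v) = 0 := by
    intro t a hat b X hX
    by_cases ht : p ≤ t
    · obtain ⟨u, rfl⟩ := Nat.exists_eq_add_of_le ht
      rw [add_comm, pow_add, Module.End.mul_apply, hp, map_zero, map_zero]
    · push Not at ht
      have h1 := hN t ((a : ℤ) * x0) (j + (a : ℤ) • s0) ?_ b X (by convert hX using 2; module)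
      · simpa using h1
      · intro i
        have h2 := ha0 t ht
        have h3 := hC i
        have h4 := hs0 i
        have h5 : |(j + (a : ℤ) • s0) i| ≤ |j i| + a * |s0 i| := by
          simp only [Pi.add_apply, Pi.smul_apply, smul_eq_mul]
          refine (abs_add_le _ _).trans ?_
          rw [abs_mul]
          simp
        have h6 : (a : ℤ) * |s0 i| ≤ a * (x0 - 1) := by
          apply mul_le_mul_of_nonneg_left (by omega) (by positivity)
        have h7 : (a0 : ℤ) ≤ a := by omega
        linarith
  have main : ∀ (q t a : ℕ), a0 + p ≤ q + a + t → ∀ b, ∀ X ∈ A.g (j + (a : ℤ) • (x0 • m + s0)),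
      (e ^ q) (R.ρ b X ((e ^ t) v)) = 0 := by
    intro q
    induction q with
    | zero => intro t a hat b X hX; simpa using base t a (by omega) b X hX
    | succ q ih =>
      intro t a hat b X hX
      rw [pow_succ, Module.End.mul_apply, he, R.comm hY hX, map_add, ← he, ← Module.End.mul_apply (f := e),
        ← pow_succ', ih (t + 1) a (by omega) b X hX, zero_add]
      refine ih t (a + 1) (by omega) _ _ ?_
      have := A.lie_mem hY hX
      convert this using 2
      push_cast
      module
  refine ⟨a0 + p, ?_⟩
  have := main (a0 + p) 0 0 (by omega) b X (by simpa using hX)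
  simpa using this

/-- Directions in which weights are bounded above. -/
def GRep.Bd (R : GRep A B V) : Set (Fin r → ℤ) :=
  {k | ∀ μ : Fin n → ℂ, ∃ x0 : ℤ, ∀ x ≥ x0, R.wsp (μ + A.ic (x • k)) = ⊥}

theorem GRep.deep_of_box (R : GRep A B V) {ε : B} (hε : R.Idem ε) (hr : 1 ≤ r) {m : Fin r → ℤ} {v : V}
    (h : ∀ s : Fin r → ℤ, (∀ i, |s i| ≤ 2) → R.Kills ε (m + s) v) : v ∈ R.deep ε m := by
  refine ⟨1, fun x s hs => ?_⟩
  have h1 := hs ⟨0, hr⟩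
  have h2 := abs_nonneg (s ⟨0, hr⟩)
  obtain ⟨y, rfl⟩ : ∃ y : ℕ, x = y + 1 := ⟨(x - 1).toNat, by omega⟩
  exact box_kills hε hr h y s fun i => by have := hs i; linarith

theorem GRep.deep_eq_top {R : GRep A B V} (hR : R.Good) {ε : B} {m : Fin r → ℤ} {v : V} (hv0 : v ≠ 0)
    (hv : v ∈ R.deep ε m) : R.deep ε m = ⊤ := by
  refine (hR.irr (R.deep ε m) (fun b j X hX v hv => R.deep_stable ε m b hX hv)).resolve_left ?_
  intro h0
  rw [h0] at hv
  exact hv0 hv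

/-- Vectors of the deep part on which a given operator is nilpotent. -/
def GRep.nilp (R : GRep A B V) (m : Fin r → ℤ) (Y : τ) : Submodule ℂ V where
  carrier := {v | v ∈ R.deep 1 m ∧ ∃ p, ((R.ρ 1 Y) ^ p) v = 0}
  zero_mem' := ⟨zero_mem _, 0, map_zero _⟩
  add_mem' := by
    rintro v w ⟨hv, p, hp⟩ ⟨hw, q, hq⟩
    refine ⟨add_mem hv hw, p + q, ?_⟩
    rw [map_add, pow_add, Module.End.mul_apply, Module.End.mul_apply, hq, map_zero, add_zero,
      ← Module.End.mul_apply, ← pow_add, add_comm, pow_add, Module.End.mul_apply, hp, map_zero]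
  smul_mem' := by
    rintro c v ⟨hv, p, hp⟩
    exact ⟨Submodule.smul_mem _ c hv, p, by rw [map_smul, hp, smul_zero]⟩

theorem GRep.nilp_stable (R : GRep A B V) (m : Fin r → ℤ) {k} (hk : k ∈ cone m) {Y} (hY : Y ∈ A.g k)
    (b : B) {j X} (hX : X ∈ A.g j) {v} (hv : v ∈ R.nilp m Y) : R.ρ b X v ∈ R.nilp m Y := by
  obtain ⟨h1, p, hp⟩ := hv
  exact ⟨R.deep_stable 1 m b hX h1, R.nil_stable m hk hY b hX h1 hp⟩

theorem GRep.mem_nilp_of_box (R : GRep A B V) (hr : 1 ≤ r) {m : Fin r → ℤ} {v : V}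
    (h : ∀ s : Fin r → ℤ, (∀ i, |s i| ≤ 2) → R.Kills 1 (m + s) v) {k} (hk : k ∈ cone m) {Y}
    (hY : Y ∈ A.g k) : v ∈ R.nilp m Y := by
  refine ⟨R.deep_of_box R.idem_one hr h, 1, ?_⟩
  obtain ⟨x, s, rfl, hx, hs⟩ := hk
  obtain ⟨y, rfl⟩ : ∃ y : ℕ, x = y + 1 := ⟨(x - 1).toNat, by omega⟩
  have := box_kills R.idem_one hr h y s (fun i => (hs i).le) 1 Y hY
  simpa using this

theorem cone_ne_zero {m : Fin r → ℤ} (hm : m ≠ 0) {k} (hk : k ∈ cone m) : k ≠ 0 := by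
  obtain ⟨x, s, rfl, hx, hs⟩ := hk
  intro h
  apply hm
  ext i
  have h1 := congrFun h i
  simp only [Pi.add_apply, Pi.smul_apply, smul_eq_mul, Pi.zero_apply] at h1 ⊢
  by_contra h2
  have h3 := hs i
  rw [show s i = -(x * m i) by linarith, abs_neg, abs_mul, abs_of_pos hx] at h3
  have : 1 ≤ |m i| := Int.one_le_abs h2
  nlinarith

theorem GRep.pow_shift {R : GRep A B V} {l : Fin n → ℂ} {v : V} (hv : v ∈ R.wsp l) {m X}
    (hX : X ∈ A.g m) (b : B) (p : ℕ) : ((R.ρ b X) ^ p) v ∈ R.wsp (l + A.ic ((p : ℤ) • m)) := by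
  induction p with
  | zero => simpa using hv
  | succ p ih =>
    rw [pow_succ', Module.End.mul_apply]
    refine R.shift' ih hX b ?_
    rw [add_assoc, ← map_add]
    congr 2
    push_cast
    module

/-- A nonzero vector killed by a box makes the weights bounded above along the cone. -/
theorem GRep.box_Bd {R : GRep A B V} (hR : R.Good) (hr : 1 ≤ r) {m : Fin r → ℤ} (hm : m ≠ 0) {v : V}
    (hv : v ≠ 0) (h : ∀ s : Fin r → ℤ, (∀ i, |s i| ≤ 2) → R.Kills 1 (m + s) v) : cone m ⊆ R.Bd := by
  intro k hk μ
  obtain ⟨e, he, f, hf, ζ, hs⟩ := hR.sl2 k (cone_ne_zero hm hk) μ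
  have htop : R.nilp m e = ⊤ := by
    refine (hR.irr _ (fun b j X hX v hv => R.nilp_stable m hk he b hX hv)).resolve_left ?_
    intro h0
    have := R.mem_nilp_of_box hr h hk he
    rw [h0] at this
    exact hv this
  refine sl2_bounded (R.ρ 1 e) (R.ρ 1 f) (fun x => R.wsp (μ + A.ic (x • k))) (fun x => hR.fin _) ?_ ?_ ζ ?_ ?_
  · intro x v hv
    refine R.shift' hv he 1 ?_
    rw [add_smul, one_smul, map_add, add_assoc]
  · intro x v hv
    refine R.shift' hv hf 1 ?_
    rw [sub_smul, one_smul, sub_eq_add_neg, map_add, add_assoc]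
  · intro x v hv
    rw [← hs x v hv]
    have := R.lie_act he hf 1 1 v
    simpa using this.symm
  · intro x v _
    have : v ∈ R.nilp m e := htop ▸ Submodule.mem_top
    exact this.2

/-- The contragredient operators on the dual space. -/
def GRep.dual (R : GRep A B V) : GRep A B (Module.Dual ℂ V) where
  ρ := LinearMap.mk₂ ℂ (fun b X => -(R.ρ b X).dualMap)
    (fun b b' X => by ext; simp [add_comm]) (fun c b X => by ext; simp)
    (fun b X X' => by ext; simp [add_comm]) (fun c b X => by ext; simp)
  comm := by
    intro m k X Y hX hY b c ξ
    ext v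
    have := congrArg ξ (R.comm hX hY b c v)
    simp only [LinearMap.mk₂_apply, LinearMap.neg_apply, LinearMap.dualMap_apply', map_neg, neg_neg,
      LinearMap.add_apply, map_add] at this ⊢
    simp [this]

theorem GRep.dual_apply (R : GRep A B V) (b X) (ξ : Module.Dual ℂ V) (v : V) :
    R.dual.ρ b X ξ v = -ξ (R.ρ b X v) := by simp [GRep.dual]

theorem GRep.mem_wsp_dual {R : GRep A B V} (hR : R.Good) {l : Fin n → ℂ} {ξ : Module.Dual ℂ V} :
    ξ ∈ R.dual.wsp l ↔ ∀ l', l' ≠ -l → ∀ v ∈ R.wsp l', ξ v = 0 := by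
  rw [GRep.mem_wsp]
  constructor
  · intro h l' hl v hv
    obtain ⟨i, hi⟩ := Function.ne_iff.1 hl
    have h1 := LinearMap.congr_fun (h i) v
    rw [dual_apply, GRep.mem_wsp.1 hv i] at h1
    simp only [map_smul, smul_eq_mul, LinearMap.smul_apply] at h1
    have h2 : (l' i + l i) * ξ v = 0 := by linear_combination -h1
    refine (mul_eq_zero.1 h2).resolve_left ?_
    intro h3
    exact hi (by simp; linear_combination h3)
  · intro h i
    have : ∀ v : V, v ∈ (⊤ : Submodule ℂ V) → (R.dual.ρ 1 (A.D i) ξ) v = (l i • ξ) v := by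
      rw [← hR.top]
      intro v hv
      refine Submodule.iSup_induction R.wsp (motive := fun v => (R.dual.ρ 1 (A.D i) ξ) v = (l i • ξ) v) hv ?_ ?_ ?_
      · intro l' v hv
        rw [dual_apply, GRep.mem_wsp.1 hv i]
        simp only [map_smul, smul_eq_mul, LinearMap.smul_apply]
        by_cases hl : l' = -l
        · subst hl; simp
        · rw [h l' hl v hv]; simp
      · simp
      · intro a b ha hb; rw [map_add, map_add, ha, hb]
    ext v
    exact this v Submodule.mem_top

theorem GRep.exists_wsp_dual {R : GRep A B V} (hR : R.Good) {l : Fin n → ℂ} (h : R.dual.wsp l = ⊥) :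
    R.wsp (-l) = ⊥ := by
  by_contra hne
  obtain ⟨v, hv, hv0⟩ := Submodule.exists_mem_ne_zero_of_ne_bot hne
  have h1 : v ∉ ⨆ j, ⨆ _ : j ≠ -l, R.wsp j := fun h2 =>
    hv0 ((Submodule.disjoint_def.1 (R.indep (-l))) v hv h2)
  obtain ⟨ξ, hξ, hm⟩ := Submodule.exists_dual_map_eq_bot_of_notMem h1 inferInstance
  have : ξ ∈ R.dual.wsp l := by
    rw [mem_wsp_dual hR]
    intro l' hl v hv
    have : ξ v ∈ Submodule.map ξ (⨆ j, ⨆ _ : j ≠ -l, R.wsp j) :=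
      Submodule.mem_map_of_mem (Submodule.mem_iSup_of_mem l' (Submodule.mem_iSup_of_mem hl hv))
    rw [hm] at this
    simpa using this
  rw [h, Submodule.mem_bot] at this
  rw [this] at hξ
  exact hξ rfl

theorem GRep.dual_fin {R : GRep A B V} (hR : R.Good) (l : Fin n → ℂ) :
    FiniteDimensional ℂ (R.dual.wsp l) := by
  have := hR.fin (-l)
  let F : R.dual.wsp l →ₗ[ℂ] Module.Dual ℂ (R.wsp (-l)) :=
    (R.wsp (-l)).dualRestrict ∘ₗ (R.dual.wsp l).subtype
  refine FiniteDimensional.of_injective F ?_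
  rw [← LinearMap.ker_eq_bot, LinearMap.ker_eq_bot']
  intro ξ hξ
  apply Subtype.ext
  ext v
  have : ∀ v : V, v ∈ (⊤ : Submodule ℂ V) → ξ.1 v = 0 := by
    rw [← hR.top]
    intro v hv
    refine Submodule.iSup_induction R.wsp (motive := fun v => ξ.1 v = 0) hv ?_ ?_ ?_
    · intro l' v hv
      by_cases hl : l' = -l
      · subst hl
        exact LinearMap.congr_fun hξ ⟨v, hv⟩
      · exact (mem_wsp_dual hR).1 ξ.2 l' hl v hv
    · simp
    · intro a b ha hb; rw [map_add, ha, hb, add_zero]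
  exact this v Submodule.mem_top

theorem GRep.dual_pow (R : GRep A B V) (X) (ξ : Module.Dual ℂ V) (p : ℕ) (v : V) :
    ((R.dual.ρ 1 X) ^ p) ξ v = (-1) ^ p * ξ (((R.ρ 1 X) ^ p) v) := by
  induction p generalizing v with
  | zero => simp
  | succ p ih =>
    rw [pow_succ', Module.End.mul_apply, dual_apply, ih, pow_succ (R.ρ 1 X), Module.End.mul_apply, pow_succ]
    ring

theorem GRep.dual_nilp {R : GRep A B V} (hR : R.Good) {m k : Fin r → ℤ} (hk : k ∈ cone m) {Y} (hY : Y ∈ A.g k)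
    (hne : R.dual.nilp m Y ≠ ⊥) {l} {ξ} (hξ : ξ ∈ R.dual.wsp l) : ∃ p, ((R.dual.ρ 1 Y) ^ p) ξ = 0 := by
  have hco : (R.dual.nilp m Y).dualCoannihilator = ⊥ := by
    refine (hR.irr _ ?_).resolve_right ?_
    · intro b j X hX v hv
      rw [Submodule.mem_dualCoannihilator] at hv ⊢
      intro ξ hξ
      have := hv _ (R.dual.nilp_stable m hk hY b hX hξ)
      rw [dual_apply] at this
      simpa using this
    · intro h
      apply hne
      rw [eq_bot_iff]
      intro ξ hξ
      rw [Submodule.mem_bot]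
      ext v
      have : v ∈ (R.dual.nilp m Y).dualCoannihilator := h ▸ Submodule.mem_top
      exact (Submodule.mem_dualCoannihilator v).1 this ξ hξ
  have := hR.fin (-l)
  let Z : Submodule ℂ (Module.Dual ℂ (R.wsp (-l))) := (R.dual.nilp m Y).map (R.wsp (-l)).dualRestrict
  have hZ : Z = ⊤ := by
    have h1 : Z.dualCoannihilator = ⊥ := by
      rw [eq_bot_iff]
      intro v hv
      rw [Submodule.mem_dualCoannihilator] at hv
      have : v.1 ∈ (R.dual.nilp m Y).dualCoannihilator := by
        rw [Submodule.mem_dualCoannihilator]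
        intro ξ hξ
        exact hv _ (Submodule.mem_map_of_mem hξ)
      rw [hco, Submodule.mem_bot] at this
      rw [Submodule.mem_bot]
      exact Subtype.ext this
    rw [← Subspace.dualCoannihilator_dualAnnihilator_eq (W := Z), h1, Submodule.dualAnnihilator_bot]
  have h2 : (R.wsp (-l)).dualRestrict ξ ∈ Z := hZ ▸ Submodule.mem_top
  obtain ⟨ξ', ⟨_, p, hp⟩, he⟩ := h2
  refine ⟨p, ?_⟩
  ext v
  have : ∀ v : V, v ∈ (⊤ : Submodule ℂ V) → (((R.dual.ρ 1 Y) ^ p) ξ) v = 0 := by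
    rw [← hR.top]
    intro v hv
    refine Submodule.iSup_induction R.wsp (motive := fun v => (((R.dual.ρ 1 Y) ^ p) ξ) v = 0) hv ?_ ?_ ?_
    · intro l' v hv
      have h3 := R.pow_shift hv hY 1 p
      rw [dual_pow]
      by_cases hl : l' + A.ic ((p : ℤ) • k) = -l
      · rw [hl] at h3
        have h4 : ξ' (((R.ρ 1 Y) ^ p) v) = ξ (((R.ρ 1 Y) ^ p) v) := LinearMap.congr_fun he ⟨_, h3⟩
        have h5 := LinearMap.congr_fun hp v
        rw [dual_pow, h4] at h5
        simpa using h5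
      · rw [(mem_wsp_dual hR).1 hξ _ hl _ h3, mul_zero]
    · simp
    · intro a b ha hb; rw [map_add, ha, hb, add_zero]
  exact this v Submodule.mem_top

/-- A nonzero functional killed by a box makes the weights bounded below along the cone. -/
theorem GRep.box_Bd_dual {R : GRep A B V} (hR : R.Good) (hr : 1 ≤ r) {m : Fin r → ℤ} (hm : m ≠ 0)
    {ξ : Module.Dual ℂ V} (hξ : ξ ≠ 0)
    (h : ∀ s : Fin r → ℤ, (∀ i, |s i| ≤ 2) → R.dual.Kills 1 (m + s) ξ) {k} (hk : k ∈ cone m) : -k ∈ R.Bd := by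
  intro μ
  obtain ⟨e, he, f, hf, ζ, hs⟩ := hR.sl2 k (cone_ne_zero hm hk) μ
  have hne : R.dual.nilp m e ≠ ⊥ := by
    intro h0
    have := R.dual.mem_nilp_of_box hr h hk he
    rw [h0] at this
    exact hξ this
  suffices hB : ∃ x0 : ℤ, ∀ x ≥ x0, R.dual.wsp (-μ + A.ic (x • k)) = ⊥ by
    obtain ⟨x0, hx0⟩ := hB
    refine ⟨x0, fun x hx => ?_⟩
    have := exists_wsp_dual hR (hx0 x hx)
    rw [neg_add, neg_neg, ← map_neg] at this
    rwa [smul_neg]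
  refine sl2_bounded (R.dual.ρ 1 e) (R.dual.ρ 1 f) (fun x => R.dual.wsp (-μ + A.ic (x • k)))
    (fun x => dual_fin hR _) ?_ ?_ (-ζ) ?_ ?_
  · intro x v hv
    refine R.dual.shift' hv he 1 ?_
    rw [add_smul, one_smul, map_add, add_assoc]
  · intro x v hv
    refine R.dual.shift' hv hf 1 ?_
    rw [sub_smul, one_smul, sub_eq_add_neg, map_add, add_assoc]
  · intro x ξ hξ
    have h1 := R.dual.lie_act he hf 1 1 ξ
    rw [← h1, mul_one]
    have hw : R.dual.ρ 1 ⁅e, f⁆ ξ ∈ R.dual.wsp (-μ + A.ic (x • k)) := by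
      refine R.dual.shift' hξ (A.lie_mem he hf) 1 ?_
      simp
    have hall : ∀ v : V, v ∈ (⊤ : Submodule ℂ V) →
        (R.dual.ρ 1 ⁅e, f⁆ ξ) v = (-(2 * (x : ℂ) + -ζ) • ξ) v := by
      rw [← hR.top]
      intro v hv
      refine Submodule.iSup_induction R.wsp
        (motive := fun v => (R.dual.ρ 1 ⁅e, f⁆ ξ) v = (-(2 * (x : ℂ) + -ζ) • ξ) v) hv ?_ ?_ ?_
      · intro l' v hv
        by_cases hl : l' = -(-μ + A.ic (x • k))
        · rw [dual_apply, hs (-x) v]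
          · simp only [map_smul, smul_eq_mul, LinearMap.smul_apply]
            push_cast
            ring
          · rw [hl] at hv
            convert hv using 2
            rw [neg_add, neg_neg, neg_smul, map_neg]
        · rw [(mem_wsp_dual hR).1 hw _ hl v hv, LinearMap.smul_apply, (mem_wsp_dual hR).1 hξ _ hl v hv, smul_zero]
      · simp
      · intro a b ha hb; rw [map_add, map_add, ha, hb]
    ext v
    exact hall v Submodule.mem_top
  · intro x ξ hξ'
    exact dual_nilp hR hk he hne hξ'

end Tor

namespace Tor

theorem exists_fin_span {V : Type} [AddCommGroup V] [Module ℂ V] (U : Submodule ℂ V)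
    [FiniteDimensional ℂ U] {d : ℕ} (h : Module.finrank ℂ U ≤ d) :
    ∃ s : Fin d → V, Submodule.span ℂ (Set.range s) = U := by
  classical
  let b := Module.finBasis ℂ U
  refine ⟨fun i => if hi : i.1 < Module.finrank ℂ U then (b ⟨i.1, hi⟩ : V) else 0, le_antisymm ?_ ?_⟩
  · rw [Submodule.span_le]
    rintro _ ⟨i, rfl⟩
    dsimp only
    split_ifs
    · exact Subtype.mem _
    · exact zero_mem _
  · intro v hv
    have h1 : (⟨v, hv⟩ : U) ∈ Submodule.span ℂ (Set.range b) := by rw [b.span_eq]; trivial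
    have h2 := Submodule.mem_map_of_mem (f := U.subtype) h1
    rw [Submodule.map_span] at h2
    refine Submodule.span_mono ?_ h2
    rintro _ ⟨_, ⟨i, rfl⟩, rfl⟩
    exact ⟨⟨i.1, i.2.trans_le h⟩, by simp⟩

theorem finrank_le_of_maps {V : Type} [AddCommGroup V] [Module ℂ V] {I : Type} [Fintype I]
    (f : I → V →ₗ[ℂ] V) (W : Submodule ℂ V) (U : I → Submodule ℂ V) [∀ i, FiniteDimensional ℂ (U i)]
    {d : ℕ} (hd : ∀ i, Module.finrank ℂ (U i) ≤ d) (h : ∀ i, ∀ v ∈ W, f i v ∈ U i)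
    (hinj : ∀ v ∈ W, (∀ i, f i v = 0) → v = 0) : Module.finrank ℂ W ≤ Fintype.card I * d := by
  let F : W →ₗ[ℂ] ∀ i, U i := LinearMap.pi fun i => (f i).restrict (h i)
  have hF : Function.Injective F := by
    rw [← LinearMap.ker_eq_bot, LinearMap.ker_eq_bot']
    intro v hv
    refine Subtype.ext (hinj v.1 v.2 fun i => ?_)
    exact congrArg Subtype.val (congrFun hv i)
  refine (LinearMap.finrank_le_finrank_of_injective hF).trans ?_
  rw [Module.finrank_pi_fintype]
  refine (Finset.sum_le_card_nsmul _ _ d fun i _ => hd i).trans ?_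
  simp

/-- A linear map with small range has a small supplement to its kernel. -/
theorem exists_codim {V P : Type} [AddCommGroup V] [Module ℂ V] [AddCommGroup P] [Module ℂ P] {I : Type} [Fintype I]
    (f : I → P →ₗ[ℂ] V) (U : I → Submodule ℂ V) [∀ i, FiniteDimensional ℂ (U i)]
    {d : ℕ} (hd : ∀ i, Module.finrank ℂ (U i) ≤ d) (h : ∀ i b, f i b ∈ U i) :
    ∃ c : Fin (Fintype.card I * d) → P, ∀ b, ∃ b0, (∀ i, f i b0 = 0) ∧
      b - b0 ∈ Submodule.span ℂ (Set.range c) := by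
  let F : P →ₗ[ℂ] ∀ i, U i := LinearMap.pi fun i => (f i).codRestrict (U i) (h i)
  have h1 : Module.finrank ℂ (LinearMap.range F) ≤ Fintype.card I * d := by
    refine (Submodule.finrank_le _).trans ?_
    rw [Module.finrank_pi_fintype]
    refine (Finset.sum_le_card_nsmul _ _ d fun i _ => hd i).trans ?_
    simp
  obtain ⟨s, hs⟩ := exists_fin_span (LinearMap.range F) h1
  have h2 : ∀ i, ∃ c, F c = s i := by
    intro i
    have : s i ∈ LinearMap.range F := hs ▸ Submodule.subset_span ⟨i, rfl⟩
    exact this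
  choose c hc using h2
  refine ⟨c, fun b => ?_⟩
  have h3 : F b ∈ Submodule.map F (Submodule.span ℂ (Set.range c)) := by
    rw [Submodule.map_span, ← Set.range_comp, show (F ∘ c) = s from funext hc, hs]
    exact ⟨b, rfl⟩
  obtain ⟨b', hb', he⟩ := h3
  refine ⟨b - b', fun i => ?_, by simpa using hb'⟩
  have : F (b - b') = 0 := by rw [map_sub, he, sub_self]
  exact congrArg Subtype.val (congrFun this i)

variable {r n : ℕ} {τ : Type} [LieRing τ] [LieAlgebra ℂ τ]
variable {A : GAlg r n τ} {B : Type} [CommRing B] [Algebra ℂ B] {V : Type}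
    [AddCommGroup V] [Module ℂ V]

theorem GAlg.exists_functional (A : GAlg r n τ) {p q : Fin r → ℤ} (h : ∃ i j, p i * q j ≠ p j * q i) :
    ∃ u : Fin n → ℂ, ∑ i, u i * A.ic p i = 0 ∧ ∑ i, u i * A.ic q i = 1 := by
  classical
  obtain ⟨i, j, hij⟩ := h
  obtain ⟨a, b, hab⟩ : ∃ a b, A.ι p a * A.ι q b ≠ A.ι p b * A.ι q a := by
    by_contra hcon
    push Not at hcon
    have hp : p ≠ 0 := by rintro rfl; simp at hij
    have hp' : A.ι p ≠ 0 := fun h0 => hp (A.inj (by rw [h0, map_zero]))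
    obtain ⟨a, ha⟩ := Function.ne_iff.1 hp'
    have h1 : (A.ι p a) • q = (A.ι q a) • p := by
      apply A.inj
      rw [map_zsmul, map_zsmul]
      ext b
      simp only [Pi.smul_apply, smul_eq_mul]
      have := hcon a b
      linarith
    have e1 := congrFun h1 i
    have e2 := congrFun h1 j
    simp only [Pi.smul_apply, smul_eq_mul] at e1 e2
    apply hij
    apply mul_left_cancel₀ ha
    linear_combination p i * e2 - p j * e1
  have hne : ((A.ι p a * A.ι q b - A.ι p b * A.ι q a : ℤ) : ℂ) ≠ 0 := by
    exact_mod_cast sub_ne_zero.2 hab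
  refine ⟨fun i => ((A.ι p a * A.ι q b - A.ι p b * A.ι q a : ℤ) : ℂ)⁻¹ *
    ((if i = b then (A.ι p a : ℂ) else 0) - if i = a then (A.ι p b : ℂ) else 0), ?_, ?_⟩
  · simp only [mul_assoc, ← Finset.mul_sum, sub_mul, Finset.sum_sub_distrib, ite_mul, zero_mul,
      Finset.sum_ite_eq', Finset.mem_univ, if_true, GAlg.ic_apply]
    ring
  · simp only [mul_assoc, ← Finset.mul_sum, sub_mul, Finset.sum_sub_distrib, ite_mul, zero_mul,
      Finset.sum_ite_eq', Finset.mem_univ, if_true, GAlg.ic_apply]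
    rw [inv_mul_eq_one₀ hne]
    push_cast
    ring

/-- A combination of degree operators. -/
def GAlg.Du (A : GAlg r n τ) (u : Fin n → ℂ) : τ := ∑ i, u i • A.D i

theorem GAlg.Du_mem (A : GAlg r n τ) (u : Fin n → ℂ) : A.Du u ∈ A.g 0 :=
  Submodule.sum_mem _ fun i _ => Submodule.smul_mem _ _ (A.D_mem i)

theorem GAlg.lie_Du (A : GAlg r n τ) (u : Fin n → ℂ) {m X} (hX : X ∈ A.g m) :
    ⁅A.Du u, X⁆ = (∑ i, u i * A.ic m i) • X := by
  simp [GAlg.Du, sum_lie, A.lie_D _ hX, Finset.sum_smul, smul_smul, GAlg.ic_apply]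

theorem GRep.Du_comm (R : GRep A B V) (u : Fin n → ℂ) {m X} (hX : X ∈ A.g m) (b c : B) (v : V) :
    R.ρ b (A.Du u) (R.ρ c X v) = R.ρ c X (R.ρ b (A.Du u) v) + (∑ i, u i * A.ic m i) • R.ρ (b * c) X v := by
  rw [R.comm (A.Du_mem u) hX, A.lie_Du u hX]; simp

theorem GRep.Du_wsp (R : GRep A B V) (u : Fin n → ℂ) {l v} (hv : v ∈ R.wsp l) (b : B) :
    R.ρ b (A.Du u) v ∈ R.wsp l := R.shift' hv (A.Du_mem u) b (by simp)

theorem GRep.ad_trick (R : GRep A B V) {p q : Fin r → ℤ} (h : ∃ i j, p i * q j ≠ p j * q i) {l : Fin n → ℂ}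
    {c : B} {Y} (hY : Y ∈ A.g p) (h0 : ∀ X ∈ A.g q, ∀ v ∈ R.wsp l, R.ρ c Y (R.ρ 1 X v) = 0) (b : B) {X}
    (hX : X ∈ A.g q) {v} (hv : v ∈ R.wsp l) : R.ρ c Y (R.ρ b X v) = 0 := by
  obtain ⟨u, h1, h2⟩ := A.exists_functional h
  have h3 := R.Du_comm u hY b c (R.ρ 1 X v)
  rw [h0 X hX v hv, R.Du_comm u hX, h1, h2, map_add, h0 X hX _ (R.Du_wsp u hv b)] at h3
  simpa using h3.symm

theorem GRep.ad_trick' (R : GRep A B V) {p q : Fin r → ℤ} (h : ∃ i j, p i * q j ≠ p j * q i) {l : Fin n → ℂ}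
    {b : B} {X} (hX : X ∈ A.g p) {Y} (hY : Y ∈ A.g q)
    (h0 : ∀ v ∈ R.wsp l, R.ρ 1 Y (R.ρ b X v) = 0) (c : B)
    {v} (hv : v ∈ R.wsp l) : R.ρ c Y (R.ρ b X v) = 0 := by
  obtain ⟨u, h1, h2⟩ := A.exists_functional h
  have h3 := R.Du_comm u hY c 1 (R.ρ b X v)
  rw [h0 v hv, R.Du_comm u hX, h1, h2, zero_smul, add_zero, h0 _ (R.Du_wsp u hv c)] at h3
  simpa using h3.symm

theorem minor_ne {m : Fin r → ℤ} {i j : Fin r} (hij : i ≠ j) (hm : |m j| ≤ |m i|) (h8 : 8 ≤ |m i|) (c c' : CI r) :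
    (m + cs 10 j c) i * (-m + cs 30 j c') j ≠ (m + cs 10 j c) j * (-m + cs 30 j c') i := by
  simp only [Pi.add_apply, Pi.neg_apply, cs_same, cs_ne _ hij]
  have a1 := ci_bound c i
  have a2 := ci_bound c j
  have a3 := ci_bound c' i
  have a4 := ci_bound c' j
  generalize c.2.1 i = a at *
  generalize c.2.1 j = b at *
  generalize c'.2.1 i = a' at *
  generalize c'.2.1 j = b' at *
  generalize m i = M at *
  generalize m j = T at *
  obtain ⟨S, hS, hS'⟩ : ∃ S : ℤ, (if c.1 = true then (10 : ℤ) else -10) = S ∧ |S| ≤ 10 := by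
    split_ifs <;> exact ⟨_, rfl, by norm_num⟩
  obtain ⟨S', hT, hT1, hT2⟩ : ∃ S : ℤ, (if c'.1 = true then (30 : ℤ) else -30) = S ∧ |S| ≤ 30 ∧ 30 ≤ |S| := by
    split_ifs <;> exact ⟨_, rfl, by norm_num, by norm_num⟩
  rw [hS, hT]
  intro h
  have e : M * (S' + b' + (S + b)) = T * (a + a') + (S + b) * a' - a * (S' + b') := by linarith
  have b1 : 16 ≤ |S' + b' + (S + b)| := by
    simp only [abs_le, le_abs] at *
    omega
  have b2 : |a + a'| ≤ 4 := (abs_add_le _ _).trans (by linarith)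
  have b3 : |S + b| ≤ 12 := (abs_add_le _ _).trans (by linarith)
  have b4 : |S' + b'| ≤ 32 := (abs_add_le _ _).trans (by linarith)
  have c1 : |M| * 16 ≤ |M * (S' + b' + (S + b))| := by
    rw [abs_mul]; exact mul_le_mul_of_nonneg_left b1 (abs_nonneg _)
  have c2 : |T * (a + a')| ≤ |M| * 4 := by
    rw [abs_mul]; exact mul_le_mul hm b2 (abs_nonneg _) (abs_nonneg _)
  have c3 : |(S + b) * a'| ≤ 12 * 2 := by
    rw [abs_mul]; exact mul_le_mul b3 a3 (abs_nonneg _) (by norm_num)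
  have c4 : |a * (S' + b')| ≤ 2 * 32 := by
    rw [abs_mul]; exact mul_le_mul a1 b4 (abs_nonneg _) (by norm_num)
  rw [e] at c1
  have d1 := abs_sub (T * (a + a') + (S + b) * a') (a * (S' + b'))
  have d2 := abs_add_le (T * (a + a')) ((S + b) * a')
  linarith

theorem GRep.no_vector {R : GRep A B V} (hR : R.Good) (hr : 1 ≤ r) {m : Fin r → ℤ} (hm : m ≠ 0)
    (hc : ¬ cone ((2 : ℤ) • m) ⊆ R.Bd) {N : ℤ} (hN : 2 < N) (j : Fin r) {v : V}
    (h : ∀ c, R.Kills 1 (m + cs N j c) v) : v = 0 := by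
  by_contra hv
  exact hc (box_Bd hR hr (smul_ne_zero two_ne_zero hm) hv fun s hs =>
    cluster_kills R.idem_one hN j h s fun i => (hs i).trans (by norm_num))

theorem GRep.no_functional {R : GRep A B V} (hR : R.Good) (hr : 1 ≤ r) {m : Fin r → ℤ} (hm : m ≠ 0)
    (hc : ¬ cone ((2 : ℤ) • m) ⊆ R.Bd) {N : ℤ} (hN : 2 < N) (j : Fin r) {ξ : Module.Dual ℂ V}
    (h : ∀ c, R.dual.Kills 1 (-m + cs N j c) ξ) : ξ = 0 := by
  by_contra hv
  refine hc fun k hk => ?_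
  have := box_Bd_dual hR hr (m := (2 : ℤ) • -m) (smul_ne_zero two_ne_zero (neg_ne_zero.2 hm)) hv (fun s hs =>
    cluster_kills R.dual.idem_one hN j h s fun i => (hs i).trans (by norm_num)) (k := -k) ?_
  · simpa using this
  · obtain ⟨x, s, rfl, hx, hs⟩ := hk
    exact ⟨x, -s, by module, hx, by simpa using hs⟩

theorem GRep.wsp_le_span {R : GRep A B V} (hR : R.Good) (hr : 1 ≤ r) {m : Fin r → ℤ} (hm : m ≠ 0)
    (hc : ¬ cone ((2 : ℤ) • m) ⊆ R.Bd) {N : ℤ} (hN : 2 < N) (j : Fin r) (l : Fin n → ℂ) :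
    R.wsp (l - A.ic m) ≤ Submodule.span ℂ {w | ∃ c : CI r, ∃ b, ∃ X ∈ A.g (-m + cs N j c),
      ∃ v ∈ R.wsp (l - A.ic (cs N j c)), w = R.ρ b X v} := by
  set S := {w | ∃ c : CI r, ∃ b, ∃ X ∈ A.g (-m + cs N j c),
      ∃ v ∈ R.wsp (l - A.ic (cs N j c)), w = R.ρ b X v} with hS
  have hSw : Submodule.span ℂ S ≤ R.wsp (l - A.ic m) := by
    rw [Submodule.span_le]
    rintro _ ⟨c, b, X, hX, v, hv, rfl⟩
    refine R.shift' hv hX b ?_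
    rw [map_add, map_neg]; abel
  intro v hv
  by_contra hvS
  have h1 : v ∉ Submodule.span ℂ S ⊔ ⨆ k, ⨆ _ : k ≠ l - A.ic m, R.wsp k := by
    intro h
    obtain ⟨w, hw, z, hz, rfl⟩ := Submodule.mem_sup.1 h
    have hz' : z ∈ R.wsp (l - A.ic m) := by
      have := Submodule.sub_mem _ hv (hSw hw)
      simpa using this
    have := (Submodule.disjoint_def.1 (R.indep (l - A.ic m))) z hz' hz
    subst this
    simp only [add_zero] at hvS
    exact hvS hw
  obtain ⟨ξ, hξ, hmap⟩ := Submodule.exists_dual_map_eq_bot_of_notMem h1 inferInstance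
  have h2 : ∀ w ∈ Submodule.span ℂ S ⊔ ⨆ k, ⨆ _ : k ≠ l - A.ic m, R.wsp k, ξ w = 0 := by
    intro w hw
    have := Submodule.mem_map_of_mem (f := ξ) hw
    rw [hmap] at this
    simpa using this
  have h0 : ξ = 0 := by
    refine no_functional hR hr hm hc hN j (fun c => ?_)
    rw [kills_one]
    intro b X hX
    have : ∀ v : V, v ∈ (⊤ : Submodule ℂ V) → (R.dual.ρ b X ξ) v = 0 := by
      rw [← hR.top]
      intro v hv
      refine Submodule.iSup_induction R.wsp (motive := fun v => (R.dual.ρ b X ξ) v = 0) hv ?_ ?_ ?_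
      · intro l' v hv
        rw [dual_apply, neg_eq_zero]
        by_cases hl : l' = l - A.ic (cs N j c)
        · subst hl
          exact h2 _ (Submodule.mem_sup_left (Submodule.subset_span ⟨c, b, X, hX, v, hv, rfl⟩))
        · refine h2 _ (Submodule.mem_sup_right ?_)
          refine Submodule.mem_iSup_of_mem _ (Submodule.mem_iSup_of_mem ?_ (R.shift hv hX b))
          intro h3
          apply hl
          rw [map_add, map_neg] at h3
          have h4 := eq_sub_of_add_eq h3
          rw [h4]; abel
      · simp
      · intro a b ha hb; rw [map_add, ha, hb, add_zero]
    ext v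
    exact this v Submodule.mem_top
  rw [h0] at hξ
  exact hξ rfl

/-- Uniform bound on weight multiplicities away from the bounded directions. -/
theorem GRep.mult_bound {R : GRep A B V} (hR : R.Good) (hr : 2 ≤ r) (d : ℕ) : ∃ Q : ℕ,
    ∀ l : Fin n → ℂ, (∀ s : Fin r → ℤ, (∀ i, |s i| ≤ 40) → Module.finrank ℂ (R.wsp (l + A.ic s)) ≤ d) →
    ∀ m : Fin r → ℤ, ¬ cone ((2 : ℤ) • m) ⊆ R.Bd → Module.finrank ℂ (R.wsp (l - A.ic m)) ≤ Q := by
  set N1 := Fintype.card (CI r × CI r × Fin A.q × Fin A.q × Fin d) * d with hN1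
  refine ⟨max d (Fintype.card (CI r × Fin A.q × Fin N1) * d), fun l hl m hm => ?_⟩
  have := hR.fin
  by_cases hsmall : ∀ i, |m i| ≤ 7
  · refine le_trans ?_ (le_max_left _ _)
    have := hl (-m) (fun i => by simpa using (hsmall i).trans (by norm_num))
    rwa [map_neg, ← sub_eq_add_neg] at this
  refine le_trans ?_ (le_max_right _ _)
  obtain ⟨i, hi⟩ : ∃ i, ∀ j, |m j| ≤ |m i| := by
    have : Nonempty (Fin r) := ⟨⟨0, by omega⟩⟩
    exact Finite.exists_max fun i => |m i|
  have h8 : 8 ≤ |m i| := by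
    by_contra h
    exact hsmall fun j => (hi j).trans (by omega)
  have hm0 : m ≠ 0 := by rintro rfl; simp at h8
  obtain ⟨j, hj⟩ : ∃ j : Fin r, i ≠ j := by
    have : Nontrivial (Fin r) := Fin.nontrivial_iff_two_le.2 hr
    obtain ⟨j, hj⟩ := exists_ne i
    exact ⟨j, hj.symm⟩
  have hcb : ∀ (N : ℤ) (c : CI r), 0 ≤ N → N ≤ 30 → ∀ i, |cs N j c i| ≤ 40 := by
    intro N c h0 h1 i
    have h2 := ci_bound c i
    by_cases hij : i = j
    · subst hij
      rw [cs_same]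
      rw [abs_le] at h2 ⊢
      split_ifs <;> omega
    · rw [cs_ne _ hij]; omega
  have hd1 : ∀ c : CI r, Module.finrank ℂ (R.wsp (l + A.ic (cs 10 j c))) ≤ d := fun c =>
    hl _ (hcb 10 c (by norm_num) (by norm_num))
  have hd2 : ∀ c : CI r, Module.finrank ℂ (R.wsp (l - A.ic (cs 30 j c))) ≤ d := fun c => by
    have := hl (-cs 30 j c) (fun i => by
      rw [Pi.neg_apply, abs_neg]; exact hcb 30 c (by norm_num) (by norm_num) i)
    rwa [map_neg, ← sub_eq_add_neg] at this
  choose G1 hG1 using fun c : CI r => A.fd (m + cs 10 j c)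
  choose G2 hG2 using fun c : CI r => A.fd (-m + cs 30 j c)
  choose G3 hG3 using fun c : CI r => exists_fin_span (R.wsp (l - A.ic (cs 30 j c))) (hd2 c)
  have hG1m : ∀ c a, G1 c a ∈ A.g (m + cs 10 j c) := fun c a => hG1 c ▸ Submodule.subset_span ⟨a, rfl⟩
  have hG2m : ∀ c a, G2 c a ∈ A.g (-m + cs 30 j c) := fun c a => hG2 c ▸ Submodule.subset_span ⟨a, rfl⟩
  have hG3m : ∀ c a, G3 c a ∈ R.wsp (l - A.ic (cs 30 j c)) := fun c a => hG3 c ▸ Submodule.subset_span ⟨a, rfl⟩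
  obtain ⟨C, hC⟩ := exists_codim (I := CI r × CI r × Fin A.q × Fin A.q × Fin d) (d := d)
    (fun t => (R.ρ.flip (G1 t.1 t.2.2.1)).flip (R.ρ 1 (G2 t.2.1 t.2.2.2.1) (G3 t.2.1 t.2.2.2.2)))
    (fun t => R.wsp (l + A.ic (cs 10 j t.1))) (fun t => hd1 t.1) (by
      rintro ⟨c, c', a, a', x⟩ b
      refine R.shift' (R.shift (hG3m c' x) (hG2m c' a') 1) (hG1m c a) b ?_
      rw [map_add, map_add, map_neg]
      abel)
  have hkill : ∀ b0, (∀ t : CI r × CI r × Fin A.q × Fin A.q × Fin d,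
      ((R.ρ.flip (G1 t.1 t.2.2.1)).flip (R.ρ 1 (G2 t.2.1 t.2.2.2.1) (G3 t.2.1 t.2.2.2.2))) b0 = 0) →
      ∀ c, ∀ a, ∀ v ∈ R.wsp (l - A.ic m), R.ρ b0 (G1 c a) v = 0 := by
    intro b0 hb0 c a v hv
    have hv' := wsp_le_span hR (by omega) hm0 hm (N := 30) (by norm_num) j l hv
    suffices h : Submodule.span ℂ {w | ∃ c : CI r, ∃ b, ∃ X ∈ A.g (-m + cs 30 j c),
      ∃ v ∈ R.wsp (l - A.ic (cs 30 j c)), w = R.ρ b X v} ≤ LinearMap.ker (R.ρ b0 (G1 c a)) from h hv'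
    rw [Submodule.span_le]
    rintro _ ⟨c', b, X, hX, w, hw, rfl⟩
    refine R.ad_trick ⟨i, j, minor_ne hj (hi j) h8 c c'⟩ (hG1m c a) ?_ b hX hw
    intro X hX w hw
    rw [← hG2 c'] at hX
    rw [← hG3 c'] at hw
    refine Submodule.span_induction ?_ ?_ ?_ ?_ hX
    · rintro _ ⟨a', rfl⟩
      refine Submodule.span_induction ?_ ?_ ?_ ?_ hw
      · rintro _ ⟨x, rfl⟩
        exact hb0 (c, c', a, a', x)
      · simp
      · intro x y _ _ hx hy; rw [map_add, map_add, hx, hy, add_zero]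
      · intro z x _ hx; rw [map_smul, map_smul, hx, smul_zero]
    · simp
    · intro x y _ _ hx hy; rw [map_add, LinearMap.add_apply, map_add, hx, hy, add_zero]
    · intro z x _ hx; rw [map_smul, LinearMap.smul_apply, map_smul, hx, smul_zero]
  refine finrank_le_of_maps (I := CI r × Fin A.q × Fin N1) (fun t => R.ρ (C t.2.2) (G1 t.1 t.2.1))
    (R.wsp (l - A.ic m)) (fun t => R.wsp (l + A.ic (cs 10 j t.1))) (fun t => hd1 t.1) ?_ ?_
  · rintro ⟨c, a, x⟩ v hv
    refine R.shift' hv (hG1m c a) _ ?_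
    rw [map_add]; abel
  · intro v hv h0
    refine no_vector hR (by omega) hm0 hm (N := 10) (by norm_num) j (v := v) fun c => ?_
    rw [kills_one]
    intro b X hX
    obtain ⟨b0, hb0, hb⟩ := hC b
    have h1 : ∀ b' ∈ Submodule.span ℂ (Set.range C), ∀ a, R.ρ b' (G1 c a) v = 0 := by
      intro b' hb' a
      refine Submodule.span_induction ?_ ?_ ?_ ?_ hb'
      · rintro _ ⟨x, rfl⟩; exact h0 (c, a, x)
      · simp
      · intro x y _ _ hx hy; rw [map_add, LinearMap.add_apply, LinearMap.add_apply, hx, hy, add_zero]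
      · intro z x _ hx; rw [map_smul, LinearMap.smul_apply, LinearMap.smul_apply, hx, smul_zero]
    rw [← hG1 c] at hX
    refine Submodule.span_induction ?_ ?_ ?_ ?_ hX
    · rintro _ ⟨a, rfl⟩
      have h2 := h1 _ hb a
      rw [map_sub, LinearMap.sub_apply, LinearMap.sub_apply, hkill b0 hb0 c a v hv, sub_zero] at h2
      exact h2
    · simp
    · intro x y _ _ hx hy; rw [map_add, LinearMap.add_apply, hx, hy, add_zero]
    · intro z x _ hx; rw [map_smul, LinearMap.smul_apply, hx, smul_zero]

end Tor

namespace Tor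

variable {r n : ℕ} {τ : Type} [LieRing τ] [LieAlgebra ℂ τ]
variable {A : GAlg r n τ} {B : Type} [CommRing B] [Algebra ℂ B] {V : Type}
    [AddCommGroup V] [Module ℂ V]

theorem exists_single_ne (hr : 1 ≤ r) : ∃ k : Fin r → ℤ, k ≠ 0 :=
  ⟨Pi.single ⟨0, hr⟩ 1, by simp⟩

theorem exists_avoid (hr : 1 ≤ r) (S : Set (Fin r → ℤ)) (hS : S.Finite) : ∃ k, k ∉ S := by
  have : Nonempty (Fin r) := ⟨⟨0, hr⟩⟩
  have : Infinite (Fin r → ℤ) := inferInstance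
  obtain ⟨k, hk⟩ := hS.infinite_compl.nonempty
  exact ⟨k, hk⟩

/-- Any degree splits into two distinct degrees avoiding a finite set. -/
theorem exists_split (hr : 1 ≤ r) (S : Set (Fin r → ℤ)) (hS : S.Finite) (m : Fin r → ℤ) :
    ∃ p k, p ∉ S ∧ k ∉ S ∧ p ≠ k ∧ p + k = m := by
  obtain ⟨k, hk⟩ := exists_avoid hr (S ∪ (fun k => m - k) ⁻¹' S ∪ (fun k => (2 : ℤ) • k) ⁻¹' {m})
    ((hS.union (hS.preimage (sub_right_injective.injOn))).union
      ((Set.finite_singleton m).preimage (smul_right_injective _ two_ne_zero).injOn))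
  simp only [Set.mem_union, Set.mem_preimage, Set.mem_singleton_iff, not_or] at hk
  refine ⟨m - k, k, hk.1.2, hk.1.1, ?_, by abel⟩
  intro h
  apply hk.2
  rw [two_smul]
  nth_rewrite 1 [← h]
  abel

theorem GRep.kills_all {R : GRep A B V} (hr : 1 ≤ r) {ε : B} (hε : R.Idem ε) {S : Set (Fin r → ℤ)}
    (hS : S.Finite) {v : V} (h : ∀ m, m ∉ S → R.Kills ε m v) (m) : R.Kills ε m v := by
  obtain ⟨p, k, hp, hk, hne, rfl⟩ := exists_split hr S hS m
  exact kills_add hε hne (h p hp) (h k hk)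

theorem GRep.sup_induct {R : GRep A B V} (hR : R.Good) (N : Submodule ℂ V)
    (h : ∀ l, ∀ v ∈ R.wsp l, v ∈ N) : N = ⊤ := by
  rw [eq_top_iff, ← hR.top]
  exact iSup_le fun l v hv => h l v hv

theorem GRep.single_coset {R : GRep A B V} (hR : R.Good) {l0 : Fin n → ℂ} (h0 : R.wsp l0 ≠ ⊥) {l}
    (hl : R.wsp l ≠ ⊥) : ∃ m, l = l0 + A.ic m := by
  by_contra hcon
  push Not at hcon
  have h1 : (⨆ m, R.wsp (l0 + A.ic m)) = ⊤ := by
    refine (hR.irr _ ?_).resolve_left ?_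
    · intro b m X hX v hv
      have : (⨆ m, R.wsp (l0 + A.ic m)) ≤ (⨆ m, R.wsp (l0 + A.ic m)).comap (R.ρ b X) := by
        refine iSup_le fun k w hw => ?_
        exact Submodule.mem_iSup_of_mem (k + m) (R.shift' hw hX b (by rw [map_add, add_assoc]))
      exact this hv
    · intro h
      apply h0
      rw [eq_bot_iff, ← h]
      exact le_trans (by simp) (le_iSup (fun m => R.wsp (l0 + A.ic m)) 0)
  have h2 : (⨆ m, R.wsp (l0 + A.ic m)) ≤ ⨆ k, ⨆ _ : k ≠ l, R.wsp k :=
    iSup_le fun m => le_iSup₂_of_le (l0 + A.ic m) (Ne.symm (hcon m)) le_rfl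
  rw [h1] at h2
  apply hl
  rw [eq_bot_iff]
  intro v hv
  exact Submodule.disjoint_def.1 (R.indep l) v hv (h2 Submodule.mem_top)

theorem GRep.exists_weight {R : GRep A B V} (hR : R.Good) : ∃ l, R.wsp l ≠ ⊥ := by
  by_contra h
  push Not at h
  have := hR.top
  simp only [h, iSup_bot] at this
  obtain ⟨b, m, X, hX, v, hv⟩ := hR.nt
  apply hv
  have hv0 : v ∈ (⊤ : Submodule ℂ V) := Submodule.mem_top
  rw [← this, Submodule.mem_bot] at hv0
  rw [hv0, map_zero]

/-- Uniform boundedness in the absence of bounded cones. -/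
theorem GRep.bounded_of_no_cone {R : GRep A B V} (hR : R.Good) (hr : 2 ≤ r)
    (hno : ∀ m, m ≠ 0 → ¬ cone m ⊆ R.Bd) : ∃ N, ∀ l, Module.finrank ℂ (R.wsp l) ≤ N := by
  obtain ⟨l0, hl0⟩ := exists_weight hR
  let F : Finset (Fin r → ℤ) := Finset.Icc (fun _ => -40) (fun _ => 40)
  set d := F.sup fun s => Module.finrank ℂ (R.wsp (l0 + A.ic s)) with hd
  have hd' : ∀ s : Fin r → ℤ, (∀ i, |s i| ≤ 40) → Module.finrank ℂ (R.wsp (l0 + A.ic s)) ≤ d := by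
    intro s hs
    refine Finset.le_sup (f := fun s => Module.finrank ℂ (R.wsp (l0 + A.ic s))) ?_
    exact Finset.mem_Icc.2 ⟨fun i => (abs_le.1 (hs i)).1, fun i => (abs_le.1 (hs i)).2⟩
  obtain ⟨Q, hQ⟩ := mult_bound hR hr d
  refine ⟨max d Q, fun l => ?_⟩
  by_cases hl : R.wsp l = ⊥
  · rw [hl]; simp
  obtain ⟨m, rfl⟩ := single_coset hR hl0 hl
  by_cases hm : m = 0
  · exact (hd' m (by simp [hm])).trans (le_max_left _ _)
  · refine le_trans ?_ (le_max_right _ _)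
    have := hQ l0 hd' (-m) (hno _ (smul_ne_zero two_ne_zero (neg_ne_zero.2 hm)))
    rwa [map_neg, sub_neg_eq_add] at this

/-- The ideal of elements of `B` acting by zero. -/
def GRep.ann (R : GRep A B V) (hr : 1 ≤ r) : Ideal B where
  carrier := {b | ∀ m, ∀ X ∈ A.g m, R.ρ b X = 0}
  zero_mem' := by intro m X _; simp
  add_mem' := by intro a b ha hb m X hX; simp [ha m X hX, hb m X hX]
  smul_mem' := by
    intro c b hb m Z hZ
    obtain ⟨p, k, -, -, hne, rfl⟩ := exists_split hr ∅ Set.finite_empty m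
    ext v
    refine R.gen_kill hne _ v ?_ hZ
    intro X hX Y hY
    rw [smul_eq_mul, R.lie_act hX hY, hb k Y hY]
    simp

theorem GRep.mem_ann {R : GRep A B V} {hr : 1 ≤ r} {b : B} :
    b ∈ R.ann hr ↔ ∀ m, ∀ X ∈ A.g m, R.ρ b X = 0 := Iff.rfl

theorem GRep.ann_of_kill {R : GRep A B V} (hR : R.Good) (hr : 1 ≤ r) (I : Ideal B) {v : V} (hv : v ≠ 0)
    (h : ∀ b ∈ I, ∀ m, ∀ X ∈ A.g m, R.ρ b X v = 0) : I ≤ R.ann hr := by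
  let W : Submodule ℂ V := ⨅ b ∈ I, ⨅ m, ⨅ X ∈ A.g m, LinearMap.ker (R.ρ b X)
  have hW : ∀ w, w ∈ W ↔ ∀ b ∈ I, ∀ m, ∀ X ∈ A.g m, R.ρ b X w = 0 := by
    intro w; simp [W, Submodule.mem_iInf]
  have : W = ⊤ := by
    refine (hR.irr W ?_).resolve_left ?_
    · intro c k Y hY w hw
      rw [hW] at hw ⊢
      intro b hb m X hX
      rw [R.comm hX hY, hw b hb m X hX, hw _ (I.mul_mem_right c hb) _ _ (A.lie_mem hX hY)]
      simp
    · intro h0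
      have := (hW v).2 h
      rw [h0] at this
      exact hv this
  intro b hb m X hX
  ext w
  have hw : w ∈ W := this ▸ Submodule.mem_top
  exact (hW w).1 hw b hb m X hX

theorem GRep.ann_of_kills {R : GRep A B V} (hR : R.Good) (hr : 1 ≤ r) {ε : B} {v : V} (hv : v ≠ 0)
    (h : ∀ m, R.Kills ε m v) : ε ∈ R.ann hr := by
  refine ann_of_kill hR hr (Ideal.span {ε}) hv ?_ (Ideal.mem_span_singleton_self ε)
  intro b hb m X hX
  obtain ⟨c, rfl⟩ := Ideal.mem_span_singleton.1 hb
  exact h m c X hX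

theorem GRep.ann_ne_top {R : GRep A B V} (hR : R.Good) (hr : 1 ≤ r) : R.ann hr ≠ ⊤ := by
  intro h
  obtain ⟨b, m, X, hX, v, hv⟩ := hR.nt
  have : b ∈ R.ann hr := h ▸ Submodule.mem_top
  exact hv (by rw [this m X hX]; rfl)

/-- The commutator with a nilpotent element is nilpotent, under commutation assumptions. -/
theorem pow_comm_eq_zero {E : Type} [Ring E] [Algebra ℂ E] {N Y T Z : E} (h1 : N * Y = Y * N + T)
    (h2 : N * T = T * N) (h3 : T * Y = Y * T + Z) (h4 : T * Z = Z * T) {D : ℕ} (hD : N ^ D = 0) :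
    T ^ (2 * D) = 0 := by
  have hN : ∀ b : ℕ, N ^ (b + 1) * Y = Y * N ^ (b + 1) + ((b : ℂ) + 1) • (T * N ^ b) := by
    intro b
    induction b with
    | zero => simp [h1]
    | succ b ih =>
      have hc : N * T = T * N := h2
      rw [pow_succ' N (b + 1), mul_assoc, ih, mul_add, ← mul_assoc, h1, mul_smul_comm, ← mul_assoc N T, h2,
        mul_assoc T N, ← pow_succ', add_mul, mul_assoc Y N, ← pow_succ']
      push_cast
      module
  have hT : ∀ a : ℕ, T ^ (a + 1) * Y = Y * T ^ (a + 1) + ((a : ℂ) + 1) • (Z * T ^ a) := by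
    intro b
    induction b with
    | zero => simp [h3]
    | succ b ih =>
      rw [pow_succ' T (b + 1), mul_assoc, ih, mul_add, ← mul_assoc, h3, mul_smul_comm, ← mul_assoc T Z, h4,
        mul_assoc Z T, ← pow_succ', add_mul, mul_assoc Y T, ← pow_succ']
      push_cast
      module
  have hNT : ∀ a b : ℕ, N ^ b * T ^ a = T ^ a * N ^ b := fun a b => ((show Commute N T from h2).pow_pow b a).eq
  have step : ∀ a b : ℕ, T ^ a * N ^ (b + 1) = 0 → T ^ (a + 2) * N ^ b = 0 := by
    intro a b h
    have e1 : T ^ (a + 1) * N ^ (b + 1) * Y = 0 := by rw [pow_succ', mul_assoc T, h]; simp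
    rw [mul_assoc, hN, mul_add, ← mul_assoc, hT, mul_smul_comm, add_mul, mul_assoc Y, pow_succ' T a,
      mul_assoc T (T ^ a), h, smul_mul_assoc, mul_assoc Z, h] at e1
    simp only [mul_zero, smul_zero, zero_add] at e1
    have e2 := (smul_eq_zero.1 e1).resolve_left (by exact_mod_cast Nat.succ_ne_zero b)
    have : T ^ (a + 2) * N ^ b = T * T ^ a * (T * N ^ b) := by
      rw [← mul_assoc, ← pow_succ', ← pow_succ]
    rw [this]
    exact e2
  have : ∀ j : ℕ, j ≤ D → T ^ (2 * j) * N ^ (D - j) = 0 := by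
    intro j
    induction j with
    | zero => intro _; simp [hD]
    | succ j ih =>
      intro hj
      have := step (2 * j) (D - (j + 1)) (by rw [show D - (j + 1) + 1 = D - j by omega]; exact ih (by omega))
      rw [show 2 * (j + 1) = 2 * j + 2 by ring]
      exact this
  simpa using this D le_rfl

theorem coeff_zero {V : Type} [AddCommGroup V] [Module ℂ V] (d : ℕ) (a : ℕ → V)
    (h : ∀ c : ℂ, ∑ m ∈ Finset.range d, c ^ m • a m = 0) : ∀ m < d, a m = 0 := by
  intro m hm
  rw [← Module.forall_dual_apply_eq_zero_iff ℂ]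
  intro ξ
  let P : Polynomial ℂ := ∑ m ∈ Finset.range d, Polynomial.monomial m (ξ (a m))
  have hP : P = 0 := by
    apply Polynomial.funext
    intro c
    have := congrArg ξ (h c)
    simp only [map_sum, map_smul, smul_eq_mul, map_zero] at this
    simp only [P, Polynomial.eval_finsetSum, Polynomial.eval_monomial, Polynomial.eval_zero]
    rw [← this]
    exact Finset.sum_congr rfl fun i _ => mul_comm _ _
  have := congrArg (fun p => Polynomial.coeff p m) hP
  simpa [P, Polynomial.finsetSum_coeff, Polynomial.coeff_monomial, hm] using this

/-- Polarization: nilpotency of bounded index on a commuting linear space. -/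
theorem polarize {V : Type} [AddCommGroup V] [Module ℂ V] (𝔗 : Submodule ℂ (Module.End ℂ V))
    (hc : ∀ S ∈ 𝔗, ∀ T ∈ 𝔗, S * T = T * S) {p : ℕ} (hp : ∀ T ∈ 𝔗, T ^ p = 0) :
    ∀ L : List (Module.End ℂ V), (∀ T ∈ L, T ∈ 𝔗) → L.length = p → L.prod = 0 := by
  have main : ∀ (q k : ℕ), q + k = p → ∀ L : List (Module.End ℂ V), (∀ T ∈ L, T ∈ 𝔗) → L.length = q →
      ∀ T ∈ 𝔗, T ^ k * L.prod = 0 := by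
    intro q
    induction q with
    | zero =>
      intro k hk L hL hl T hT
      rw [zero_add] at hk
      rw [hk, hp T hT, zero_mul]
    | succ q ih =>
      intro k hk L hL hl T hT
      obtain ⟨U, L', rfl⟩ : ∃ U L', L = U :: L' := by
        cases L with
        | nil => simp at hl
        | cons U L' => exact ⟨U, L', rfl⟩
      have hU : U ∈ 𝔗 := hL U (by simp)
      have h1 := fun c : ℂ => ih (k + 1) (by omega) L' (fun T hT => hL T (by simp [hT])) (by simpa using hl)
        (c • U + T) (𝔗.add_mem (𝔗.smul_mem c hU) hT)
      have h2 := coeff_zero (k + 2) (fun m => (U ^ m * T ^ (k + 1 - m) * ((k + 1).choose m : Module.End ℂ V)) * L'.prod) ?_ 1 (by omega)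
      · simp only [pow_one, add_tsub_cancel_right, Nat.choose_one_right] at h2
        rw [← nsmul_eq_mul', smul_mul_assoc, ← Nat.cast_smul_eq_nsmul ℂ] at h2
        have h3 := (smul_eq_zero.1 h2).resolve_left (by exact_mod_cast Nat.succ_ne_zero k)
        rw [List.prod_cons, ← mul_assoc, ← h3]
        congr 1
        exact (((show Commute U T from hc U hU T hT).pow_right k).eq).symm
      · intro c
        rw [← h1 c, Commute.add_pow (by
          show (c • U) * T = T * (c • U)
          rw [smul_mul_assoc, hc U hU T hT, mul_smul_comm]), Finset.sum_mul]
        refine Finset.sum_congr rfl fun m _ => ?_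
        rw [smul_pow, smul_mul_assoc, smul_mul_assoc, smul_mul_assoc]
  intro L hL hl
  have := main p 0 (by simp) L hL hl 0 (zero_mem _)
  simpa using this

end Tor

namespace Tor

variable {r n : ℕ} {τ : Type} [LieRing τ] [LieAlgebra ℂ τ]
variable {A : GAlg r n τ} {B : Type} [CommRing B] [Algebra ℂ B] {V : Type}
    [AddCommGroup V] [Module ℂ V]

theorem pow_eq_zero_of_finrank {V : Type} [AddCommGroup V] [Module ℂ V] (N : Module.End ℂ V) (U : Submodule ℂ V)
    [FiniteDimensional ℂ U] {D : ℕ} (hD : Module.finrank ℂ U ≤ D) (h : ∀ v ∈ U, N v ∈ U) {v : V} (hv : v ∈ U)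
    {p : ℕ} (hp : (N ^ p) v = 0) : (N ^ D) v = 0 := by
  have hr : ∀ q : ℕ, ∀ w : U, (((N.restrict h) ^ q) w : V) = (N ^ q) w := by
    intro q
    induction q with
    | zero => intro w; simp
    | succ q ih => intro w; rw [pow_succ, pow_succ, Module.End.mul_apply, Module.End.mul_apply, ih]; rfl
  have h1 : (⟨v, hv⟩ : U) ∈ Module.End.maxGenEigenspace (N.restrict h) 0 := by
    rw [Module.End.mem_maxGenEigenspace]
    refine ⟨p, ?_⟩
    simp only [zero_smul, sub_zero]
    exact Subtype.ext (by rw [hr]; exact hp)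
  rw [Module.End.maxGenEigenspace_eq_genEigenspace_finrank, Module.End.mem_genEigenspace_nat] at h1
  simp only [zero_smul, sub_zero, LinearMap.mem_ker] at h1
  have h2 := congrArg Subtype.val h1
  rw [hr] at h2
  rw [← Nat.sub_add_cancel hD, pow_add, Module.End.mul_apply, h2]
  simp

theorem GRep.stab_top {R : GRep A B V} (hR : R.Good) (W : Submodule ℂ V)
    (h : ∀ b m, ∀ X ∈ A.g m, ∀ v ∈ W, R.ρ b X v ∈ W) {v : V} (hv : v ∈ W) (hv0 : v ≠ 0) : W = ⊤ := by
  refine (hR.irr W h).resolve_left fun h0 => hv0 ?_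
  rw [h0] at hv
  simpa using hv

/-- An element of square zero modulo the annihilator acts through the degree operators with a single
generalized eigenvalue. -/
theorem GRep.single_eigenvalue {R : GRep A B V} (hR : R.Good) {D : ℕ}
    (hD : ∀ l, Module.finrank ℂ (R.wsp l) ≤ D) {x : B} (hx : ∀ b m, ∀ X ∈ A.g m, R.ρ (x * x * b) X = 0)
    (i : Fin n) : ∃ c : ℂ, (R.ρ x (A.D i) - algebraMap ℂ (Module.End ℂ V) c) ^ D = 0 := by
  obtain ⟨l0, hl0⟩ := GRep.exists_weight hR
  have hst : ∀ l, ∀ v ∈ R.wsp l, R.ρ x (A.D i) v ∈ R.wsp l := fun l v hv =>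
    R.shift' hv (A.D_mem i) x (by simp)
  have := hR.fin
  have : Nontrivial (R.wsp l0) := Submodule.nontrivial_iff_ne_bot.2 hl0
  obtain ⟨c, hc⟩ := Module.End.exists_eigenvalue ((R.ρ x (A.D i)).restrict (hst l0))
  obtain ⟨w, hw⟩ := hc.exists_hasEigenvector
  refine ⟨c, ?_⟩
  set N := R.ρ x (A.D i) - algebraMap ℂ (Module.End ℂ V) c with hN
  have hNw : N (w : V) = 0 := by
    have := congrArg Subtype.val hw.apply_eq_smul
    simp [hN, Module.algebraMap_end_apply, sub_eq_zero] at this ⊢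
    exact this
  have hcomm : ∀ b m, ∀ X ∈ A.g m, ∀ v, N (R.ρ b X v) = R.ρ b X (N v) + (A.ι m i : ℂ) • R.ρ (x * b) X v := by
    intro b m X hX v
    simp only [hN, LinearMap.sub_apply, Module.algebraMap_end_apply, map_sub, map_smul]
    rw [R.comm (A.D_mem i) hX, A.lie_D i hX]
    simp only [map_smul, LinearMap.smul_apply]
    abel
  have hpow : ∀ (p : ℕ) b m, ∀ X ∈ A.g m, ∀ v, (N ^ (p + 1)) (R.ρ b X v) = R.ρ b X ((N ^ (p + 1)) v) +
      ((p + 1 : ℕ) * (A.ι m i : ℂ)) • R.ρ (x * b) X ((N ^ p) v) := by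
    intro p
    induction p with
    | zero => intro b m X hX v; simpa using hcomm b m X hX v
    | succ p ih =>
      intro b m X hX v
      rw [pow_succ', Module.End.mul_apply, ih b m X hX, map_add, map_smul, hcomm _ _ _ hX, hcomm _ _ _ hX,
        ← mul_assoc, hx b m X hX]
      rw [← Module.End.mul_apply N, ← pow_succ', ← Module.End.mul_apply N, ← pow_succ']
      simp only [LinearMap.zero_apply, smul_zero, add_zero]
      push_cast
      module
  have htop : Module.End.maxGenEigenspace N 0 = ⊤ := by
    refine GRep.stab_top hR _ ?_ (v := (w : V)) ?_ (by simpa using hw.2)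
    · intro b m X hX v hv
      rw [Module.End.mem_maxGenEigenspace] at hv ⊢
      simp only [zero_smul, sub_zero] at hv ⊢
      obtain ⟨p, hp⟩ := hv
      exact ⟨p + 1, by rw [hpow _ _ _ _ hX, pow_succ', Module.End.mul_apply, hp]; simp⟩
    · rw [Module.End.mem_maxGenEigenspace]
      exact ⟨1, by simpa using hNw⟩
  have : LinearMap.ker (N ^ D) = ⊤ := by
    refine GRep.sup_induct hR _ fun l v hv => ?_
    have hvt : v ∈ Module.End.maxGenEigenspace N 0 := by rw [htop]; trivial
    rw [Module.End.mem_maxGenEigenspace] at hvt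
    obtain ⟨p, hp⟩ := hvt
    refine pow_eq_zero_of_finrank N (R.wsp l) (hD l) ?_ hv (p := p) (by simpa using hp)
    intro v hv
    simp only [hN, LinearMap.sub_apply, Module.algebraMap_end_apply]
    exact Submodule.sub_mem _ (hst l v hv) (Submodule.smul_mem _ _ hv)
  exact LinearMap.ker_eq_top.1 this

/-- Operators of nonzero `i`-degree in the `x`-part. -/
def GRep.part (R : GRep A B V) (x : B) (i : Fin n) : Set (Module.End ℂ V) :=
  {T | ∃ b m, ∃ X ∈ A.g m, A.ι m i ≠ 0 ∧ T = R.ρ (x * b) X}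

theorem GRep.part_prod {R : GRep A B V} (hR : R.Good) {D : ℕ}
    (hD : ∀ l, Module.finrank ℂ (R.wsp l) ≤ D) {x : B} (hx : ∀ b m, ∀ X ∈ A.g m, R.ρ (x * x * b) X = 0)
    (i : Fin n) (L : List (Module.End ℂ V)) (hL : ∀ T ∈ L, T ∈ R.part x i) (hl : L.length = 2 * D) :
    L.prod = 0 := by
  obtain ⟨c, hN⟩ := GRep.single_eigenvalue hR hD hx i
  set N := R.ρ x (A.D i) - algebraMap ℂ (Module.End ℂ V) c with hN'
  let 𝔄 : Submodule ℂ (Module.End ℂ V) := Submodule.span ℂ {T | ∃ b m, ∃ X ∈ A.g m, T = R.ρ b X}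
  let 𝔛 : Submodule ℂ (Module.End ℂ V) := Submodule.span ℂ {T | ∃ b m, ∃ X ∈ A.g m, T = R.ρ (x * b) X}
  let 𝔗 : Submodule ℂ (Module.End ℂ V) := Submodule.span ℂ (R.part x i)
  have hTX : 𝔗 ≤ 𝔛 := Submodule.span_mono (by rintro _ ⟨b, m, X, hX, -, rfl⟩; exact ⟨b, m, X, hX, rfl⟩)
  have hXX : ∀ S ∈ 𝔛, ∀ T ∈ 𝔛, S * T = T * S := by
    intro S hS T hT
    induction hS using Submodule.span_induction with
    | mem S hS =>
      obtain ⟨b, m, X, hX, rfl⟩ := hS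
      induction hT using Submodule.span_induction with
      | mem T hT =>
        obtain ⟨b', m', X', hX', rfl⟩ := hT
        ext v
        have := R.comm hX hX' (x * b) (x * b') v
        rw [show x * b * (x * b') = x * x * (b * b') by ring, hx _ _ _ (A.lie_mem hX hX')] at this
        simpa using this
      | zero => simp
      | add S T _ _ h1 h2 => rw [mul_add, add_mul, h1, h2]
      | smul a T _ h => rw [mul_smul_comm, smul_mul_assoc, h]
    | zero => simp
    | add S T _ _ h1 h2 => rw [mul_add, add_mul, h1, h2]
    | smul a T _ h => rw [mul_smul_comm, smul_mul_assoc, h]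
  have hXA : ∀ S ∈ 𝔛, ∀ Y ∈ 𝔄, S * Y - Y * S ∈ 𝔛 := by
    intro S hS T hT
    induction hS using Submodule.span_induction with
    | mem S hS =>
      obtain ⟨b, m, X, hX, rfl⟩ := hS
      induction hT using Submodule.span_induction with
      | mem T hT =>
        obtain ⟨b', m', X', hX', rfl⟩ := hT
        refine Submodule.subset_span ⟨b * b', _, _, A.lie_mem hX hX', ?_⟩
        ext v
        have := R.comm hX hX' (x * b) b' v
        simp [this, mul_assoc]
      | zero => simp
      | add S T _ _ h1 h2 => convert Submodule.add_mem _ h1 h2 using 1; noncomm_ring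
      | smul a T _ h => rw [mul_smul_comm, smul_mul_assoc, ← smul_sub]; exact Submodule.smul_mem _ _ h
    | zero => simp
    | add S T _ _ h1 h2 => convert Submodule.add_mem _ h1 h2 using 1; noncomm_ring
    | smul a T _ h => rw [mul_smul_comm, smul_mul_assoc, ← smul_sub]; exact Submodule.smul_mem _ _ h
  have hN0 : R.ρ x (A.D i) ∈ 𝔛 := Submodule.subset_span ⟨1, 0, _, A.D_mem i, by simp⟩
  have hNX : ∀ T ∈ 𝔛, N * T = T * N := by
    intro T hT
    rw [hN', sub_mul, mul_sub, hXX _ hN0 _ hT, Algebra.commutes]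
  have hY : ∀ T ∈ 𝔗, ∃ Y ∈ 𝔄, N * Y = Y * N + T := by
    intro T hT
    induction hT using Submodule.span_induction with
    | mem T hT =>
      obtain ⟨b, m, X, hX, hm, rfl⟩ := hT
      have hm' : (A.ι m i : ℂ) ≠ 0 := by exact_mod_cast hm
      refine ⟨(A.ι m i : ℂ)⁻¹ • R.ρ b X, Submodule.smul_mem _ _ (Submodule.subset_span ⟨b, m, X, hX, rfl⟩), ?_⟩
      ext v
      have h1 := R.comm (A.D_mem i) hX x b v
      rw [A.lie_D i hX] at h1
      simp only [hN', map_smul, LinearMap.smul_apply] at h1 ⊢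
      simp [h1, Module.algebraMap_end_apply, smul_sub, smul_smul, hm']
      abel
    | zero => exact ⟨0, zero_mem _, by simp⟩
    | add S T _ _ h1 h2 =>
      obtain ⟨Y1, hY1, e1⟩ := h1
      obtain ⟨Y2, hY2, e2⟩ := h2
      exact ⟨Y1 + Y2, add_mem hY1 hY2, by rw [mul_add, add_mul, e1, e2]; abel⟩
    | smul a T _ h =>
      obtain ⟨Y1, hY1, e1⟩ := h
      exact ⟨a • Y1, Submodule.smul_mem _ _ hY1, by rw [mul_smul_comm, smul_mul_assoc, e1, smul_add]⟩
  refine polarize 𝔗 (fun S hS T hT => hXX S (hTX hS) T (hTX hT)) (p := 2 * D) ?_ L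
    (fun T hT => Submodule.subset_span (hL T hT)) hl
  intro T hT
  obtain ⟨Y, hYA, e⟩ := hY T hT
  have hZ := hXA T (hTX hT) Y hYA
  exact pow_comm_eq_zero (Z := T * Y - Y * T) e (hNX T (hTX hT)) (by abel) (hXX _ (hTX hT) _ hZ) hN

theorem GRep.radical {R : GRep A B V} (hR : R.Good) (hr : 1 ≤ r) {D : ℕ}
    (hD : ∀ l, Module.finrank ℂ (R.wsp l) ≤ D) {x : B} (hx : x * x ∈ R.ann hr) : x ∈ R.ann hr := by
  classical
  have hx' : ∀ b m, ∀ X ∈ A.g m, R.ρ (x * x * b) X = 0 := fun b m X hX =>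
    Ideal.mul_mem_right b _ hx m X hX
  obtain ⟨k0, hk0⟩ := exists_single_ne hr
  obtain ⟨i, hi⟩ : ∃ i, A.ι k0 i ≠ 0 := by
    by_contra! h
    exact hk0 (A.inj (by rw [map_zero]; ext i; exact h i))
  obtain ⟨k0, hi⟩ : ∃ k0, 0 < A.ι k0 i := by
    rcases lt_or_gt_of_ne hi with h | h
    · exact ⟨-k0, by simp [h]⟩
    · exact ⟨k0, h⟩
  have hex : ∃ P : ℕ, ∀ L : List (Module.End ℂ V), (∀ T ∈ L, T ∈ R.part x i) → L.length = P → L.prod = 0 :=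
    ⟨2 * D, GRep.part_prod hR hD hx' i⟩
  have hP := Nat.find_spec hex
  obtain ⟨l0, hl0⟩ := GRep.exists_weight hR
  obtain ⟨v0, -, hv0⟩ := Submodule.exists_mem_ne_zero_of_ne_bot hl0
  have hP0 : Nat.find hex ≠ 0 := by
    intro h0
    have := hP [] (by simp) (by simp [h0])
    exact hv0 (by simpa using congrArg (fun T : Module.End ℂ V => T v0) this)
  obtain ⟨P, hPP⟩ := Nat.exists_eq_succ_of_ne_zero hP0
  have hmin := Nat.find_min hex (m := P) (by omega)
  push Not at hmin
  obtain ⟨L, hL, hlen, hne⟩ := hmin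
  rw [hPP] at hP
  obtain ⟨v, hv⟩ : ∃ v, L.prod v ≠ 0 := by
    by_contra! h
    exact hne (by ext v; simpa using h v)
  have hbd : ∀ L : List (Module.End ℂ V), (∀ T ∈ L, T ∈ R.part x i) → ∃ C : ℕ, ∀ T ∈ L,
      ∃ b m, ∃ X ∈ A.g m, A.ι m i ≠ 0 ∧ A.ι m i < C ∧ T = R.ρ (x * b) X := by
    intro L
    induction L with
    | nil => intro _; exact ⟨0, by simp⟩
    | cons T L ih =>
      intro h
      obtain ⟨C, hC⟩ := ih fun T hT => h T (by simp [hT])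
      obtain ⟨b, m, X, hX, hm, e⟩ := h T (by simp)
      refine ⟨max C ((A.ι m i).natAbs + 1), ?_⟩
      intro S hS
      rcases List.mem_cons.1 hS with rfl | hS
      · exact ⟨b, m, X, hX, hm, by omega, e⟩
      · obtain ⟨b, m, X, hX, hm, hlt, e⟩ := hC S hS
        exact ⟨b, m, X, hX, hm, by omega, e⟩
  obtain ⟨C, hC⟩ := hbd L hL
  have hdir : ∀ b m, ∀ X ∈ A.g m, A.ι m i ≠ 0 → R.ρ (x * b) X (L.prod v) = 0 := by
    intro b m X hX hm
    have := hP (R.ρ (x * b) X :: L) (by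
      intro T hT
      rcases List.mem_cons.1 hT with rfl | hT
      · exact ⟨b, m, X, hX, hm, rfl⟩
      · exact hL T hT) (by simp [hlen])
    simpa using congrArg (fun T : Module.End ℂ V => T v) this
  refine GRep.ann_of_kills hR hr hv fun m b Z hZ => ?_
  by_cases hm : A.ι m i = 0
  swap
  · exact hdir b m Z hZ hm
  set k : Fin r → ℤ := ((C : ℤ) + 1) • k0 with hk
  have hki : (C : ℤ) < A.ι k i := by
    simp only [hk, map_zsmul, Pi.smul_apply, smul_eq_mul]
    nlinarith
  have hmk : A.ι (m - k) i = - A.ι k i := by simp [hm]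
  refine R.gen_kill (m := k) (k := m - k) ?_ _ _ ?_ (by simpa using hZ)
  · intro h
    rw [← h] at hmk
    omega
  intro X hX Y hY
  rw [show x * b = x * b * 1 by ring, R.lie_act hX hY, hdir b k X hX (by omega)]
  have key : ∀ L2 : List (Module.End ℂ V), (∀ T ∈ L2,
      ∃ b m, ∃ X ∈ A.g m, A.ι m i ≠ 0 ∧ A.ι m i < C ∧ T = R.ρ (x * b) X) →
      ∀ L1 : List (Module.End ℂ V), (∀ T ∈ L1, T ∈ R.part x i) → L1.length + L2.length = P + 1 →
      L1.prod * R.ρ 1 Y * L2.prod = 0 := by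
    intro L2
    induction L2 with
    | nil =>
      intro _ L1 h1 h2
      rw [hP L1 h1 (by simpa using h2)]
      simp
    | cons T L2 ih =>
      intro h3 L1 h1 h2
      have h3' := fun T hT => h3 T (List.mem_cons_of_mem _ hT)
      obtain ⟨b', m', X', hX', hm', hlt, rfl⟩ := h3 T (by simp)
      have h5 := ih h3' (L1 ++ [R.ρ (x * b') X']) (by
        intro S hS
        rcases List.mem_append.1 hS with hS | hS
        · exact h1 S hS
        · rw [List.mem_singleton.1 hS]
          exact ⟨b', m', X', hX', hm', rfl⟩) (by simp at h2 ⊢; omega)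
      have h6 := hP (L1 ++ R.ρ (x * b') ⁅Y, X'⁆ :: L2) (by
        intro S hS
        rcases List.mem_append.1 hS with hS | hS
        · exact h1 S hS
        · rcases List.mem_cons.1 hS with rfl | hS
          · refine ⟨b', _, _, A.lie_mem hY hX', ?_, rfl⟩
            rw [map_add, Pi.add_apply, hmk]
            omega
          · obtain ⟨b, m, X, hX, hm, _, e⟩ := h3' S hS
            exact ⟨b, m, X, hX, hm, e⟩) (by simp at h2 ⊢; omega)
      have h7 : R.ρ 1 Y * R.ρ (x * b') X' = R.ρ (x * b') X' * R.ρ 1 Y + R.ρ (x * b') ⁅Y, X'⁆ := by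
        ext w
        simpa using R.comm hY hX' 1 (x * b') w
      rw [List.prod_append, List.prod_cons, List.prod_nil, mul_one] at h5
      rw [List.prod_append, List.prod_cons] at h6
      rw [List.prod_cons, mul_assoc, ← mul_assoc (R.ρ 1 Y), h7, add_mul, mul_add, h6, add_zero, ← h5]
      simp only [mul_assoc]
  have := key L hC [R.ρ (x * b) X] (by
    intro S hS
    rw [List.mem_singleton.1 hS]
    exact ⟨b, k, X, hX, by omega, rfl⟩) (by simp [hlen, add_comm])
  simpa using congrArg (fun T : Module.End ℂ V => T v) this

theorem GRep.ann_reduced {R : GRep A B V} (hR : R.Good) (hr : 1 ≤ r) {D : ℕ}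
    (hD : ∀ l, Module.finrank ℂ (R.wsp l) ≤ D) : IsReduced (B ⧸ R.ann hr) := by
  rw [isReduced_iff_pow_one_lt 2 (by norm_num)]
  intro y hy
  obtain ⟨x, rfl⟩ := Ideal.Quotient.mk_surjective y
  rw [← map_pow, Ideal.Quotient.eq_zero_iff_mem, pow_two] at hy
  exact Ideal.Quotient.eq_zero_iff_mem.2 (GRep.radical hR hr hD hy)

end Tor

namespace Tor

variable {r n : ℕ} {τ : Type} [LieRing τ] [LieAlgebra ℂ τ]
variable {A : GAlg r n τ} {B : Type} [CommRing B] [Algebra ℂ B] {V : Type}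
    [AddCommGroup V] [Module ℂ V]

theorem nilpotent_ideal {C : Type} [CommRing C] [Algebra ℂ C] [FiniteDimensional ℂ C] {𝔮 : Ideal C} {j Q : ℕ}
    (h : 𝔮 ^ j = ⊥) (hQ : Module.finrank ℂ C ≤ Q) : 𝔮 ^ Q = ⊥ := by
  have main : ∀ i : ℕ, 𝔮 ^ i = ⊥ ∨ Module.finrank ℂ ((𝔮 ^ i).restrictScalars ℂ) + i ≤ Q := by
    intro i
    induction i with
    | zero => exact Or.inr (by simpa using (Submodule.finrank_le _).trans hQ)
    | succ i ih =>
      rcases ih with ih | ih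
      · exact Or.inl (by rw [pow_succ, ih, Ideal.bot_mul])
      have hle : 𝔮 ^ (i + 1) ≤ 𝔮 ^ i := Ideal.pow_le_pow_right (Nat.le_succ i)
      rcases hle.eq_or_lt with he | hlt
      · left
        have : ∀ k, 𝔮 ^ (i + 1 + k) = 𝔮 ^ (i + 1) := by
          intro k
          induction k with
          | zero => rfl
          | succ k ihk => rw [← add_assoc, pow_succ, ihk, he, ← pow_succ, he]
        rw [← this j, pow_add, h, Ideal.mul_bot]
      · right
        have := Submodule.finrank_lt_finrank_of_lt (s := (𝔮 ^ (i + 1)).restrictScalars ℂ)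
          (t := (𝔮 ^ i).restrictScalars ℂ) hlt
        omega
  rcases main Q with h | h
  · exact h
  · have h0 : Module.finrank ℂ ((𝔮 ^ Q).restrictScalars ℂ) = 0 := by omega
    have := Submodule.finrank_eq_zero.1 h0
    exact (Submodule.restrictScalars_eq_bot_iff ..).1 this

theorem pow_le_of_cofinite {P I : Ideal B} {j Q : ℕ} [FiniteDimensional ℂ (B ⧸ I)] (h : P ^ j ≤ I)
    (hQ : Module.finrank ℂ (B ⧸ I) ≤ Q) : P ^ Q ≤ I := by
  have h1 : (P.map (Ideal.Quotient.mk I)) ^ j = ⊥ := by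
    rw [← Ideal.map_pow, eq_bot_iff, Ideal.map_le_iff_le_comap]
    intro x hx
    simpa using Ideal.Quotient.eq_zero_iff_mem.2 (h hx)
  have h2 := nilpotent_ideal h1 hQ
  rw [← Ideal.map_pow, eq_bot_iff, Ideal.map_le_iff_le_comap] at h2
  intro x hx
  have := h2 hx
  exact Ideal.Quotient.eq_zero_iff_mem.1 (by simpa using this)

/-- Coefficients killing the degree `γ` operators on a weight space. -/
def GRep.annW (R : GRep A B V) (l : Fin n → ℂ) (γ : Fin r → ℤ) : Ideal B where
  carrier := {b | ∀ c, ∀ X ∈ A.g γ, ∀ v ∈ R.wsp l, R.ρ (c * b) X v = 0}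
  zero_mem' := by intro c X _ v _; simp
  add_mem' := by
    intro a b ha hb c X hX v hv
    rw [mul_add, map_add, LinearMap.add_apply, LinearMap.add_apply, ha c X hX v hv, hb c X hX v hv, add_zero]
  smul_mem' := by
    intro a b hb c X hX v hv
    rw [smul_eq_mul, ← mul_assoc]
    exact hb _ X hX v hv

theorem GRep.mem_annW_of_ne (R : GRep A B V) {l : Fin n → ℂ} {γ : Fin r → ℤ} (hγ : γ ≠ 0) {b : B}
    (h : ∀ X ∈ A.g γ, ∀ v ∈ R.wsp l, R.ρ b X v = 0) : b ∈ R.annW l γ := by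
  intro c X hX v hv
  obtain ⟨i, hi⟩ : ∃ i, A.ι γ i ≠ 0 := by
    by_contra! h
    exact hγ (A.inj (by rw [map_zero]; ext i; exact h i))
  have h1 := R.comm (A.D_mem i) hX c b v
  rw [h X hX v hv, map_zero, h X hX _ (R.shift' hv (A.D_mem i) c (by simp)), zero_add, A.lie_D i hX,
    map_smul, LinearMap.smul_apply] at h1
  exact (smul_eq_zero.1 h1.symm).resolve_left (by exact_mod_cast hi)

theorem GRep.annW_mul (R : GRep A B V) {l : Fin n → ℂ} {a b : Fin r → ℤ} (hab : a ≠ b) :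
    R.annW l a * R.annW l b ≤ R.annW l (a + b) := by
  rw [Ideal.mul_le]
  intro x hx y hy c Z hZ v hv
  refine R.gen_kill hab _ v ?_ hZ
  intro X hX Y hY
  rw [← mul_assoc, R.lie_act hX hY, ← one_mul y, hy 1 Y hY v hv, hx c X hX v hv]
  simp

theorem GRep.annW_codim {R : GRep A B V} (hR : R.Good) (hr : 2 ≤ r) (hno : ∀ m, m ≠ 0 → ¬ cone m ⊆ R.Bd)
    {D : ℕ} (hD : ∀ l, Module.finrank ℂ (R.wsp l) ≤ D) (l : Fin n → ℂ) : ∃ Q : ℕ, ∀ γ : Fin r → ℤ, γ ≠ 0 →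
    FiniteDimensional ℂ (B ⧸ R.annW l γ) ∧ Module.finrank ℂ (B ⧸ R.annW l γ) ≤ Q := by
  classical
  have := hR.fin
  refine ⟨Fintype.card (CI r × Fin A.q × Fin A.q × Fin D) * D, fun γ hγ => ?_⟩
  obtain ⟨i, -, hi⟩ := Finset.exists_max_image (Finset.univ : Finset (Fin r)) (fun i => |γ i|)
    ⟨⟨0, by omega⟩, Finset.mem_univ _⟩
  have hi0 : γ i ≠ 0 := by
    intro h
    apply hγ
    ext j
    have := hi j (Finset.mem_univ _)
    simp only [h, abs_zero] at this
    simpa using this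
  obtain ⟨j, hij⟩ : ∃ j : Fin r, j ≠ i := by
    have : Nontrivial (Fin r) := Fin.nontrivial_iff_two_le.2 hr
    exact exists_ne i
  have hmin : ∀ c : CI r, ∃ p q, γ p * (-γ + cs 10 j c) q ≠ γ q * (-γ + cs 10 j c) p := by
    intro c
    refine ⟨i, j, ?_⟩
    have h1 := abs_le.1 (ci_bound c i)
    have h2 := abs_le.1 (ci_bound c j)
    have h3 := hi j (Finset.mem_univ _)
    simp only [Pi.add_apply, Pi.neg_apply, cs_same, cs_ne _ hij.symm]
    intro h4
    have h5 : γ i * ((if c.1 then 10 else -10) + c.2.1 j) = γ j * c.2.1 i := by linarith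
    have h6 := congrArg abs h5
    rw [abs_mul, abs_mul] at h6
    have h7 : 8 ≤ |(if c.1 then (10 : ℤ) else -10) + c.2.1 j| := by
      split_ifs
      · exact (by omega : (8 : ℤ) ≤ 10 + c.2.1 j).trans (le_abs_self _)
      · exact (by omega : (8 : ℤ) ≤ -(-10 + c.2.1 j)).trans (neg_le_abs _)
    have h8 := ci_bound c i
    have h9 : 0 < |γ i| := abs_pos.2 hi0
    nlinarith [abs_nonneg (γ j), abs_nonneg (c.2.1 i)]
  choose G1 hG1 using fun c : CI r => A.fd (-γ + cs 10 j c)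
  obtain ⟨G2, hG2⟩ := A.fd γ
  obtain ⟨G3, hG3⟩ := exists_fin_span (R.wsp l) (hD l)
  obtain ⟨C, hC⟩ := exists_codim (I := CI r × Fin A.q × Fin A.q × Fin D) (d := D) (P := B)
    (fun t => (R.ρ 1 (G1 t.1 t.2.1)) ∘ₗ (R.ρ.flip (G2 t.2.2.1)).flip (G3 t.2.2.2))
    (fun t => R.wsp (l + A.ic γ + A.ic (-γ + cs 10 j t.1))) (fun t => hD _) (by
      rintro ⟨c, p, q', x⟩ b
      have h1 : G3 x ∈ R.wsp l := hG3 ▸ Submodule.subset_span ⟨x, rfl⟩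
      have h2 : G2 q' ∈ A.g γ := hG2 ▸ Submodule.subset_span ⟨q', rfl⟩
      have h3 : G1 c p ∈ A.g (-γ + cs 10 j c) := hG1 c ▸ Submodule.subset_span ⟨p, rfl⟩
      exact R.shift (R.shift h1 h2 b) h3 1)
  have hmem : ∀ b0 : B, (∀ t : CI r × Fin A.q × Fin A.q × Fin D, ((R.ρ 1 (G1 t.1 t.2.1)) ∘ₗ
      (R.ρ.flip (G2 t.2.2.1)).flip (G3 t.2.2.2)) b0 = 0) → b0 ∈ R.annW l γ := by
    intro b0 h0
    refine R.mem_annW_of_ne hγ fun X hX v hv => ?_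
    refine no_vector hR (by omega) (m := -γ) (neg_ne_zero.2 hγ) (hno _ ?_) (N := 10) (by norm_num) j ?_
    · exact smul_ne_zero two_ne_zero (neg_ne_zero.2 hγ)
    intro c
    rw [kills_one]
    intro b Y hY
    refine R.ad_trick' (hmin c) hX hY (fun v hv => ?_) b hv
    rw [← hG1 c] at hY
    rw [← hG2] at hX
    rw [← hG3] at hv
    induction hY using Submodule.span_induction with
    | mem Y hY =>
      obtain ⟨p, rfl⟩ := hY
      induction hX using Submodule.span_induction with
      | mem X hX =>
        obtain ⟨q', rfl⟩ := hX
        induction hv using Submodule.span_induction with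
        | mem v hv =>
          obtain ⟨x, rfl⟩ := hv
          exact h0 (c, p, q', x)
        | zero => simp
        | add a b _ _ h1 h2 => rw [map_add, map_add, h1, h2, add_zero]
        | smul a b _ h => rw [map_smul, map_smul, h, smul_zero]
      | zero => simp
      | add a b _ _ h1 h2 => rw [map_add, LinearMap.add_apply, map_add, h1, h2, add_zero]
      | smul a b _ h => rw [map_smul, LinearMap.smul_apply, map_smul, h, smul_zero]
    | zero => simp
    | add a b _ _ h1 h2 => rw [map_add, LinearMap.add_apply, h1, h2, add_zero]
    | smul a b _ h => rw [map_smul, LinearMap.smul_apply, h, smul_zero]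
  have hspan : Submodule.span ℂ (Set.range fun k => (Ideal.Quotient.mkₐ ℂ (R.annW l γ)) (C k)) = ⊤ := by
    rw [eq_top_iff]
    rintro y -
    obtain ⟨b, rfl⟩ := Ideal.Quotient.mk_surjective y
    obtain ⟨b0, h1, h2⟩ := hC b
    have h3 := Submodule.mem_map_of_mem (f := (Ideal.Quotient.mkₐ ℂ (R.annW l γ)).toLinearMap) h2
    rw [Submodule.map_span, ← Set.range_comp] at h3
    have h4 : (Ideal.Quotient.mk (R.annW l γ)) b0 = 0 := Ideal.Quotient.eq_zero_iff_mem.2 (hmem b0 h1)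
    simpa [h4, Function.comp_def] using h3
  constructor
  · exact Module.Finite.of_fg_top ⟨Finset.univ.image fun k => (Ideal.Quotient.mkₐ ℂ (R.annW l γ)) (C k), by simpa using hspan⟩
  · have := finrank_range_le_card (R := ℂ) (b := fun k => (Ideal.Quotient.mkₐ ℂ (R.annW l γ)) (C k))
    rw [Set.finrank, hspan, finrank_top, Fintype.card_fin] at this
    exact this

theorem GRep.pow_le_annW {R : GRep A B V} {l : Fin n → ℂ} {P : Ideal B}
    (hP : ∀ s : Fin r → ℤ, s ≠ 0 → (∀ i, |s i| ≤ 2) → P ≤ R.annW l s) (x : ℕ) :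
    ∀ γ : Fin r → ℤ, γ ≠ 0 → (∀ i, |γ i| ≤ x + 2) → P ^ (x + 1) ≤ R.annW l γ := by
  induction x with
  | zero =>
    intro γ hγ h
    rw [zero_add, pow_one]
    exact hP γ hγ fun i => by simpa using h i
  | succ x ih =>
    intro γ hγ h
    by_cases h2 : ∀ i, |γ i| ≤ 2
    · exact (Ideal.pow_le_self (by omega)).trans (hP γ hγ h2)
    push Not at h2
    obtain ⟨i, hi⟩ := h2
    set b : Fin r → ℤ := fun i => (γ i).sign with hb
    have key : ∀ z : ℤ, |z.sign| ≤ 1 := by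
      intro z
      rcases lt_trichotomy z 0 with hz | hz | hz
      · simp [Int.sign_eq_neg_one_of_neg hz]
      · simp [hz]
      · simp [Int.sign_eq_one_of_pos hz]
    have key2 : ∀ z : ℤ, |z| ≤ x + 3 → |z - z.sign| ≤ x + 2 := by
      intro z h
      rw [abs_le] at h ⊢
      rcases lt_trichotomy z 0 with hz | hz | hz
      · rw [Int.sign_eq_neg_one_of_neg hz]; omega
      · simp [hz]; omega
      · rw [Int.sign_eq_one_of_pos hz]; omega
    have hbi := key (γ i)
    have hgi : ∃ i, (γ - b) i ≠ 0 ∧ (γ - b) i ≠ b i ∧ b i ≠ 0 := by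
      refine ⟨i, ?_⟩
      simp only [hb, Pi.sub_apply]
      rcases lt_trichotomy (γ i) 0 with hz | hz | hz
      · rw [abs_of_neg hz] at hi
        rw [Int.sign_eq_neg_one_of_neg hz]; omega
      · rw [hz] at hi; simp at hi
      · rw [abs_of_pos hz] at hi
        rw [Int.sign_eq_one_of_pos hz]; omega
    obtain ⟨i, h3, h4, h5⟩ := hgi
    have ha := ih (γ - b) (fun h => h3 (by rw [h]; rfl)) fun i => key2 _ (by
      have := h i
      push_cast at this
      linarith)
    have hb' := hP b (fun h => h5 (by rw [h]; rfl)) fun i => (key (γ i)).trans (by norm_num)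
    have h6 := R.annW_mul (l := l) (a := γ - b) (b := b) fun h => h4 (by rw [h])
    rw [sub_add_cancel] at h6
    rw [pow_succ]
    exact (Ideal.mul_mono ha hb').trans h6

theorem GRep.ann_cofinite {R : GRep A B V} (hR : R.Good) (hr : 2 ≤ r) (hno : ∀ m, m ≠ 0 → ¬ cone m ⊆ R.Bd)
    {D : ℕ} (hD : ∀ l, Module.finrank ℂ (R.wsp l) ≤ D) (hr1 : 1 ≤ r) : FiniteDimensional ℂ (B ⧸ R.ann hr1) := by
  obtain ⟨l, hl⟩ := GRep.exists_weight hR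
  obtain ⟨v, hv, hv0⟩ := Submodule.exists_mem_ne_zero_of_ne_bot hl
  obtain ⟨Q, hQ⟩ := annW_codim hR hr hno hD l
  let F : Set (Fin r → ℤ) := {s | s ≠ 0 ∧ ∀ i, |s i| ≤ 2}
  have hF : F.Finite := (Set.finite_Icc (fun _ => (-2 : ℤ)) (fun _ => 2)).subset
    fun s hs => ⟨fun i => (abs_le.1 (hs.2 i)).1, fun i => (abs_le.1 (hs.2 i)).2⟩
  let P : Ideal B := ⨅ s ∈ F, R.annW l s
  have hPs : ∀ s : Fin r → ℤ, s ≠ 0 → (∀ i, |s i| ≤ 2) → P ≤ R.annW l s := fun s h1 h2 =>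
    iInf₂_le (f := fun s (_ : s ∈ F) => R.annW l s) s ⟨h1, h2⟩
  have hPQ : ∀ γ : Fin r → ℤ, γ ≠ 0 → P ^ Q ≤ R.annW l γ := by
    intro γ hγ
    obtain ⟨C, hC⟩ := exists_bound γ
    have := (hQ γ hγ).1
    refine pow_le_of_cofinite (pow_le_annW hPs C.toNat γ hγ fun i => ?_) (hQ γ hγ).2
    have := hC i
    omega
  have hPQ2 : ∀ γ : Fin r → ℤ, P ^ (Q + Q) ≤ R.annW l γ := by
    intro γ
    by_cases hγ : γ = 0
    · obtain ⟨k, hk⟩ := exists_single_ne (r := r) hr1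
      have hkk : k ≠ -k := fun h => hk (self_eq_neg.1 h)
      have := R.annW_mul (l := l) hkk
      rw [add_neg_cancel, ← hγ] at this
      rw [pow_add]
      exact (Ideal.mul_mono (hPQ k hk) (hPQ (-k) (neg_ne_zero.2 hk))).trans this
    · exact (Ideal.pow_le_pow_right (by omega)).trans (hPQ γ hγ)
  have hle : P ^ (Q + Q) ≤ R.ann hr1 := by
    refine ann_of_kill hR hr1 _ hv0 fun b hb m X hX => ?_
    simpa using hPQ2 m hb 1 X hX v hv
  have hred := ann_reduced hR hr1 hD
  have hPJ : P ≤ R.ann hr1 := by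
    intro x hx
    have h1 : x ^ (Q + Q) ∈ R.ann hr1 := hle (Ideal.pow_mem_pow hx _)
    have h2 : (Ideal.Quotient.mk (R.ann hr1) x) ^ (Q + Q) = 0 := by
      rw [← map_pow]; exact Ideal.Quotient.eq_zero_iff_mem.2 h1
    exact Ideal.Quotient.eq_zero_iff_mem.1 (hred.eq_zero _ ⟨_, h2⟩)
  have hcof : (P.restrictScalars ℂ).CoFG := by
    have h1 := Submodule.CoFG.sInf_of_finite (R := ℂ) (s := (fun s => (R.annW l s).restrictScalars ℂ) '' F)
      (hF.image _) (by
        rintro _ ⟨s, hs, rfl⟩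
        have := (hQ s hs.1).1
        exact Module.Finite.equiv (Submodule.Quotient.restrictScalarsEquiv ℂ (R.annW l s)).symm)
    refine h1.of_le ?_
    intro x hx
    simp only [Submodule.mem_sInf, Set.mem_image, forall_exists_index, and_imp, forall_apply_eq_imp_iff₂] at hx
    simpa [P] using hx
  have h2 : ((R.ann hr1).restrictScalars ℂ).CoFG := hcof.of_le hPJ
  have : Module.Finite ℂ (B ⧸ (R.ann hr1).restrictScalars ℂ) := h2
  exact Module.Finite.equiv (Submodule.Quotient.restrictScalarsEquiv ℂ (R.ann hr1))

end Tor

namespace Tor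

variable {r n : ℕ} {τ : Type} [LieRing τ] [LieAlgebra ℂ τ]
variable {A : GAlg r n τ} {B : Type} [CommRing B] [Algebra ℂ B] {V : Type}
    [AddCommGroup V] [Module ℂ V]

theorem exists_idempotent {C : Type} [CommRing C] [Algebra ℂ C] [FiniteDimensional ℂ C] [IsReduced C]
    [Nontrivial C] (h : ¬ IsField C) : ∃ e : C, e * e = e ∧ e ≠ 0 ∧ e ≠ 1 := by
  have : IsArtinianRing C := IsArtinianRing.of_finite ℂ C
  have : ¬ IsDomain C := fun _ => h (IsArtinianRing.isField_of_isDomain C)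
  have : ¬ NoZeroDivisors C := fun h => this (NoZeroDivisors.to_isDomain C)
  rw [noZeroDivisors_iff] at this
  push Not at this
  obtain ⟨a, b, hab, ha, hb⟩ := this
  obtain ⟨k, y, hy⟩ := IsArtinian.exists_pow_succ_smul_dvd (M := C) a (1 : C)
  simp only [smul_eq_mul, mul_one, Nat.succ_eq_add_one] at hy
  have h1 : a * (1 - a * y) = 0 := by
    refine IsReduced.eq_zero _ ⟨k + 1, ?_⟩
    rw [mul_pow, pow_succ' a k, pow_succ (1 - a * y)]
    linear_combination (-(a * (1 - a * y) ^ k)) * hy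
  refine ⟨a * y, ?_, ?_, ?_⟩
  · linear_combination (-y) * h1
  · intro h0
    rw [h0] at h1
    exact ha (by simpa using h1)
  · intro h0
    apply hb
    linear_combination (-b) * h0 + y * hab

theorem finite_shift {V : Type} [AddCommGroup V] [Module ℂ V] (U U' : Submodule ℂ V) [FiniteDimensional ℂ U]
    [FiniteDimensional ℂ U'] (E : Module.End ℂ V) (hU : ∀ v ∈ U, E v ∈ U) (hU' : ∀ v ∈ U', E v ∈ U') :
    {a : ℂ | ∃ F : V →ₗ[ℂ] V, (∀ v ∈ U, F v ∈ U') ∧ (∃ v ∈ U, F v ≠ 0) ∧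
      ∀ v ∈ U, E (F v) = F (E v) + a • F v}.Finite := by
  let T : Module.End ℂ (U →ₗ[ℂ] U') := LinearMap.compRight ℂ (E.restrict hU') - LinearMap.lcomp ℂ U' (E.restrict hU)
  refine (Module.End.finite_hasEigenvalue T).subset ?_
  rintro a ⟨F, hF, ⟨v, hv, hne⟩, h⟩
  refine Module.End.hasEigenvalue_of_hasEigenvector (x := F.restrict hF) ⟨?_, ?_⟩
  · rw [Module.End.mem_eigenspace_iff]
    ext w
    have := h w w.2
    simp [T, this]
  · intro h0
    apply hne
    exact congrArg Subtype.val (LinearMap.congr_fun h0 ⟨v, hv⟩)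

/-- Degrees `γ` at which complementary idempotents interact on a weight space. -/
theorem GRep.finite_interaction {R : GRep A B V} (hR : R.Good) {e : B} (he : R.Idem e)
    (he' : ∀ b m, ∀ X ∈ A.g m, R.ρ (e * (1 - e) * b) X = 0) (l : Fin n → ℂ) :
    ∃ Γ : Set (Fin r → ℤ), Γ.Finite ∧ ∀ γ, γ ∉ Γ → ∀ b, ∀ X ∈ A.g γ, ∀ v ∈ R.wsp l,
      ∀ σ : Fin r → ℤ, (∀ i, |σ i| ≤ 2) → R.Kills (1 - e) (-γ + σ) (R.ρ (e * b) X v) := by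
  have := hR.fin
  let Sg : Set (Fin r → ℤ) := Set.Icc (fun _ => (-2 : ℤ)) (fun _ => 2)
  have hst : ∀ i l, ∀ v ∈ R.wsp l, R.ρ e (A.D i) v ∈ R.wsp l := fun i l v hv =>
    R.shift' hv (A.D_mem i) e (by simp)
  let S : Fin n → (Fin r → ℤ) → Set ℂ := fun i σ => {a : ℂ | ∃ F : V →ₗ[ℂ] V, (∀ v ∈ R.wsp l, F v ∈ R.wsp (l + A.ic σ)) ∧
    (∃ v ∈ R.wsp l, F v ≠ 0) ∧ ∀ v ∈ R.wsp l, R.ρ e (A.D i) (F v) = F (R.ρ e (A.D i) v) + a • F v}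
  have hS : ∀ i σ, (S i σ).Finite := fun i σ => finite_shift _ _ _ (hst i _) (hst i _)
  refine ⟨{γ | ∀ i, A.ic γ i ∈ ⋃ σ ∈ Sg, S i σ}, ?_, ?_⟩
  · refine Set.Finite.of_finite_image (f := A.ic) ?_ A.ic_inj.injOn
    refine (Set.Finite.pi' fun i => (Set.finite_Icc (fun _ : Fin r => (-2 : ℤ)) (fun _ => 2)).biUnion
      fun σ _ => hS i σ).subset ?_
    rintro _ ⟨γ, hγ, rfl⟩
    exact hγ
  · intro γ hγ b X hX v hv σ hσ c Y hY
    by_contra hne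
    refine hγ fun i => ?_
    rw [Set.mem_iUnion₂]
    refine ⟨σ, ⟨fun i => (abs_le.1 (hσ i)).1, fun i => (abs_le.1 (hσ i)).2⟩,
      R.ρ ((1 - e) * c) Y ∘ₗ R.ρ (e * b) X, ?_, ⟨v, hv, hne⟩, ?_⟩
    · intro v hv
      exact R.shift' (R.shift hv hX _) hY _ (by rw [map_add, map_neg]; abel)
    · intro v hv
      simp only [LinearMap.comp_apply]
      rw [R.comm (A.D_mem i) hY, R.comm (A.D_mem i) hX, ← mul_assoc e (1 - e) c, he' _ _ _ (A.lie_mem (A.D_mem i) hY),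
        ← mul_assoc e e b, he _ _ _ (A.lie_mem (A.D_mem i) hX), A.lie_D i hX]
      simp [GAlg.ic_apply]

theorem exists_large (S : Set (Fin r → ℤ)) (hS : S.Finite) : ∃ C : ℤ, ∀ s ∈ S, ∀ i, |s i| ≤ C := by
  choose f hf using exists_bound (r := r)
  obtain ⟨C, hC⟩ := hS.image f |>.bddAbove
  exact ⟨C, fun s hs i => (hf s i).trans (hC ⟨s, hs, rfl⟩)⟩

theorem GRep.no_idempotent {R : GRep A B V} (hR : R.Good) (hr : 1 ≤ r) (hno : ∀ m, m ≠ 0 → ¬ cone m ⊆ R.Bd)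
    {e : B} (h : e * e - e ∈ R.ann hr) (h0 : e ∉ R.ann hr) (h1 : 1 - e ∉ R.ann hr) : False := by
  have he : R.Idem e := by
    intro b m X hX
    have := Ideal.mul_mem_right b _ h m X hX
    rw [sub_mul, map_sub, LinearMap.sub_apply, sub_eq_zero] at this
    exact this
  have he' : ∀ b m, ∀ X ∈ A.g m, R.ρ (e * (1 - e) * b) X = 0 := by
    intro b m X hX
    have := Ideal.mul_mem_right (-b) _ h m X hX
    rwa [show (e * e - e) * -b = e * (1 - e) * b by ring] at this
  have hf : R.Idem (1 - e) := by
    intro b m X hX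
    rw [show (1 - e) * (1 - e) * b = (1 - e) * b - e * (1 - e) * b by ring, map_sub, LinearMap.sub_apply,
      he' b m X hX, sub_zero]
  obtain ⟨l, hl⟩ := GRep.exists_weight hR
  obtain ⟨v0, hv0, hv00⟩ := Submodule.exists_mem_ne_zero_of_ne_bot hl
  obtain ⟨Γ, hΓ, hΓ'⟩ := finite_interaction hR he he' l
  have hdeep : ∀ γ, γ ∉ Γ → (∃ b, ∃ X ∈ A.g γ, ∃ v ∈ R.wsp l, R.ρ (e * b) X v ≠ 0) → R.deep (1 - e) (-γ) = ⊤ := by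
    rintro γ hγ ⟨b, X, hX, v, hv, hne⟩
    exact deep_eq_top hR hne (deep_of_box R hf hr fun s hs => hΓ' γ hγ b X hX v hv s hs)
  obtain ⟨m, hm, hmd⟩ : ∃ m, m ≠ 0 ∧ R.deep (1 - e) m = ⊤ := by
    by_contra! hcon
    refine h0 (ann_of_kills hR hr hv00 (kills_all hr he (hΓ.union (Set.finite_singleton 0)) fun γ hγ => ?_))
    rw [Set.mem_union, not_or] at hγ
    intro b X hX
    by_contra hne
    exact hcon (-γ) (neg_ne_zero.2 hγ.2) (hdeep γ hγ.1 ⟨b, X, hX, v0, hv0, hne⟩)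
  have hk : ∀ γ ∈ cone m, γ ∉ Γ → R.Kills e γ v0 := by
    intro γ hγ hγΓ b X hX
    by_contra hne
    have hd := hdeep γ hγΓ ⟨b, X, hX, v0, hv0, hne⟩
    refine h1 (ann_of_kills hR hr hv00 fun j => ?_)
    obtain ⟨N1, hN1⟩ : v0 ∈ R.deep (1 - e) m := hmd ▸ Submodule.mem_top
    obtain ⟨N2, hN2⟩ : v0 ∈ R.deep (1 - e) (-γ) := hd ▸ Submodule.mem_top
    obtain ⟨C, hC⟩ := exists_bound j
    obtain ⟨i, hi⟩ := Function.ne_iff.1 (cone_ne_zero hm hγ)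
    obtain ⟨x, s, rfl, hx, hs⟩ := hγ
    set γ := x • m + s with hγd
    let y : ℤ := max (C + N1) (max N2 (C + 1))
    have hy1 : C + N1 ≤ y := le_max_left _ _
    have hy2 : N2 ≤ y := (le_max_left _ _).trans (le_max_right _ _)
    have hy3 : C + 1 ≤ y := (le_max_right _ _).trans (le_max_right _ _)
    have hC0 : 0 ≤ C := (abs_nonneg _).trans (hC i)
    have k1 := hN1 (y * x) (j + y • s) (fun i => by
      have h1 := hs i
      have h2 := hC i
      have h3 : |(j + y • s) i| ≤ |j i| + y * |s i| := by
        refine (abs_add_le _ _).trans ?_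
        simp [abs_mul, abs_of_nonneg (show 0 ≤ y by omega)]
      nlinarith)
    have k2 := hN2 y 0 (fun i => by simpa using hy2)
    have := kills_add hf (m := (y * x) • m + (j + y • s)) (k := y • (-γ) + 0) ?_ k1 k2
    · convert this using 1
      rw [hγd]; module
    · intro heq
      have h5 := congrFun heq i
      have h6 : j i = - (2 * y * γ i) := by
        simp only [hγd, Pi.add_apply, Pi.smul_apply, smul_eq_mul, Pi.neg_apply, add_zero, Pi.zero_apply] at h5 ⊢
        linarith
      have h7 := hC i
      rw [h6, abs_neg, abs_mul, abs_of_nonneg (by omega : 0 ≤ 2 * y)] at h7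
      have h8 : 1 ≤ |γ i| := Int.one_le_abs hi
      nlinarith
  obtain ⟨C, hC⟩ := exists_large Γ hΓ
  obtain ⟨N1, hN1⟩ : v0 ∈ R.deep (1 - e) m := hmd ▸ Submodule.mem_top
  obtain ⟨i, hi⟩ := Function.ne_iff.1 hm
  let y : ℤ := max (C + 3) (max (N1 + 2) 3)
  have hy1 : C + 3 ≤ y := le_max_left _ _
  have hy2 : N1 + 2 ≤ y := (le_max_left _ _).trans (le_max_right _ _)
  have hy3 : 3 ≤ y := (le_max_right _ _).trans (le_max_right _ _)
  have hym : y • m ≠ 0 := smul_ne_zero (by omega) hm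
  refine hno _ hym (box_Bd hR hr hym hv00 fun s hs => ?_)
  rw [kills_one]
  intro b X hX
  have hnot : y • m + s ∉ Γ := by
    intro hmem
    have h1 := hC _ hmem i
    have h2 := hs i
    have h3 : 1 ≤ |m i| := Int.one_le_abs hi
    have h4 : y * |m i| ≤ |(y • m + s) i| + |s i| := by
      have := abs_sub ((y • m + s) i) (s i)
      have h5 : (y • m + s) i - s i = y * m i := by simp
      rw [h5, abs_mul, abs_of_nonneg (by omega : 0 ≤ y)] at this
      exact this
    nlinarith
  have e1 := hk _ ⟨y, s, rfl, by omega, fun i => by have := hs i; omega⟩ hnot b X hX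
  have e2 := hN1 y s (fun i => by have := hs i; omega) b X hX
  have : b = e * b + (1 - e) * b := by ring
  rw [this, map_add, LinearMap.add_apply, LinearMap.add_apply, e1, e2, add_zero]

/-- Without bounded directions the annihilator in the coefficient ring is maximal. -/
theorem GRep.ann_maximal {R : GRep A B V} (hR : R.Good) (hr : 2 ≤ r) (hno : ∀ m, m ≠ 0 → ¬ cone m ⊆ R.Bd)
    (hr1 : 1 ≤ r) : (R.ann hr1).IsMaximal := by
  obtain ⟨D, hD⟩ := bounded_of_no_cone hR hr hno
  have := ann_cofinite hR hr hno hD hr1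
  have := ann_reduced hR hr1 hD
  have : Nontrivial (B ⧸ R.ann hr1) := Ideal.Quotient.nontrivial_iff.2 (ann_ne_top hR hr1)
  refine Ideal.Quotient.maximal_of_isField _ ?_
  by_contra hf
  obtain ⟨y, hy, hy0, hy1⟩ := exists_idempotent hf
  obtain ⟨e, rfl⟩ := Ideal.Quotient.mk_surjective y
  refine no_idempotent hR hr1 hno (e := e) ?_ (fun h => hy0 (Ideal.Quotient.eq_zero_iff_mem.2 h)) fun h => hy1 ?_
  · rw [← Ideal.Quotient.eq_zero_iff_mem, map_sub, map_mul, hy, sub_self]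
  · rw [← Ideal.Quotient.eq_zero_iff_mem, map_sub, map_one, sub_eq_zero] at h
    exact h.symm

end Tor

namespace Tor

theorem exists_dual_vec {n : ℕ} (S : Submodule ℂ (Fin n → ℂ)) {μ : Fin n → ℂ} (h : μ ∉ S) :
    ∃ y : Fin n → ℂ, (∀ s ∈ S, y ⬝ᵥ s = 0) ∧ y ⬝ᵥ μ = 1 := by
  obtain ⟨f, hf, hS⟩ := Submodule.exists_le_ker_of_notMem h
  have key : ∀ x : Fin n → ℂ, (fun i => (f μ)⁻¹ * f (Pi.single i 1)) ⬝ᵥ x = (f μ)⁻¹ * f x := by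
    intro x
    conv_rhs => rw [show x = ∑ i, x i • (Pi.single i (1 : ℂ) : Fin n → ℂ) by
      ext j; simp [Finset.sum_apply, Pi.single_apply]]
    rw [map_sum, dotProduct, Finset.mul_sum]
    refine Finset.sum_congr rfl fun i _ => ?_
    rw [map_smul, smul_eq_mul]; ring
  refine ⟨fun i => (f μ)⁻¹ * f (Pi.single i 1), fun s hs => ?_, ?_⟩
  · rw [key, LinearMap.mem_ker.1 (hS hs), mul_zero]
  · rw [key, inv_mul_cancel₀ hf]

theorem span_pair_ne_top {n : ℕ} (hn : 3 ≤ n) (a b : Fin n → ℂ) : Submodule.span ℂ {a, b} ≠ ⊤ := by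
  intro h
  have h1 := finrank_span_finset_le_card (R := ℂ) ({a, b} : Finset (Fin n → ℂ))
  rw [Set.finrank, Finset.coe_pair, h, finrank_top, Module.finrank_fin_fun] at h1
  have := Finset.card_le_two (a := a) (b := b)
  omega

variable {n : ℕ} {τ : Type} [LieRing τ] [LieAlgebra ℂ τ] {A : GAlg n n τ} {B : Type}
    [CommRing B] [Algebra ℂ B] {V : Type} [AddCommGroup V] [Module ℂ V]

/-- Vector fields `W m u` acting through `R`. -/
structure GRep.WAct (R : GRep A B V) (W : (Fin n → ℤ) → (Fin n → ℂ) → τ) : Prop where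
  mem : ∀ m u, W m u ∈ A.g m
  zero : ∀ u l, ∀ v ∈ R.wsp l, R.ρ 1 (W 0 u) v = (u ⬝ᵥ l) • v
  lie : ∀ m k u y, y ⬝ᵥ A.ic m = 0 → y ⬝ᵥ A.ic k = 0 → ⁅W m u, W k y⁆ = (u ⬝ᵥ A.ic k) • W (m + k) y
  sl2 : ∀ k, ∃ z : ℂ, ∀ u, u ⬝ᵥ A.ic k = 1 → ∀ l, ∀ v ∈ R.wsp l,
    R.ρ 1 ⁅W k u, W (-k) u⁆ v = -(2 * (u ⬝ᵥ l) + z) • v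

theorem GRep.WAct.finrank_le {R : GRep A B V} {W} (w : R.WAct W) (hR : R.Good) {k : Fin n → ℤ} (hk : k ≠ 0)
    {μ : Fin n → ℂ} (hμ : μ ∉ Submodule.span ℂ {A.ic k}) {j : ℕ}
    (hj : R.wsp (μ + A.ic ((j : ℤ) • k)) = ⊥) :
    Module.finrank ℂ (R.wsp μ) ≤ Module.finrank ℂ (R.wsp (μ - A.ic k)) := by
  obtain ⟨z, hz⟩ := w.sl2 k
  obtain ⟨y, hy, hyμ⟩ := exists_dual_vec _ hμ
  have hyk : y ⬝ᵥ A.ic k = 0 := hy _ (Submodule.mem_span_singleton_self _)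
  have hk0 : A.ic k ∉ (⊥ : Submodule ℂ (Fin n → ℂ)) := by
    rw [Submodule.mem_bot]
    exact fun h => hk (A.ic_inj (h.trans (map_zero _).symm))
  obtain ⟨u0, -, hu0⟩ := exists_dual_vec _ hk0
  set a : ℂ := (1 - z) / 2 - u0 ⬝ᵥ μ with ha
  set u := u0 + a • y with hu
  have huk : u ⬝ᵥ A.ic k = 1 := by simp [hu, add_dotProduct, hyk, hu0]
  have huμ : 2 * (u ⬝ᵥ μ) + z = 1 := by
    simp [hu, add_dotProduct, hyμ, ha]; ring
  have step : ∀ p : ℤ, ∀ v ∈ R.wsp (μ + A.ic (p • k)),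
      R.ρ 1 (W (-k) u) (R.ρ 1 (W k u) v) = R.ρ 1 (W k u) (R.ρ 1 (W (-k) u) v) + (2 * (p : ℂ) + 1) • v := by
    intro p v hv
    have h1 := hz u huk _ v hv
    have h2 := R.lie_act (w.mem k u) (w.mem (-k) u) 1 1 v
    rw [one_mul, h1] at h2
    rw [dotProduct_add, map_zsmul, dotProduct_smul, huk] at h2
    rw [show 2 * (u ⬝ᵥ μ + p • (1 : ℂ)) + z = 2 * (p : ℂ) + 1 by
      rw [zsmul_eq_mul, mul_one]; linear_combination huμ] at h2
    rw [neg_smul] at h2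
    rw [eq_sub_iff_add_eq] at h2
    rw [← h2]; abel
  have inj : ∀ v ∈ R.wsp μ, R.ρ 1 (W (-k) u) v = 0 → v = 0 := by
    intro v hv h0
    set e := R.ρ 1 (W k u) with he
    have hsh : ∀ p : ℕ, (e ^ p) v ∈ R.wsp (μ + A.ic ((p : ℤ) • k)) := R.pow_shift hv (w.mem k u) 1
    have hf : ∀ p : ℕ, R.ρ 1 (W (-k) u) ((e ^ (p + 1)) v) = ((p : ℂ) + 1) ^ 2 • (e ^ p) v := by
      intro p
      induction p with
      | zero =>
        have := step 0 v (by simpa using hv)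
        rw [h0] at this
        simpa using this
      | succ p ih =>
        have := step (p + 1 : ℕ) _ (hsh (p + 1))
        rw [pow_succ' e (p + 1), Module.End.mul_apply, this, ih, map_smul, ← Module.End.mul_apply, ← pow_succ',
          ← add_smul]
        congr 1
        push_cast; ring
    have hz : ∀ p : ℕ, (e ^ p) v = 0 → v = 0 := by
      intro p
      induction p with
      | zero => intro h; simpa using h
      | succ p ih =>
        intro h
        apply ih
        have := hf p
        rw [h, map_zero] at this
        have h3 : ((p : ℂ) + 1) ^ 2 ≠ 0 := pow_ne_zero _ (Nat.cast_add_one_ne_zero p)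
        exact (smul_eq_zero.1 this.symm).resolve_left h3
    refine hz j ?_
    have := hsh j
    rwa [hj, Submodule.mem_bot] at this
  have := hR.fin (μ - A.ic k)
  refine LinearMap.finrank_le_finrank_of_injective
    (f := (R.ρ 1 (W (-k) u)).restrict (p := R.wsp μ) (q := R.wsp (μ - A.ic k))
      (fun v hv => R.shift' hv (w.mem (-k) u) 1 (by rw [map_neg, sub_eq_add_neg]))) ?_
  rw [← LinearMap.ker_eq_bot, LinearMap.ker_eq_bot']
  intro v hv
  exact Subtype.ext (inj v v.2 (congrArg Subtype.val hv))

theorem GRep.WAct.eq_bot {R : GRep A B V} {W} (w : R.WAct W) (hR : R.Good) {k : Fin n → ℤ} (hk : k ≠ 0)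
    {μ : Fin n → ℂ} (hμ : μ ∉ Submodule.span ℂ {A.ic k}) {j : ℕ}
    (hj : R.wsp (μ + A.ic ((j : ℤ) • k)) = ⊥) (h : R.wsp (μ - A.ic k) = ⊥) : R.wsp μ = ⊥ := by
  have h1 := w.finrank_le hR hk hμ hj
  rw [h, finrank_bot] at h1
  have := hR.fin μ
  exact Submodule.finrank_eq_zero.1 (Nat.le_zero.1 h1)

theorem GRep.exists_bot {R : GRep A B V} {k : Fin n → ℤ} (hk : k ∈ R.Bd) (μ : Fin n → ℂ) :
    ∃ j : ℕ, R.wsp (μ + A.ic ((j : ℤ) • k)) = ⊥ := by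
  obtain ⟨x, hx⟩ := hk μ
  exact ⟨x.toNat, hx _ (Int.self_le_toNat x)⟩

end Tor

namespace Tor

section
variable {r n : ℕ} {τ : Type} [LieRing τ] [LieAlgebra ℂ τ] {A : GAlg r n τ} {B : Type}
    [CommRing B] [Algebra ℂ B] {V : Type} [AddCommGroup V] [Module ℂ V]

theorem GRep.exists_weight_ne_zero {R : GRep A B V} (hR : R.Good) (hr : 1 ≤ r) :
    ∃ l, l ≠ 0 ∧ R.wsp l ≠ ⊥ := by
  by_contra! hcon
  have htop : R.wsp 0 = ⊤ := R.sup_induct hR _ (fun l v hv => by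
    by_cases hl : l = 0
    · rwa [← hl]
    · rw [hcon l hl, Submodule.mem_bot] at hv
      rw [hv]; exact zero_mem _)
  obtain ⟨b, m, X, hX, v, hv⟩ := hR.nt
  apply hv
  refine GRep.kills_one.1 (R.kills_all hr R.idem_one (Set.finite_singleton 0) (v := v) ?_ m) b X hX
  intro k hk
  rw [GRep.kills_one]
  intro b X hX
  have h1 := R.shift (l := 0) (v := v) (by rw [htop]; trivial) hX b
  rw [zero_add, hcon _ fun h => hk (A.ic_inj (h.trans (map_zero _).symm))] at h1
  exact (Submodule.mem_bot _).1 h1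

end

variable {n : ℕ} {τ : Type} [LieRing τ] [LieAlgebra ℂ τ] {A : GAlg n n τ} {B : Type}
    [CommRing B] [Algebra ℂ B] {V : Type} [AddCommGroup V] [Module ℂ V]

theorem cone_smul {m k : Fin n → ℤ} (hk : k ∈ cone m) {c : ℤ} (hc : 0 < c) : c • k ∈ cone m := by
  obtain ⟨x, s, rfl, hx, hs⟩ := hk
  refine ⟨c * x, c • s, by rw [smul_add, smul_smul], mul_pos hc hx, fun i => ?_⟩
  rw [Pi.smul_apply, smul_eq_mul, abs_mul, abs_of_pos hc]
  exact mul_lt_mul_of_pos_left (hs i) hc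

/-- A representation with vector fields, bounded along a cone of directions. -/
structure GRep.Cone (R : GRep A B V) (W : (Fin n → ℤ) → (Fin n → ℂ) → τ) (m₀ : Fin n → ℤ) : Prop where
  good : R.Good
  w : R.WAct W
  hn : 3 ≤ n
  ι_id : ∀ m, A.ι m = m
  ne : m₀ ≠ 0
  sub : cone m₀ ⊆ R.Bd

theorem GRep.WAct.finrank_le_iter {R : GRep A B V} {W} (w : R.WAct W) (hR : R.Good) {k : Fin n → ℤ} (hk : k ≠ 0)
    (hE : ∀ μ, ∃ j : ℕ, R.wsp (μ + A.ic ((j : ℤ) • k)) = ⊥)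
    {μ : Fin n → ℂ} (hμ : μ ∉ Submodule.span ℂ {A.ic k}) (x : ℕ) :
    Module.finrank ℂ (R.wsp (μ + A.ic ((x : ℤ) • k))) ≤ Module.finrank ℂ (R.wsp μ) := by
  induction x with
  | zero => rw [Nat.cast_zero, zero_smul, map_zero, add_zero]
  | succ x ih =>
    refine le_trans ?_ ih
    obtain ⟨j, hj⟩ := hE (μ + A.ic (((x + 1 : ℕ) : ℤ) • k))
    have h1 := w.finrank_le hR hk (fun h => hμ ?_) hj
    · rwa [add_sub_assoc, ← map_sub, show ((x + 1 : ℕ) : ℤ) • k - k = (x : ℤ) • k by push_cast; module] at h1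
    · refine ((Submodule.span ℂ {A.ic k}).add_mem_iff_left ?_).1 h
      rw [map_zsmul]
      exact zsmul_mem (Submodule.mem_span_singleton_self _) _

theorem GRep.WAct.up_bot {R : GRep A B V} {W} (w : R.WAct W) (hR : R.Good) {k : Fin n → ℤ} (hk : k ≠ 0)
    (hE : ∀ μ, ∃ j : ℕ, R.wsp (μ + A.ic ((j : ℤ) • k)) = ⊥)
    {μ : Fin n → ℂ} (hμ : μ ∉ Submodule.span ℂ {A.ic k}) (h : R.wsp μ = ⊥) (x : ℕ) :
    R.wsp (μ + A.ic ((x : ℤ) • k)) = ⊥ := by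
  have h1 := w.finrank_le_iter hR hk hE hμ x
  rw [h, finrank_bot] at h1
  have := hR.fin (μ + A.ic ((x : ℤ) • k))
  exact Submodule.finrank_eq_zero.1 (Nat.le_zero.1 h1)

theorem GAlg.ic_ne {k : Fin n → ℤ} (hk : k ≠ 0) : A.ic k ≠ 0 :=
  fun h => hk (A.ic_inj (h.trans (map_zero _).symm))

namespace GRep.Cone
variable {R : GRep A B V} {W : (Fin n → ℤ) → (Fin n → ℂ) → τ} {m₀ : Fin n → ℤ}

theorem exists_cone (H : R.Cone W m₀) {U : Submodule ℂ (Fin n → ℂ)} (hU : U ≠ ⊤) :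
    ∃ ε ∈ cone m₀, A.ic ε ∉ U := by
  by_contra! hcon
  apply hU
  have h2 : A.ic ((2 : ℤ) • m₀) ∈ U := hcon _ ⟨2, 0, by simp, by norm_num, by simp⟩
  have h1 : ∀ i, (Pi.single i (1 : ℂ) : Fin n → ℂ) ∈ U := by
    intro i
    have h3 := hcon ((2 : ℤ) • m₀ + Pi.single i 1) ⟨2, _, rfl, by norm_num, fun j => by
      by_cases h : j = i
      · subst h; simp
      · simp [h]⟩
    rw [map_add, U.add_mem_iff_right h2] at h3
    convert h3 using 1
    ext j
    rw [GAlg.ic_apply, H.ι_id]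
    by_cases h : j = i
    · subst h; simp
    · simp [h]
  rw [eq_top_iff]
  intro x _
  rw [show x = ∑ i, x i • (Pi.single i (1 : ℂ) : Fin n → ℂ) by
    ext j; simp [Finset.sum_apply, Pi.single_apply]]
  exact U.sum_mem fun i _ => U.smul_mem _ (h1 i)

theorem span_ne_top (H : R.Cone W m₀) (a : Fin n → ℂ) : Submodule.span ℂ {a} ≠ ⊤ := by
  have := span_pair_ne_top H.hn a a
  rwa [Set.pair_eq_singleton] at this

theorem cone_ne (H : R.Cone W m₀) {ε} (h : ε ∈ cone m₀) : ε ≠ 0 := cone_ne_zero H.ne h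

theorem up_bot (H : R.Cone W m₀) {k : Fin n → ℤ} (hk : k ≠ 0) (hE : k ∈ R.Bd)
    {μ : Fin n → ℂ} (hμ : μ ∉ Submodule.span ℂ {A.ic k}) (h : R.wsp μ = ⊥) (x : ℕ) :
    R.wsp (μ + A.ic ((x : ℤ) • k)) = ⊥ := H.w.up_bot H.good hk (R.exists_bot hE) hμ h x

theorem bot_of_sub (H : R.Cone W m₀) {k : Fin n → ℤ} (hk : k ≠ 0) (hE : k ∈ R.Bd)
    {μ : Fin n → ℂ} (hμ : μ ∉ Submodule.span ℂ {A.ic k}) (h : R.wsp (μ - A.ic k) = ⊥) : R.wsp μ = ⊥ := by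
  obtain ⟨j, hj⟩ := R.exists_bot hE μ
  exact H.w.eq_bot H.good hk hμ hj h

theorem not_mem_span_of {U : Submodule ℂ (Fin n → ℂ)} {ε} (hε : A.ic ε ∉ U) {ν : Fin n → ℂ}
    (hν : ν ∈ U) (h0 : ν ≠ 0) : ν ∉ Submodule.span ℂ {A.ic ε} := by
  intro h
  obtain ⟨c, rfl⟩ := Submodule.mem_span_singleton.1 h
  have hc : c ≠ 0 := fun h => h0 (by rw [h, zero_smul])
  exact hε ((U.smul_mem_iff hc).1 hν)

theorem exists_weight (H : R.Cone W m₀) {U : Submodule ℂ (Fin n → ℂ)} (hU : U ≠ ⊤) :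
    ∃ μ, μ ∉ U ∧ R.wsp μ ≠ ⊥ := by
  obtain ⟨ν, h0, hν⟩ := R.exists_weight_ne_zero H.good (by have := H.hn; omega)
  by_cases hU' : ν ∈ U
  · obtain ⟨ε, hε, hεU⟩ := H.exists_cone hU
    refine ⟨ν - A.ic ε, fun h => hεU ((U.sub_mem_iff_right hU').1 h), fun h => hν ?_⟩
    exact H.bot_of_sub (H.cone_ne hε) (H.sub hε) (not_mem_span_of hεU hU' h0) h
  · exact ⟨ν, hU', hν⟩

theorem zero_not_mem (H : R.Cone W m₀) : (0 : Fin n → ℤ) ∉ R.Bd := by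
  intro h
  obtain ⟨l, hl⟩ := R.exists_weight H.good
  obtain ⟨x, hx⟩ := h l
  exact hl (by simpa using hx x le_rfl)

theorem ne_zero (H : R.Cone W m₀) {k} (hk : k ∈ R.Bd) : k ≠ 0 := fun h => H.zero_not_mem (h ▸ hk)

theorem neg_not_mem (H : R.Cone W m₀) {k} (hk : k ∈ R.Bd) : -k ∉ R.Bd := by
  intro h
  obtain ⟨μ, hμ, hw⟩ := H.exists_weight (H.span_ne_top (A.ic k))
  obtain ⟨x, hx⟩ := R.exists_bot h μ
  apply hw
  have := H.up_bot (H.ne_zero hk) hk (fun h => hμ ?_) hx x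
  · rw [add_assoc, ← map_add] at this
    simpa using this
  · refine ((Submodule.span ℂ {A.ic k}).add_mem_iff_left ?_).1 h
    rw [map_zsmul, map_neg]
    exact zsmul_mem (neg_mem (Submodule.mem_span_singleton_self _)) _

theorem mem_of_proper (H : R.Cone W m₀) {k} (hk : k ≠ 0) {U : Submodule ℂ (Fin n → ℂ)} (hU : U ≠ ⊤)
    (hkU : A.ic k ∈ U) (h : ∀ μ ∉ U, ∃ x0 : ℤ, ∀ x ≥ x0, R.wsp (μ + A.ic (x • k)) = ⊥) : k ∈ R.Bd := by
  intro μ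
  by_cases hμ : μ ∈ U
  · obtain ⟨ε, hε, hεU⟩ := H.exists_cone hU
    obtain ⟨x0, hx0⟩ := h (μ - A.ic ε) (fun h => hεU ((U.sub_mem_iff_right hμ).1 h))
    have h1 : ∃ x1 : ℤ, ∀ x ≥ x1, μ + A.ic (x • k) ≠ 0 := by
      by_cases h2 : ∃ x : ℤ, μ + A.ic (x • k) = 0
      · obtain ⟨x, hx⟩ := h2
        refine ⟨x + 1, fun y hy h3 => ?_⟩
        have h4 : (y - x) • A.ic k = 0 := by
          rw [map_zsmul] at hx h3
          rw [sub_smul, sub_eq_zero]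
          exact add_left_cancel (h3.trans hx.symm)
        rcases smul_eq_zero.1 h4 with h5 | h5
        · omega
        · exact GAlg.ic_ne hk h5
      · exact ⟨0, fun x _ h3 => h2 ⟨x, h3⟩⟩
    obtain ⟨x1, hx1⟩ := h1
    refine ⟨max x0 x1, fun x hx => ?_⟩
    refine H.bot_of_sub (H.cone_ne hε) (H.sub hε) (not_mem_span_of hεU (U.add_mem hμ ?_)
      (hx1 x (le_of_max_le_right hx))) ?_
    · rw [map_zsmul]; exact zsmul_mem hkU _
    · rw [add_sub_right_comm]; exact hx0 x (le_of_max_le_left hx)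
  · exact h μ hμ

theorem add_mem (H : R.Cone W m₀) {k l} (hk : k ∈ R.Bd) (hl : l ∈ R.Bd) : k + l ∈ R.Bd := by
  have hkU : A.ic k ∈ Submodule.span ℂ {A.ic k, A.ic l} := Submodule.subset_span (by simp)
  have hlU : A.ic l ∈ Submodule.span ℂ {A.ic k, A.ic l} := Submodule.subset_span (by simp)
  refine H.mem_of_proper (fun h => ?_) (span_pair_ne_top H.hn (A.ic k) (A.ic l))
    (by rw [map_add]; exact Submodule.add_mem _ hkU hlU) (fun μ hμ => ?_)
  · exact H.neg_not_mem hk (by rwa [neg_eq_of_add_eq_zero_right h])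
  · obtain ⟨x0, hx0⟩ := hk μ
    refine ⟨max x0 0, fun x hx => ?_⟩
    have h1 := H.up_bot (H.ne_zero hl) hl (μ := μ + A.ic (x • k)) (fun h => hμ ?_)
      (hx0 x (le_of_max_le_left hx)) x.toNat
    · rw [Int.toNat_of_nonneg (le_of_max_le_right hx), add_assoc, ← map_add, ← smul_add] at h1
      exact h1
    · rw [map_zsmul] at h
      exact ((Submodule.span ℂ {A.ic k, A.ic l}).add_mem_iff_left (zsmul_mem hkU _)).1
        (Submodule.span_mono (by simp) h)

theorem mem_of_smul (H : R.Cone W m₀) {k} {j : ℕ} (hk : (j : ℤ) • k ∈ R.Bd) : k ∈ R.Bd := by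
  have hk0 : k ≠ 0 := fun h => H.ne_zero hk (by rw [h, smul_zero])
  have hE : ∀ μ, ∃ j : ℕ, R.wsp (μ + A.ic ((j : ℤ) • k)) = ⊥ := fun μ => by
    obtain ⟨x, hx⟩ := R.exists_bot hk μ
    exact ⟨x * j, by rwa [smul_smul, ← Nat.cast_mul] at hx⟩
  refine H.mem_of_proper hk0 (H.span_ne_top (A.ic k)) (Submodule.mem_span_singleton_self _) (fun μ hμ => ?_)
  obtain ⟨x0, hx0⟩ := hE μ
  refine ⟨x0, fun x hx => ?_⟩
  have := H.w.up_bot H.good hk0 hE (fun h => hμ ?_) hx0 (x - x0).toNat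
  · rwa [Int.toNat_of_nonneg (by omega), add_assoc, ← map_add, ← add_smul, add_sub_cancel] at this
  · refine ((Submodule.span ℂ {A.ic k}).add_mem_iff_left ?_).1 h
    rw [map_zsmul]
    exact zsmul_mem (Submodule.mem_span_singleton_self _) _

theorem not_cone_sub (H : R.Cone W m₀) {m} (hm : m ∉ R.Bd) : ¬ cone ((2 : ℤ) • m) ⊆ R.Bd := by
  intro h
  exact hm (H.mem_of_smul (j := 2) (h ⟨1, 0, by simp, by norm_num, by simp⟩))

end GRep.Cone
end Tor

namespace Tor

theorem linearIndependent_of_triangular {V : Type} [AddCommGroup V] [Module ℂ V] {N : ℕ} (f : Fin N → V)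
    (Y : Fin N → V →ₗ[ℂ] V) (h0 : ∀ i j, j < i → Y j (f i) = 0) (h1 : ∀ j, Y j (f j) ≠ 0) :
    LinearIndependent ℂ f := by
  rw [Fintype.linearIndependent_iff]
  intro g hg i
  induction i using WellFoundedLT.induction with
  | ind i ih =>
    have h2 := congrArg (Y i) hg
    rw [map_sum, map_zero, Finset.sum_eq_single i] at h2
    · rw [map_smul] at h2
      exact (smul_eq_zero.1 h2).resolve_right (h1 i)
    · intro j _ hj
      rw [map_smul]
      rcases lt_or_gt_of_ne hj with h | h
      · rw [ih j h, zero_smul]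
      · rw [h0 _ _ h, smul_zero]
    · simp

theorem exists_box_bound {n : ℕ} (F : (Fin n → ℤ) → ℕ) (b : ℤ) : ∃ d, ∀ s : Fin n → ℤ, (∀ i, |s i| ≤ b) → F s ≤ d := by
  obtain ⟨d, hd⟩ := ((Set.finite_Icc (fun _ : Fin n => -b) (fun _ => b)).image F).bddAbove
  exact ⟨d, fun s hs => hd ⟨s, ⟨fun i => (abs_le.1 (hs i)).1, fun i => (abs_le.1 (hs i)).2⟩, rfl⟩⟩

variable {n : ℕ} {τ : Type} [LieRing τ] [LieAlgebra ℂ τ] {A : GAlg n n τ} {B : Type}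
    [CommRing B] [Algebra ℂ B] {V : Type} [AddCommGroup V] [Module ℂ V]

theorem GRep.WAct.le_finrank {R : GRep A B V} {W} (w : R.WAct W) (hR : R.Good) {q c : Fin n → ℤ} {μ : Fin n → ℂ}
    (hq : q ≠ 0) (hc : A.ic c ∉ Submodule.span ℂ {A.ic q}) (hμ : μ ∉ Submodule.span ℂ {A.ic q, A.ic c})
    (hS : R.wsp μ ≠ ⊥) {N : ℕ} (h1 : ∀ j : ℤ, 1 ≤ j → j ≤ N → R.wsp (μ + A.ic (j • q)) = ⊥)
    (h2 : ∀ i : ℤ, 2 ≤ i → i ≤ 2 * N → R.wsp (μ + A.ic (c - i • q)) = ⊥) :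
    N ≤ Module.finrank ℂ (R.wsp (μ - A.ic c)) := by
  obtain ⟨v, hv, hv0⟩ := Submodule.exists_mem_ne_zero_of_ne_bot hS
  obtain ⟨y, hy, hyμ⟩ := exists_dual_vec _ hμ
  have hyq : y ⬝ᵥ A.ic q = 0 := hy _ (Submodule.subset_span (by simp))
  have hyc : y ⬝ᵥ A.ic c = 0 := hy _ (Submodule.subset_span (by simp))
  obtain ⟨u, hu, huc⟩ := exists_dual_vec _ hc
  have huq : u ⬝ᵥ A.ic q = 0 := hu _ (Submodule.mem_span_singleton_self _)
  obtain ⟨w', -, hwq⟩ := exists_dual_vec (⊥ : Submodule ℂ (Fin n → ℂ)) (μ := A.ic q)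
    (by rw [Submodule.mem_bot]; exact GAlg.ic_ne hq)
  have hyz : ∀ a b : ℤ, y ⬝ᵥ A.ic (a • c + b • q) = 0 := by
    intro a b
    rw [map_add, map_zsmul, map_zsmul, dotProduct_add, dotProduct_smul, dotProduct_smul, hyq, hyc]
    simp
  have hyz1 : ∀ b : ℤ, y ⬝ᵥ A.ic (b • q) = 0 := fun b => by simpa using hyz 0 b
  set x : ℤ → V := fun i => R.ρ 1 (W (-(i • q)) y) v with hx
  set f : ℤ → V := fun i => R.ρ 1 (W (-c + i • q) u) (x i) with hf
  set Y : ℤ → V →ₗ[ℂ] V := fun j => R.ρ 1 (W (c - j • q) y) with hY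
  have hxw : ∀ i, x i ∈ R.wsp (μ - A.ic (i • q)) := fun i =>
    R.shift' hv (w.mem _ _) 1 (by rw [map_neg, sub_eq_add_neg])
  have hfw : ∀ i, f i ∈ R.wsp (μ - A.ic c) := fun i =>
    R.shift' (hxw i) (w.mem _ _) 1 (by simp only [map_add, map_neg]; abel)
  have hYf : ∀ i j : ℤ, 1 ≤ i → i ≤ N → 1 ≤ j → j ≤ N → Y j (f i) = - R.ρ 1 (W ((i - j) • q) y) (x i) := by
    intro i j hi hiN hj hjN
    have h3 := R.comm (w.mem (-c + i • q) u) (w.mem (c - j • q) y) 1 1 (x i)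
    have h4 : R.ρ 1 (W (c - j • q) y) (x i) = 0 := by
      have := R.shift' (hxw i) (w.mem (c - j • q) y) 1 (l' := μ + A.ic (c - (i + j) • q))
        (by simp only [map_sub, add_smul, map_add]; abel)
      rw [h2 (i + j) (by omega) (by omega)] at this
      exact (Submodule.mem_bot _).1 this
    rw [h4, map_zero, one_mul, w.lie _ _ _ _ (by simpa using hyz (-1) i)
      (by simpa [sub_eq_add_neg] using hyz 1 (-j))] at h3
    rw [map_sub, dotProduct_sub, huc, map_zsmul, dotProduct_smul, huq, smul_zero, sub_zero, one_smul,
      show -c + i • q + (c - j • q) = (i - j) • q by rw [sub_smul]; abel] at h3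
    rw [eq_neg_iff_add_eq_zero]
    exact h3.symm
  have hlin : LinearIndependent ℂ (fun i : Fin N => f ((i : ℤ) + 1)) := by
    refine linearIndependent_of_triangular _ (fun j => Y ((j : ℤ) + 1)) ?_ ?_
    · intro i j hij
      have hi := i.2
      have hj := j.2
      have hij' : (j : ℕ) < i := hij
      rw [hYf _ _ (by omega) (by omega) (by omega) (by omega)]
      have h3 := R.comm (w.mem ((((i : ℤ) + 1) - ((j : ℤ) + 1)) • q) y) (w.mem (-(((i : ℤ) + 1) • q)) y) 1 1 v
      rw [w.lie _ _ _ _ (hyz1 _) (by rw [← neg_smul]; exact hyz1 _), ← neg_smul, hyz1, zero_smul, map_zero,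
        LinearMap.zero_apply, add_zero] at h3
      have h4 : R.ρ 1 (W ((((i : ℤ) + 1) - ((j : ℤ) + 1)) • q) y) v = 0 := by
        have := R.shift hv (w.mem ((((i : ℤ) + 1) - ((j : ℤ) + 1)) • q) y) 1
        rw [h1 _ (by omega) (by omega)] at this
        exact (Submodule.mem_bot _).1 this
      rw [h4, map_zero] at h3
      simp only [hx, ← neg_smul]
      rw [h3, neg_zero]
    · intro j h
      have hj := j.2
      rw [hYf _ _ (by omega) (by omega) (by omega) (by omega), sub_self, zero_smul, w.zero _ _ _ (hxw _),
        dotProduct_sub, hyz1, hyμ, sub_zero, one_smul, neg_eq_zero] at h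
      have h3 := R.comm (w.mem (((j : ℤ) + 1) • q) w') (w.mem (-(((j : ℤ) + 1) • q)) y) 1 1 v
      have h4 : R.ρ 1 (W (((j : ℤ) + 1) • q) w') v = 0 := by
        have := R.shift hv (w.mem (((j : ℤ) + 1) • q) w') 1
        rw [h1 _ (by omega) (by omega)] at this
        exact (Submodule.mem_bot _).1 this
      rw [show R.ρ 1 (W (-(((j : ℤ) + 1) • q)) y) v = 0 from h, h4, map_zero, map_zero, zero_add,
        w.lie _ _ _ _ (hyz1 _) (by rw [← neg_smul]; exact hyz1 _), add_neg_cancel, one_mul, map_smul,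
        LinearMap.smul_apply, w.zero _ _ _ hv, hyμ, one_smul, map_neg, map_zsmul, dotProduct_neg,
        dotProduct_smul, hwq] at h3
      rcases smul_eq_zero.1 h3.symm with h5 | h5
      · rw [zsmul_eq_mul, mul_one, neg_eq_zero, Int.cast_eq_zero] at h5
        omega
      · exact hv0 h5
  have h5 := finrank_span_eq_card hlin
  rw [Fintype.card_fin] at h5
  have := hR.fin (μ - A.ic c)
  rw [← h5]
  refine Submodule.finrank_mono (Submodule.span_le.2 ?_)
  rintro _ ⟨i, rfl⟩
  exact hfw _

namespace GRep.Cone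
variable {R : GRep A B V} {W : (Fin n → ℤ) → (Fin n → ℂ) → τ} {m₀ : Fin n → ℤ}

theorem exists_uniform (H : R.Cone W m₀) (d : ℕ) : ∃ N : ℕ, ∀ q, q ∉ R.Bd → q ≠ 0 → ∀ μ, R.wsp μ ≠ ⊥ →
    μ ∉ Submodule.span ℂ {A.ic q} → ∀ ε ∈ cone m₀, A.ic ε ∉ Submodule.span ℂ {A.ic q, μ} →
    (∀ s : Fin n → ℤ, (∀ i, |s i| ≤ 40) → Module.finrank ℂ (R.wsp (μ - A.ic ε + A.ic s)) ≤ d) →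
    ∃ j : ℤ, 1 ≤ j ∧ j ≤ N ∧ R.wsp (μ + A.ic (j • q)) ≠ ⊥ := by
  obtain ⟨Q, hQ⟩ := R.mult_bound H.good (by have := H.hn; omega) d
  refine ⟨2 * (Q + 1), fun q hqK hq μ hμ hμq ε hε hεU hd => ?_⟩
  by_contra! hcon
  set N : ℤ := 2 * (Q + 1) with hN
  have hμ' : μ ∉ Submodule.span ℂ {A.ic q, A.ic ε} := by
    intro h
    obtain ⟨a, b, hab⟩ := Submodule.mem_span_pair.1 h
    by_cases hb : b = 0
    · rw [hb, zero_smul, add_zero] at hab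
      exact hμq (Submodule.mem_span_singleton.2 ⟨a, hab⟩)
    · refine hεU (Submodule.mem_span_pair.2 ⟨-(b⁻¹ * a), b⁻¹, ?_⟩)
      rw [← hab, smul_add, smul_smul, smul_smul, inv_mul_cancel₀ hb]
      module
  set c : Fin n → ℤ := (N + 1) • q + ε with hc
  have hq1 : A.ic q ∈ Submodule.span ℂ {A.ic q} := Submodule.mem_span_singleton_self _
  have hεq : A.ic ε ∉ Submodule.span ℂ {A.ic q} := fun h => hεU (Submodule.span_mono (by simp) h)
  have h1 := H.w.le_finrank H.good (q := q) (c := c) (μ := μ) (N := Q + 1) hq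
    (fun h => hεq (by
      rw [hc, map_add, map_zsmul] at h
      exact ((Submodule.span ℂ {A.ic q}).add_mem_iff_right (zsmul_mem hq1 (N + 1))).1 h))
    (fun h => hμ' ?_) hμ (fun j hj hjN => hcon j hj (by push_cast at hjN ⊢; omega)) ?_
  · have h2 := hQ (μ - A.ic ε) hd ((N + 1) • q) (H.not_cone_sub fun h => hqK
      (H.mem_of_smul (j := 2 * (Q + 1) + 1) (by push_cast; exact h)))
    rw [sub_sub, ← map_add, add_comm ε, ← hc] at h2
    omega
  · refine (Submodule.span_le.2 ?_) h
    rintro x (rfl | rfl)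
    · exact Submodule.subset_span (by simp)
    · rw [SetLike.mem_coe, hc, map_add, map_zsmul]
      exact Submodule.add_mem _ (zsmul_mem (Submodule.subset_span (by simp)) _)
        (Submodule.subset_span (by simp))
  · intro i hi hiN
    have h3 := hcon (N + 1 - i) (by push_cast at hiN; omega) (by push_cast at *; omega)
    have h4 := H.up_bot (H.cone_ne hε) (H.sub hε) (fun h => hμ' ?_) h3 1
    · rw [add_assoc, ← map_add] at h4
      convert h4 using 4
      rw [hc]
      push_cast
      module
    · have h5 := Submodule.span_mono (t := {A.ic q, A.ic ε}) (by simp) h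
      rw [map_zsmul] at h5
      exact (Submodule.add_mem_iff_left _ (zsmul_mem (Submodule.subset_span (by simp)) _)).1 h5

theorem exists_box (_ : R.Cone W m₀) (μ : Fin n → ℂ) : ∃ d, ∀ s : Fin n → ℤ, (∀ i, |s i| ≤ 40) →
    Module.finrank ℂ (R.wsp (μ + A.ic s)) ≤ d := exists_box_bound _ _

theorem exists_ge (H : R.Cone W m₀) {q} (hqK : q ∉ R.Bd) (hq : q ≠ 0) {μ : Fin n → ℂ} (hμ : R.wsp μ ≠ ⊥)
    (hμq : μ ∉ Submodule.span ℂ {A.ic q}) (x0 : ℤ) : ∃ x ≥ x0, R.wsp (μ + A.ic (x • q)) ≠ ⊥ := by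
  by_contra! hcon
  obtain ⟨x, hx, hmax⟩ := Int.exists_greatest_of_bdd (P := fun x => R.wsp (μ + A.ic (x • q)) ≠ ⊥)
    ⟨x0, fun z hz => not_lt.1 fun h => hz (hcon z h.le)⟩ ⟨0, by simpa using hμ⟩
  obtain ⟨ε, hε, hεU⟩ := H.exists_cone (span_pair_ne_top H.hn (A.ic q) (μ + A.ic (x • q)))
  obtain ⟨d, hd⟩ := H.exists_box (μ + A.ic (x • q) - A.ic ε)
  obtain ⟨N, hN⟩ := H.exists_uniform d
  obtain ⟨j, hj, -, h⟩ := hN q hqK hq _ hx (fun h => hμq (((Submodule.span ℂ {A.ic q}).add_mem_iff_left (by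
    rw [map_zsmul]; exact zsmul_mem (Submodule.mem_span_singleton_self _) _)).1 h)) ε hε hεU hd
  have := hmax (x + j) (by rw [add_smul, map_add, ← add_assoc]; exact h)
  omega

end GRep.Cone
end Tor

namespace Tor

variable {n : ℕ} {τ : Type} [LieRing τ] [LieAlgebra ℂ τ] {A : GAlg n n τ} {B : Type}
    [CommRing B] [Algebra ℂ B] {V : Type} [AddCommGroup V] [Module ℂ V]

namespace GRep.Cone
variable {R : GRep A B V} {W : (Fin n → ℤ) → (Fin n → ℂ) → τ} {m₀ : Fin n → ℤ}

theorem smul_mem (_ : R.Cone W m₀) {k} (hk : k ∈ R.Bd) {c : ℤ} (hc : 0 < c) : c • k ∈ R.Bd := by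
  intro μ
  obtain ⟨x0, hx0⟩ := hk μ
  refine ⟨max x0 0, fun x hx => ?_⟩
  rw [smul_smul]
  exact hx0 _ (by nlinarith [le_of_max_le_left hx, le_of_max_le_right hx])

theorem smul_not_mem (H : R.Cone W m₀) {q} (hq : q ∉ R.Bd) (hq' : -q ∉ R.Bd) (a : ℤ) : a • q ∉ R.Bd := by
  intro h
  rcases le_total 0 a with ha | ha
  · lift a to ℕ using ha
    exact hq (H.mem_of_smul h)
  · obtain ⟨b, hb⟩ := Int.eq_ofNat_of_zero_le (neg_nonneg.2 ha)
    refine hq' (H.mem_of_smul (j := b) ?_)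
    rwa [← hb, neg_smul_neg]

theorem exists_smul_eq (H : R.Cone W m₀) {k q : Fin n → ℤ} (hq : q ≠ 0) (h : A.ic k ∈ Submodule.span ℂ {A.ic q}) :
    ∃ i, q i ≠ 0 ∧ q i • k = k i • q := by
  obtain ⟨i, hi⟩ := Function.ne_iff.1 hq
  refine ⟨i, hi, ?_⟩
  obtain ⟨c, hc⟩ := Submodule.mem_span_singleton.1 h
  have h1 : ∀ j, c * (q j : ℂ) = k j := fun j => by
    have := congrFun hc j
    simpa [GAlg.ic_apply, H.ι_id] using this
  ext j
  have : ((q i * k j : ℤ) : ℂ) = ((k i * q j : ℤ) : ℂ) := by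
    push_cast
    rw [← h1, ← h1]; ring
  simpa using Int.cast_injective this

theorem not_mem_span (H : R.Cone W m₀) {k q : Fin n → ℤ} (hk : k ∈ R.Bd) (hq0 : q ≠ 0) (hq : q ∉ R.Bd)
    (hq' : -q ∉ R.Bd) : A.ic k ∉ Submodule.span ℂ {A.ic q} := by
  intro h
  obtain ⟨i, hi, h⟩ := H.exists_smul_eq hq0 h
  refine H.smul_not_mem hq hq' (q i * k i) ?_
  rw [mul_smul, ← h, smul_smul]
  exact H.smul_mem hk (mul_self_pos.2 hi)

theorem exists_cone_box (H : R.Cone W m₀) {U : Submodule ℂ (Fin n → ℂ)} (hU : U ≠ ⊤) (μ : Fin n → ℂ) (b : ℤ) :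
    ∃ ε ∈ cone m₀, A.ic ε ∉ U ∧ ∀ s : Fin n → ℤ, (∀ i, |s i| ≤ b) → μ - A.ic ε + A.ic s ∉ U := by
  obtain ⟨ε, hε, hεU⟩ := H.exists_cone hU
  by_contra! hcon
  have h1 : ∀ c : ℕ, ∃ s ∈ Set.Icc (fun _ : Fin n => -b) (fun _ => b),
      μ - A.ic (((c : ℤ) + 1) • ε) + A.ic s ∈ U := by
    intro c
    obtain ⟨s, hs, h⟩ := hcon (((c : ℤ) + 1) • ε) (cone_smul hε (by positivity)) (fun h => hεU (by
      rw [map_zsmul, ← Int.cast_smul_eq_zsmul ℂ] at h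
      refine (U.smul_mem_iff ?_).1 h
      exact_mod_cast (by positivity : ((c : ℤ) + 1) ≠ 0)))
    exact ⟨s, ⟨fun i => (abs_le.1 (hs i)).1, fun i => (abs_le.1 (hs i)).2⟩, h⟩
  choose s hs hsU using h1
  have hinj : Function.Injective s := by
    intro c c' hcc
    by_contra hne
    have h2 := U.sub_mem (hsU c) (hsU c')
    rw [hcc, show μ - A.ic (((c : ℤ) + 1) • ε) + A.ic (s c') - (μ - A.ic (((c' : ℤ) + 1) • ε) + A.ic (s c')) =
      ((c' : ℂ) - c) • A.ic ε by
        rw [map_zsmul, map_zsmul, ← Int.cast_smul_eq_zsmul ℂ, ← Int.cast_smul_eq_zsmul ℂ]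
        push_cast; module] at h2
    exact hεU ((U.smul_mem_iff (sub_ne_zero.2 (fun h => hne (Nat.cast_injective h).symm))).1 h2)
  exact Set.infinite_univ ((Set.finite_Icc (fun _ : Fin n => -b) (fun _ => b)).preimage hinj.injOn |>.subset
    (fun c _ => hs c))

theorem window {Y : Set ℤ} {N : ℤ} (hu : ∀ y ∈ Y, ∃ j, 1 ≤ j ∧ j ≤ N ∧ y + j ∈ Y)
    (hd : ∀ y ∈ Y, ∃ j, 1 ≤ j ∧ j ≤ N ∧ y - j ∈ Y) (hY : Y.Nonempty) : ∃ y ∈ Y, 0 ≤ y ∧ y ≤ N := by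
  by_contra! hcon
  obtain ⟨y, hy⟩ := hY
  rcases lt_or_ge y 0 with h | h
  · obtain ⟨z, ⟨hz, hz0⟩, hmax⟩ := Int.exists_greatest_of_bdd (P := fun z => z ∈ Y ∧ z < 0)
      ⟨0, fun z hz => hz.2.le⟩ ⟨y, hy, h⟩
    obtain ⟨j, hj, hjN, hjY⟩ := hu z hz
    rcases lt_or_ge (z + j) 0 with h1 | h1
    · have := hmax _ ⟨hjY, h1⟩
      omega
    · have := hcon _ hjY h1
      omega
  · obtain ⟨z, ⟨hz, hz0⟩, hmin⟩ := Int.exists_least_of_bdd (P := fun z => z ∈ Y ∧ N < z)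
      ⟨N, fun z hz => hz.2.le⟩ ⟨y, hy, hcon y hy h⟩
    obtain ⟨j, hj, hjN, hjY⟩ := hd z hz
    have h2 := hcon _ hjY (by omega)
    have := hmin _ ⟨hjY, h2⟩
    omega

theorem exists_uniform_bot (H : R.Cone W m₀) {k q : Fin n → ℤ} (hk : k ∈ R.Bd) (hq0 : q ≠ 0) (hq : q ∉ R.Bd)
    (hq' : -q ∉ R.Bd) {μ : Fin n → ℂ} (hμ : μ ∉ Submodule.span ℂ {A.ic k, A.ic q}) :
    ∃ X1 : ℤ, ∀ X ≥ X1, ∀ y : ℤ, R.wsp (μ + A.ic (X • k) + A.ic (y • q)) = ⊥ := by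
  set U := Submodule.span ℂ {A.ic k, A.ic q} with hUdef
  have hkU : A.ic k ∈ U := Submodule.subset_span (by simp)
  have hqU : A.ic q ∈ U := Submodule.subset_span (by simp)
  have hzU : ∀ a b : ℤ, A.ic (a • k) + A.ic (b • q) ∈ U := fun a b => by
    rw [map_zsmul, map_zsmul]; exact U.add_mem (zsmul_mem hkU _) (zsmul_mem hqU _)
  obtain ⟨ε, hε, hεU, hbox⟩ := H.exists_cone_box (span_pair_ne_top H.hn (A.ic k) (A.ic q)) μ 40
  obtain ⟨d0, hd0⟩ := exists_box_bound (fun s => Module.finrank ℂ (R.wsp (μ - A.ic ε + A.ic s))) 80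
  obtain ⟨Q, hQ⟩ := R.mult_bound H.good (by have := H.hn; omega) d0
  obtain ⟨N, hN⟩ := H.exists_uniform Q
  have hdim : ∀ X : ℕ, ∀ a : ℤ, ∀ s : Fin n → ℤ, (∀ i, |s i| ≤ 40) →
      Module.finrank ℂ (R.wsp (μ + A.ic ((X : ℤ) • k) + A.ic (a • q) - A.ic ε + A.ic s)) ≤ Q := by
    intro X a s hs
    have h1 := H.w.finrank_le_iter H.good (H.ne_zero hk) (R.exists_bot hk)
      (μ := μ - A.ic ε + A.ic s + A.ic (a • q)) (fun h => hbox s hs ?_) X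
    · have h2 := hQ (μ - A.ic ε + A.ic s) (fun s' hs' => ?_) ((-a) • q)
        (H.not_cone_sub (H.smul_not_mem hq hq' _))
      · rw [neg_smul, map_neg, sub_neg_eq_add] at h2
        refine le_trans (le_of_eq ?_) (h1.trans h2)
        rw [show μ + A.ic ((X : ℤ) • k) + A.ic (a • q) - A.ic ε + A.ic s =
          μ - A.ic ε + A.ic s + A.ic (a • q) + A.ic ((X : ℤ) • k) by abel]
      · rw [add_assoc, ← map_add]
        refine hd0 _ fun i => (abs_add_le _ _).trans ?_
        have := hs i
        have := hs' i
        omega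
    · refine (U.add_mem_iff_left (y := A.ic (a • q)) ?_).1 (Submodule.span_mono (by simp) h)
      rw [map_zsmul]; exact zsmul_mem hqU _
  have hbad : ∃ Xb : ℤ, ∀ X ≥ Xb, A.ic ε ∉ Submodule.span ℂ {A.ic q, μ + A.ic (X • k)} := by
    by_cases h : ∃ X : ℤ, A.ic ε ∈ Submodule.span ℂ {A.ic q, μ + A.ic (X • k)}
    · obtain ⟨X, hX⟩ := h
      refine ⟨X + 1, fun Y hY h => ?_⟩
      obtain ⟨a, b, h1⟩ := Submodule.mem_span_pair.1 hX
      obtain ⟨a', b', h2⟩ := Submodule.mem_span_pair.1 h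
      have hb : b ≠ 0 := by
        rintro rfl
        rw [zero_smul, add_zero] at h1
        exact hεU (h1 ▸ U.smul_mem _ hqU)
      have hbb : b = b' := by
        by_contra hne
        have h3 : (b - b') • μ ∈ U := by
          have : (b - b') • μ = a' • A.ic q - a • A.ic q + b' • A.ic (Y • k) - b • A.ic (X • k) := by
            linear_combination (norm := module) h1 - h2
          rw [this]
          refine U.sub_mem (U.add_mem (U.sub_mem (U.smul_mem _ hqU) (U.smul_mem _ hqU)) (U.smul_mem _ ?_))
            (U.smul_mem _ ?_)
          · simpa using hzU Y 0
          · simpa using hzU X 0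
        exact hμ ((U.smul_mem_iff (sub_ne_zero.2 hne)).1 h3)
      subst hbb
      refine H.not_mem_span hk hq0 hq hq' (Submodule.mem_span_singleton.2 ⟨(b * (Y - X))⁻¹ * (a - a'), ?_⟩)
      have h4 : (Y : ℂ) - X ≠ 0 := sub_ne_zero.2 (fun h => by have := Int.cast_injective h; omega)
      rw [map_zsmul, ← Int.cast_smul_eq_zsmul ℂ] at h1 h2
      have h5 : (a - a') • A.ic q = (b * (Y - X)) • A.ic k := by
        linear_combination (norm := module) h1 - h2
      rw [mul_smul, h5, inv_smul_smul₀ (mul_ne_zero hb h4)]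
    · exact ⟨0, fun X _ hX => h ⟨X, hX⟩⟩
  obtain ⟨Xb, hXb⟩ := hbad
  have hev : ∀ᶠ X : ℤ in Filter.atTop, ∀ y ∈ Set.Icc (0 : ℤ) N, R.wsp (μ + A.ic (y • q) + A.ic (X • k)) = ⊥ := by
    rw [Filter.eventually_all_finite (Set.finite_Icc _ _)]
    intro y _
    exact Filter.eventually_atTop.2 (hk _)
  obtain ⟨Xc, hXc⟩ := Filter.eventually_atTop.1 hev
  refine ⟨max (max Xb Xc) 0, fun X hX => ?_⟩
  have hX1 : Xb ≤ X := (le_max_left _ _).trans ((le_max_left _ _).trans hX)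
  have hX2 : Xc ≤ X := (le_max_right _ _).trans ((le_max_left _ _).trans hX)
  lift X to ℕ using (le_max_right _ _).trans hX
  by_contra! hcon
  have hμX : ∀ y : ℤ, μ + A.ic ((X : ℤ) • k) + A.ic (y • q) ∉ U := fun y h => hμ (by
    rw [add_assoc] at h
    exact (U.add_mem_iff_left (hzU _ _)).1 h)
  have hεX : ∀ y : ℤ, A.ic ε ∉ Submodule.span ℂ {A.ic q, μ + A.ic ((X : ℤ) • k) + A.ic (y • q)} := by
    intro y h
    refine hXb X hX1 (Submodule.span_le.2 ?_ h)
    rintro x (rfl | rfl)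
    · exact Submodule.subset_span (by simp)
    · rw [SetLike.mem_coe, map_zsmul A.ic y q]
      have h1 : A.ic q ∈ Submodule.span ℂ {A.ic q, μ + A.ic ((X : ℤ) • k)} := Submodule.subset_span (by simp)
      exact Submodule.add_mem _ (Submodule.subset_span (by simp)) (zsmul_mem h1 _)
  have hqX : ∀ y : ℤ, μ + A.ic ((X : ℤ) • k) + A.ic (y • q) ∉ Submodule.span ℂ {A.ic q} := fun y h =>
    hμX y (Submodule.span_mono (by simp) h)
  have hsp : Submodule.span ℂ {A.ic (-q)} = Submodule.span ℂ {A.ic q} := by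
    rw [map_neg, ← Set.neg_singleton, Submodule.span_neg]
  obtain ⟨y, hy, hy0, hyN⟩ := window (Y := {y | R.wsp (μ + A.ic ((X : ℤ) • k) + A.ic (y • q)) ≠ ⊥}) (N := N)
    (by
      intro y hy
      obtain ⟨j, hj, hjN, h⟩ := hN q hq hq0 (μ + A.ic ((X : ℤ) • k) + A.ic (y • q)) hy (hqX y) ε hε
        (hεX y) (hdim X y)
      refine ⟨j, hj, hjN, ?_⟩
      rw [Set.mem_ofPred_eq, add_smul, map_add, ← add_assoc]
      exact h)
    (by
      intro y hy
      obtain ⟨j, hj, hjN, h⟩ := hN (-q) hq' (neg_ne_zero.2 hq0) (μ + A.ic ((X : ℤ) • k) + A.ic (y • q)) hy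
        (hsp ▸ hqX y) ε hε (fun h => hεX y (by
          rw [Submodule.span_insert] at h ⊢
          rwa [hsp] at h)) (hdim X y)
      refine ⟨j, hj, hjN, ?_⟩
      rw [Set.mem_ofPred_eq, sub_eq_add_neg, add_smul, map_add, ← add_assoc, neg_smul, ← smul_neg]
      exact h) hcon
  refine hy ?_
  rw [add_right_comm]
  exact hXc X hX2 y ⟨hy0, hyN⟩

theorem add_not_mem (H : R.Cone W m₀) {p q : Fin n → ℤ} (hp : p ∉ R.Bd) (hp' : -p ∉ R.Bd) (hq : q ∉ R.Bd) :
    p + q ∉ R.Bd := by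
  intro h
  by_cases hp0 : p = 0
  · exact hq (by rwa [hp0, zero_add] at h)
  apply hq
  have hU := span_pair_ne_top H.hn (A.ic (p + q)) (A.ic (-p))
  refine H.mem_of_proper (fun h0 => hp (by rwa [h0, add_zero] at h)) hU ?_ (fun μ hμ => ?_)
  · rw [show A.ic q = A.ic (p + q) + A.ic (-p) by rw [← map_add]; congr 1; abel]
    exact Submodule.add_mem _ (Submodule.subset_span (by simp)) (Submodule.subset_span (by simp))
  · obtain ⟨X1, hX1⟩ := H.exists_uniform_bot h (neg_ne_zero.2 hp0) hp' (by rwa [neg_neg]) hμ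
    refine ⟨X1, fun x hx => ?_⟩
    have := hX1 x hx x
    rwa [add_assoc, ← map_add, ← smul_add, add_neg_cancel_comm] at this

/-- The directions that are unbounded both ways. -/
def lin (H : R.Cone W m₀) : AddSubgroup (Fin n → ℤ) where
  carrier := {q | q ∉ R.Bd ∧ -q ∉ R.Bd}
  zero_mem' := ⟨H.zero_not_mem, by rw [neg_zero]; exact H.zero_not_mem⟩
  add_mem' := by
    rintro a b ⟨ha, ha'⟩ ⟨hb, hb'⟩
    refine ⟨H.add_not_mem ha ha' hb, ?_⟩
    rw [neg_add]
    exact H.add_not_mem ha' (by rwa [neg_neg]) hb'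
  neg_mem' := by
    rintro a ⟨ha, ha'⟩
    exact ⟨ha', by rwa [neg_neg]⟩

theorem mem_lin (H : R.Cone W m₀) {q} : q ∈ H.lin ↔ q ∉ R.Bd ∧ -q ∉ R.Bd := Iff.rfl

theorem add_lin (H : R.Cone W m₀) {k m} (hk : k ∈ R.Bd) (hm : m ∈ H.lin) : k + m ∈ R.Bd := by
  by_contra h
  have := H.add_not_mem (H.mem_lin.1 hm).2 (by rw [neg_neg]; exact (H.mem_lin.1 hm).1) h
  rw [add_comm k, neg_add_cancel_left] at this
  exact this hk

theorem add_neg_not_mem (H : R.Cone W m₀) {p q} (hp : -p ∉ R.Bd) (hq : q ∈ R.Bd) : p + q ∈ R.Bd := by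
  by_cases h : p ∈ R.Bd
  · exact H.add_mem h hq
  · rw [add_comm]; exact H.add_lin hq ⟨h, hp⟩

theorem neg_add_not_mem (H : R.Cone W m₀) {p q} (hp : -p ∉ R.Bd) (hq : -q ∉ R.Bd) : -(p + q) ∉ R.Bd := by
  by_cases h : q ∈ R.Bd
  · exact H.neg_not_mem (H.add_neg_not_mem hp h)
  · rw [neg_add, add_comm]
    exact H.add_not_mem hq (by rwa [neg_neg]) hp

end GRep.Cone
end Tor

namespace Tor

variable {n : ℕ} {τ : Type} [LieRing τ] [LieAlgebra ℂ τ] {A : GAlg n n τ} {B : Type}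
    [CommRing B] [Algebra ℂ B] {V : Type} [AddCommGroup V] [Module ℂ V]

namespace GRep.Cone
variable {R : GRep A B V} {W : (Fin n → ℤ) → (Fin n → ℂ) → τ} {m₀ : Fin n → ℤ}

theorem le_finrank_of_sub (H : R.Cone W m₀) {c q : Fin n → ℤ} (hq : q ∈ R.Bd)
    {N Q : ℕ} (hQ : 2 * N + 1 ≤ Q) (h : c - (Q : ℤ) • q ∈ R.Bd) (hcq : A.ic c ∉ Submodule.span ℂ {A.ic q})
    {μ : Fin n → ℂ} (hμ : R.wsp μ ≠ ⊥) (hμU : μ ∉ Submodule.span ℂ {A.ic c, A.ic q}) :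
    N ≤ Module.finrank ℂ (R.wsp (μ - A.ic c)) := by
  have hcU : A.ic c ∈ Submodule.span ℂ {A.ic c, A.ic q} := Submodule.subset_span (by simp)
  have hqU : A.ic q ∈ Submodule.span ℂ {A.ic c, A.ic q} := Submodule.subset_span (by simp)
  obtain ⟨x0, hx0⟩ := hq μ
  obtain ⟨j, ⟨hj, hj0⟩, hmax⟩ := Int.exists_greatest_of_bdd
    (P := fun x => R.wsp (μ + A.ic (x • q)) ≠ ⊥ ∧ 0 ≤ x)
    ⟨x0, fun z hz => not_lt.1 fun h => hz.1 (hx0 z h.le)⟩ ⟨0, by simpa using hμ, le_rfl⟩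
  have hbot : ∀ i : ℤ, j < i → R.wsp (μ + A.ic (i • q)) = ⊥ := fun i hi => by
    by_contra h
    have := hmax i ⟨h, by omega⟩
    omega
  have hshift : ∀ i : ℤ, μ + A.ic (i • q) ∉ Submodule.span ℂ {A.ic c, A.ic q} := fun i h => hμU (by
    rw [map_zsmul] at h
    exact ((Submodule.span ℂ {A.ic c, A.ic q}).add_mem_iff_left (zsmul_mem hqU _)).1 h)
  have hz : ∀ i : ℤ, i • A.ic q ∈ Submodule.span ℂ {A.ic q} := fun i =>
    zsmul_mem (Submodule.mem_span_singleton_self _) _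
  have h1 := H.w.le_finrank H.good (q := q) (c := c + j • q) (μ := μ + A.ic (j • q)) (N := N) (H.ne_zero hq)
    (fun h => hcq (by
      rw [map_add, map_zsmul] at h
      exact ((Submodule.span ℂ {A.ic q}).add_mem_iff_left (hz j)).1 h))
    (fun h => hshift j (by
      refine Submodule.span_le.2 ?_ h
      rintro x (rfl | rfl)
      · exact hqU
      · rw [SetLike.mem_coe, map_add, map_zsmul]
        exact Submodule.add_mem _ hcU (zsmul_mem hqU _))) hj
    (fun i hi _ => by rw [add_assoc, ← map_add, ← add_smul]; exact hbot _ (by omega))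
    (fun i hi hiN => by
      have h2 := H.up_bot (H.ne_zero h) h (fun h3 => hshift (2 * j + Q - i) (Submodule.span_le.2 ?_ h3))
        (hbot (2 * j + Q - i) (by omega)) 1
      · rw [add_assoc, ← map_add] at h2
        rw [add_assoc, ← map_add]
        convert h2 using 4
        push_cast
        module
      · rintro x rfl
        rw [SetLike.mem_coe, map_sub, map_zsmul]
        exact Submodule.sub_mem _ hcU (zsmul_mem hqU _))
  rwa [map_add, add_sub_add_right_eq_sub] at h1

theorem mul_pos_of_smul_eq (H : R.Cone W m₀) {x y : Fin n → ℤ} (hx : x ∈ R.Bd) (hy : y ∈ R.Bd) {a b : ℤ}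
    (ha : a ≠ 0) (h : a • x = b • y) : 0 < a * b := by
  have key : ∀ a b : ℤ, 0 < a → a • x = b • y → 0 < b := by
    intro a b ha h
    by_contra hb
    rcases (not_lt.1 hb).lt_or_eq with hb | hb
    · refine H.neg_not_mem (H.smul_mem hx ha) ?_
      rw [h, ← neg_smul]
      exact H.smul_mem hy (by omega)
    · rw [hb, zero_smul] at h
      exact H.zero_not_mem (h ▸ H.smul_mem hx ha)
  rcases lt_or_gt_of_ne ha with ha | ha
  · have := key (-a) (-b) (by omega) (by rw [neg_smul, neg_smul, h])
    nlinarith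
  · exact mul_pos ha (key a b ha h)

theorem exists_sub_not_mem (H : R.Cone W m₀) {c : Fin n → ℤ} (hc : c ∈ R.Bd) :
    ∃ Q : ℕ, 1 ≤ Q ∧ ∀ q ∈ R.Bd, c - (Q : ℤ) • q ∉ R.Bd := by
  obtain ⟨μ, hμU, hμ⟩ := H.exists_weight (H.span_ne_top (A.ic c))
  obtain ⟨ν, hνU, hν⟩ := H.exists_weight (span_pair_ne_top H.hn (A.ic c) μ)
  obtain ⟨i, hi⟩ := Function.ne_iff.1 (H.ne_zero hc)
  rw [Pi.zero_apply] at hi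
  set N := Module.finrank ℂ (R.wsp (μ - A.ic c)) + Module.finrank ℂ (R.wsp (ν - A.ic c)) + 1 with hN
  refine ⟨2 * N + 1 + (c i).natAbs, by omega, fun q hq h => ?_⟩
  set Q := 2 * N + 1 + (c i).natAbs with hQ
  have hcq : A.ic c ∉ Submodule.span ℂ {A.ic q} := by
    intro hcon
    have hqc : A.ic q ∈ Submodule.span ℂ {A.ic c} := by
      obtain ⟨a, ha⟩ := Submodule.mem_span_singleton.1 hcon
      have ha0 : a ≠ 0 := by
        rintro rfl
        exact GAlg.ic_ne (H.ne_zero hc) (by rw [← ha, zero_smul])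
      exact Submodule.mem_span_singleton.2 ⟨a⁻¹, by rw [← ha, inv_smul_smul₀ ha0]⟩
    obtain ⟨i', hi', h1⟩ := H.exists_smul_eq (H.ne_zero hc) hqc
    have h2 : c i • q = q i • c := by
      ext k
      have h3 : ∀ k, c i' * q k = q i' * c k := fun k => by simpa using congrFun h1 k
      have h4 : c i' * (c i * q k) = c i' * (q i * c k) := by
        linear_combination c i * h3 k - c k * h3 i
      simpa using mul_left_cancel₀ hi' h4
    have h3 := H.mul_pos_of_smul_eq hq hc hi h2
    have h4 := H.mul_pos_of_smul_eq h hc (a := c i) (b := c i - Q * q i) hi (by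
      rw [smul_sub, smul_comm, h2, sub_smul, mul_smul])
    have h5 : |c i| ≤ Q := by rw [hQ, Int.abs_eq_natAbs]; push_cast; omega
    have h6 : |c i| ≤ c i * q i := by
      have : q i ≠ 0 := fun h => by rw [h, mul_zero] at h3; exact lt_irrefl _ h3
      rw [← abs_of_pos h3, abs_mul]
      nlinarith [Int.one_le_abs this, abs_nonneg (c i)]
    have h7 : c i * c i = |c i| * |c i| := (abs_mul_abs_self _).symm
    nlinarith [abs_nonneg (c i)]
  have h2N : 2 * N + 1 ≤ Q := by omega
  by_cases hμ' : μ ∈ Submodule.span ℂ {A.ic c, A.ic q}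
  · have hν' : ν ∉ Submodule.span ℂ {A.ic c, A.ic q} := by
      intro h1
      obtain ⟨a, b, hab⟩ := Submodule.mem_span_pair.1 hμ'
      have hb : b ≠ 0 := by
        rintro rfl
        rw [zero_smul, add_zero] at hab
        exact hμU (Submodule.mem_span_singleton.2 ⟨a, hab⟩)
      refine hνU (Submodule.span_le.2 ?_ h1)
      rintro x (rfl | rfl)
      · exact Submodule.subset_span (by simp)
      · refine Submodule.mem_span_pair.2 ⟨-(b⁻¹ * a), b⁻¹, ?_⟩
        rw [← hab, smul_add, smul_smul, smul_smul, inv_mul_cancel₀ hb]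
        module
    have := H.le_finrank_of_sub hq h2N h hcq hν hν'
    omega
  · have := H.le_finrank_of_sub hq h2N h hcq hμ hμ'
    omega

theorem exists_minimal (H : R.Cone W m₀) : ∃ β ∈ R.Bd, ∀ q ∈ R.Bd, β - q ∉ R.Bd := by
  by_contra! hcon
  have hm : m₀ ∈ R.Bd := H.sub ⟨1, 0, by simp, by norm_num, by simp⟩
  obtain ⟨Q, hQ, hQ'⟩ := H.exists_sub_not_mem hm
  have hP : ∀ j : ℕ, ∀ p, -p ∉ R.Bd → -((j : ℤ) • p) ∉ R.Bd := by
    intro j p hp hcon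
    rw [← smul_neg] at hcon
    exact hp (H.mem_of_smul hcon)
  have key : ∀ j : ℕ, ∃ q ∈ R.Bd, -(m₀ - ((2 ^ j : ℕ) : ℤ) • q) ∉ R.Bd := by
    intro j
    induction j with
    | zero => exact ⟨m₀, hm, by simpa using H.zero_not_mem⟩
    | succ j ih =>
      obtain ⟨q, hq, hqP⟩ := ih
      obtain ⟨a, ha, hb⟩ := hcon q hq
      obtain ⟨x, hx, hxP⟩ : ∃ x ∈ R.Bd, -(q - (2 : ℤ) • x) ∉ R.Bd := by
        by_cases h : q - (2 : ℤ) • a ∈ R.Bd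
        · exact ⟨a, ha, H.neg_not_mem h⟩
        · refine ⟨q - a, hb, ?_⟩
          rwa [show -(q - (2 : ℤ) • (q - a)) = q - (2 : ℤ) • a by module]
      refine ⟨x, hx, ?_⟩
      have := H.neg_add_not_mem hqP (hP (2 ^ j) _ hxP)
      convert this using 2
      push_cast
      module
  obtain ⟨q, hq, hqP⟩ := key Q
  have hlt : Q < 2 ^ Q := Nat.lt_two_pow_self
  refine hQ' q hq ?_
  have := H.add_neg_not_mem hqP (H.smul_mem hq (c := ((2 ^ Q : ℕ) : ℤ) - Q) (by
    have : (Q : ℤ) < ((2 ^ Q : ℕ) : ℤ) := by exact_mod_cast hlt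
    omega))
  convert this using 1
  module

theorem exists_decomp (H : R.Cone W m₀) : ∃ β ∈ R.Bd, IsCompl H.lin (AddSubgroup.zmultiples β) ∧
    ∀ m ∈ H.lin, ∀ x : ℤ, 0 < x → m + x • β ∈ R.Bd := by
  obtain ⟨β, hβ, hmin⟩ := H.exists_minimal
  have hK : ∀ c ∈ R.Bd, c ∈ H.lin ⊔ AddSubgroup.zmultiples β := by
    intro c hc
    obtain ⟨Q, hQ, hQ'⟩ := H.exists_sub_not_mem hc
    have hex : ∃ j : ℕ, c - (j : ℤ) • β ∉ R.Bd := ⟨Q, hQ' β hβ⟩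
    classical
    have h1 := Nat.find_spec hex
    have h0 : Nat.find hex ≠ 0 := by
      intro h
      rw [h] at h1
      simp [hc] at h1
    obtain ⟨j, hj⟩ := Nat.exists_eq_succ_of_ne_zero h0
    have h2 : c - (j : ℤ) • β ∈ R.Bd := by
      by_contra h
      exact Nat.find_min hex (by omega) h
    rw [hj] at h1
    have h3 : c - ((j.succ : ℕ) : ℤ) • β ∈ H.lin := by
      refine ⟨h1, ?_⟩
      have := hmin _ h2
      rwa [show -(c - ((j.succ : ℕ) : ℤ) • β) = β - (c - (j : ℤ) • β) by push_cast; module]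
    rw [show c = (c - ((j.succ : ℕ) : ℤ) • β) + ((j.succ : ℕ) : ℤ) • β by abel]
    exact AddSubgroup.add_mem_sup h3 (AddSubgroup.mem_zmultiples_iff.2 ⟨_, rfl⟩)
  refine ⟨β, hβ, ⟨?_, ?_⟩, fun m hm x hx => ?_⟩
  · rw [AddSubgroup.disjoint_def]
    intro m hm hm'
    obtain ⟨x, rfl⟩ := AddSubgroup.mem_zmultiples_iff.1 hm'
    rcases lt_trichotomy x 0 with h | h | h
    · refine absurd (H.smul_mem hβ (c := -x) (by omega)) ?_
      rw [neg_smul]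
      exact (H.mem_lin.1 hm).2
    · rw [h, zero_smul]
    · exact absurd (H.smul_mem hβ h) (H.mem_lin.1 hm).1
  · rw [codisjoint_iff, eq_top_iff]
    intro m _
    by_cases h1 : m ∈ R.Bd
    · exact hK m h1
    · by_cases h2 : -m ∈ R.Bd
      · have := hK _ h2
        exact neg_mem_iff.1 this
      · exact AddSubgroup.mem_sup_left ⟨h1, h2⟩
  · rw [add_comm]
    exact H.add_lin (H.smul_mem hβ hx) hm

end GRep.Cone
end Tor

namespace Tor

theorem exists_embedding {n : ℕ} (hn : 3 ≤ n) {M : AddSubgroup (Fin n → ℤ)} {β : Fin n → ℤ}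
    (h : IsCompl M (AddSubgroup.zmultiples β)) :
    ∃ r, 2 ≤ r ∧ ∃ ι : (Fin r → ℤ) →+ (Fin n → ℤ), Function.Injective ι ∧ ∀ m, m ∈ M ↔ ∃ k, ι k = m := by
  set P : Submodule ℤ (Fin n → ℤ) := AddSubgroup.toIntSubmodule M
  have hc : IsCompl P (ℤ ∙ β) := by
    have := h.map AddSubgroup.toIntSubmodule
    rwa [show AddSubgroup.toIntSubmodule (AddSubgroup.zmultiples β) = ℤ ∙ β by
      ext x
      rw [Submodule.mem_span_singleton]
      exact AddSubgroup.mem_zmultiples_iff] at this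
  have h1 := (Submodule.prodEquivOfIsCompl P (ℤ ∙ β) hc).finrank_eq
  rw [Module.finrank_prod, Module.finrank_fin_fun] at h1
  have h2 : Module.finrank ℤ (ℤ ∙ β) ≤ 1 := by
    have := finrank_span_le_card (R := ℤ) ({β} : Set (Fin n → ℤ))
    simpa using this
  let e := Module.finBasis ℤ P
  refine ⟨Module.finrank ℤ P, by omega, (P.subtype ∘ₗ e.equivFun.symm.toLinearMap).toAddMonoidHom, ?_, ?_⟩
  · exact P.injective_subtype.comp e.equivFun.symm.injective
  · intro m
    constructor
    · intro hm
      exact ⟨e.equivFun ⟨m, hm⟩, by simp⟩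
    · rintro ⟨k, rfl⟩
      exact (e.equivFun.symm k).2

variable {n : ℕ} {τ : Type} [LieRing τ] [LieAlgebra ℂ τ] {A : GAlg n n τ} {B : Type}
    [CommRing B] [Algebra ℂ B] {V : Type} [AddCommGroup V] [Module ℂ V]

namespace GRep.Cone
variable {R : GRep A B V} {W : (Fin n → ℤ) → (Fin n → ℂ) → τ} {m₀ : Fin n → ℤ}

theorem exists_lin_ne (H : R.Cone W m₀) {β} (h : IsCompl H.lin (AddSubgroup.zmultiples β)) :
    ∃ q ∈ H.lin, q ≠ 0 := by
  obtain ⟨r, hr, ι, hι, hM⟩ := exists_embedding H.hn h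
  obtain ⟨k, hk⟩ := exists_single_ne (r := r) (by omega)
  exact ⟨ι k, (hM _).2 ⟨k, rfl⟩, fun h => hk (hι (h.trans (map_zero ι).symm))⟩

/-- Weight spaces vanish above a bounded level. -/
theorem exists_top_level (H : R.Cone W m₀) {β} (hβ : β ∈ R.Bd) (h : IsCompl H.lin (AddSubgroup.zmultiples β))
    (hK : ∀ m ∈ H.lin, ∀ x : ℤ, 0 < x → m + x • β ∈ R.Bd) :
    ∃ μ, R.wsp μ ≠ ⊥ ∧ ∀ m ∈ H.lin, ∀ x : ℤ, 0 < x → R.wsp (μ + A.ic (m + x • β)) = ⊥ := by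
  obtain ⟨q, hqM, hq⟩ := H.exists_lin_ne h
  obtain ⟨hqB, hqB'⟩ := H.mem_lin.1 hqM
  have hβ0 := H.ne_zero hβ
  have hiβ := GAlg.ic_ne (A := A) hβ0
  obtain ⟨ν, hν⟩ := R.exists_weight H.good
  obtain ⟨j0, hj0⟩ := hβ ν
  obtain ⟨j, hj, hνj⟩ : ∃ j : ℤ, j0 ≤ j ∧ ν + A.ic (j • β) ≠ 0 := by
    by_contra! hcon
    have h1 := hcon j0 le_rfl
    have h2 := hcon (j0 + 1) (by omega)
    apply hiβ
    rw [add_smul, one_smul, map_add] at h2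
    linear_combination (norm := module) h2 - h1
  set σ := ν + A.ic (j • β) with hσ
  have hσ0 : R.wsp σ = ⊥ := hj0 j hj
  have hdown : ∀ k ∈ R.Bd, R.wsp (σ + A.ic k) ≠ ⊥ → σ ∈ Submodule.span ℂ {A.ic k} := by
    intro k hk hne
    by_contra hcon
    refine hne (H.bot_of_sub (H.ne_zero hk) hk (fun h => hcon ?_) (by rwa [add_sub_cancel_right]))
    exact (Submodule.add_mem_iff_left _ (Submodule.mem_span_singleton_self _)).1 h
  have hvan : ∀ m ∈ H.lin, ∀ x : ℤ, 2 ≤ x → σ + A.ic (m + x • β) ≠ 0 → R.wsp (σ + A.ic (m + x • β)) = ⊥ := by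
    intro m hm x hx hp
    by_contra hne
    have hk := hK m hm x (by omega)
    set k := m + x • β with hk'
    obtain ⟨c, hc⟩ := Submodule.mem_span_singleton.1 (hdown k hk hne)
    obtain ⟨a, haM, ha⟩ : ∃ a ∈ H.lin, σ + A.ic k ∉ Submodule.span ℂ {A.ic (a + (1 : ℤ) • β)} := by
      by_contra! hcon
      obtain ⟨c1, h1⟩ := Submodule.mem_span_singleton.1 (hcon 0 (zero_mem _))
      obtain ⟨c2, h2⟩ := Submodule.mem_span_singleton.1 (hcon q hqM)
      rw [zero_add, one_smul] at h1
      rw [one_smul, map_add] at h2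
      refine H.not_mem_span hβ hq hqB hqB' (Submodule.mem_span_singleton.2 ?_)
      by_cases h12 : c1 = c2
      · subst h12
        have : c1 • A.ic q = 0 := by linear_combination (norm := module) h2 - h1
        rcases smul_eq_zero.1 this with h0 | h0
        · exact absurd (by rw [← h1, h0, zero_smul]) hp
        · exact absurd h0 (GAlg.ic_ne hq)
      · refine ⟨(c1 - c2)⁻¹ * c2, ?_⟩
        rw [mul_smul, inv_smul_eq_iff₀ (sub_ne_zero.2 h12)]
        linear_combination (norm := module) h2 - h1
    have haB := hK a haM 1 one_pos
    set g := a + (1 : ℤ) • β with hg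
    have hne2 : R.wsp (σ + A.ic (k - g)) ≠ ⊥ := by
      intro h0
      refine hne (H.bot_of_sub (H.ne_zero haB) haB ha ?_)
      rwa [map_sub, ← add_sub_assoc] at h0
    have hkg : k - g ∈ R.Bd := by
      rw [show k - g = (m - a) + (x - 1) • β by rw [hk', hg]; module]
      exact hK _ (sub_mem hm haM) _ (by omega)
    obtain ⟨c', hc'⟩ := Submodule.mem_span_singleton.1 (hdown _ hkg hne2)
    rw [map_sub] at hc'
    have hc0 : c' ≠ 0 := by
      rintro rfl
      rw [zero_smul] at hc'
      exact hνj hc'.symm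
    have hcc : c' - c ≠ 0 := by
      intro h0
      have : c' • A.ic g = 0 := by
        rw [sub_eq_zero.1 h0] at hc' ⊢
        linear_combination (norm := module) hc - hc'
      rcases smul_eq_zero.1 this with h1 | h1
      · exact hc0 h1
      · exact GAlg.ic_ne (H.ne_zero haB) h1
    apply ha
    refine Submodule.mem_span_singleton.2 ⟨(c + 1) * ((c' - c)⁻¹ * c'), ?_⟩
    have : A.ic k = ((c' - c)⁻¹ * c') • A.ic g := by
      rw [mul_smul, eq_inv_smul_iff₀ hcc]
      linear_combination (norm := module) hc' - hc
    rw [mul_smul, ← this, ← hc]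
    module
  have huniq : ∃ x1 : ℤ, ∀ m ∈ H.lin, ∀ x : ℤ, x1 < x → σ + A.ic (m + x • β) ≠ 0 := by
    by_cases h0 : ∃ m ∈ H.lin, ∃ x : ℤ, σ + A.ic (m + x • β) = 0
    · obtain ⟨m, hm, x, hx⟩ := h0
      refine ⟨x, fun m' hm' x' hlt h' => ?_⟩
      have h1 : m + x • β = m' + x' • β := A.ic_inj (add_left_cancel (hx.trans h'.symm))
      refine H.ne_zero (H.smul_mem hβ (c := x' - x) (by omega)) ?_
      refine AddSubgroup.disjoint_def.1 h.disjoint ?_ (AddSubgroup.mem_zmultiples_iff.2 ⟨_, rfl⟩)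
      rw [show (x' - x) • β = m - m' by linear_combination (norm := module) -h1]
      exact sub_mem hm hm'
    · push Not at h0
      exact ⟨0, fun m hm x _ => h0 m hm x⟩
  obtain ⟨x1, hx1⟩ := huniq
  obtain ⟨x, ⟨m, hm, hx⟩, hmax⟩ := Int.exists_greatest_of_bdd
    (P := fun x => ∃ m ∈ H.lin, R.wsp (σ + A.ic (m + x • β)) ≠ ⊥)
    ⟨max 2 x1, fun x ⟨m, hm, hx⟩ => by
      by_contra hlt
      exact hx (hvan m hm x (by omega) (hx1 m hm x (by omega)))⟩
    ⟨-j, 0, zero_mem _, by rwa [hσ, add_assoc, ← map_add, zero_add, neg_smul, add_neg_cancel, map_zero, add_zero]⟩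
  refine ⟨_, hx, fun m' hm' y hy => ?_⟩
  by_contra hne
  have := hmax (x + y) ⟨m + m', AddSubgroup.add_mem _ hm hm', by
    rwa [add_assoc, ← map_add, show m + x • β + (m' + y • β) = m + m' + (x + y) • β by module] at hne⟩
  omega

end GRep.Cone
end Tor

namespace Tor

variable {r n : ℕ} {τ : Type} [LieRing τ] [LieAlgebra ℂ τ] {A : GAlg r n τ} {B : Type}
    [CommRing B] [Algebra ℂ B] {V : Type} [AddCommGroup V] [Module ℂ V]

/-- The weights `μ + m + y β`, `m ∈ M`, vanish for `y > 0`. -/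
structure GRep.Top (R : GRep A B V) (M : AddSubgroup (Fin r → ℤ)) (β : Fin r → ℤ) (μ : Fin n → ℂ) : Prop where
  good : R.Good
  compl : IsCompl M (AddSubgroup.zmultiples β)
  ne : β ≠ 0
  wsp_ne : R.wsp μ ≠ ⊥
  bot : ∀ m ∈ M, ∀ x : ℤ, 0 < x → R.wsp (μ + A.ic (m + x • β)) = ⊥

/-- The sum of the weight spaces at level `y`. -/
def GRep.lev (R : GRep A B V) (M : AddSubgroup (Fin r → ℤ)) (β : Fin r → ℤ) (μ : Fin n → ℂ) (y : ℤ) :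
    Submodule ℂ V := ⨆ m : M, R.wsp (μ + A.ic (m + y • β))

variable {R : GRep A B V} {M : AddSubgroup (Fin r → ℤ)} {β : Fin r → ℤ} {μ : Fin n → ℂ}

theorem GRep.act_lev {m X} (hm : m ∈ M) {x y z : ℤ} (hX : X ∈ A.g (m + x • β)) {v : V} (hv : v ∈ R.lev M β μ y)
    (hz : z = y + x) (b : B) : R.ρ b X v ∈ R.lev M β μ z := by
  have : R.lev M β μ y ≤ (R.lev M β μ z).comap (R.ρ b X) := by
    refine iSup_le fun k v hv => ?_
    refine Submodule.mem_iSup_of_mem (⟨k + m, add_mem k.2 hm⟩ : M) (R.shift' hv hX b ?_)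
    rw [add_assoc μ, ← map_add, hz]
    congr 2
    dsimp only
    module
  exact this hv

namespace GRep.Top

theorem exists_eq (H : R.Top M β μ) (k : Fin r → ℤ) : ∃ m ∈ M, ∃ x : ℤ, k = m + x • β := by
  have : k ∈ M ⊔ AddSubgroup.zmultiples β := H.compl.sup_eq_top ▸ AddSubgroup.mem_top k
  obtain ⟨m, hm, b, hb, rfl⟩ := AddSubgroup.mem_sup.1 this
  obtain ⟨x, rfl⟩ := AddSubgroup.mem_zmultiples_iff.1 hb
  exact ⟨m, hm, x, rfl⟩

theorem eq_of (H : R.Top M β μ) {m k : Fin r → ℤ} (hm : m ∈ M) (hk : k ∈ M) {x y : ℤ}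
    (h : m + x • β = k + y • β) : x = y := by
  have : (x - y) • β = 0 := by
    refine AddSubgroup.disjoint_def.1 H.compl.disjoint ?_ (AddSubgroup.mem_zmultiples_iff.2 ⟨_, rfl⟩)
    rw [show (x - y) • β = k - m by linear_combination (norm := module) h]
    exact sub_mem hk hm
  have := (smul_eq_zero.1 this).resolve_right H.ne
  omega

theorem lev_eq_bot (H : R.Top M β μ) {y : ℤ} (hy : 0 < y) : R.lev M β μ y = ⊥ :=
  iSup_eq_bot.2 fun m => H.bot m m.2 y hy

theorem wsp_le_lev (m : M) (y : ℤ) : R.wsp (μ + A.ic (m + y • β)) ≤ R.lev M β μ y :=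
  le_iSup (fun m : M => R.wsp (μ + A.ic (m + y • β))) m

theorem wsp_le (m : M) : R.wsp (μ + A.ic m) ≤ R.lev M β μ 0 := by
  have := wsp_le_lev (R := R) (β := β) (μ := μ) m 0
  rwa [zero_smul, add_zero] at this

theorem wsp_le_self : R.wsp μ ≤ R.lev M β μ 0 := by
  have := wsp_le (R := R) (β := β) (μ := μ) (0 : M)
  rwa [ZeroMemClass.coe_zero, map_zero, add_zero] at this

theorem iSup_lev (H : R.Top M β μ) : ⨆ y, R.lev M β μ y = ⊤ := by
  refine sup_induct H.good _ fun l v hv => ?_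
  by_cases hl : R.wsp l = ⊥
  · rw [hl, Submodule.mem_bot] at hv
    rw [hv]
    exact zero_mem _
  obtain ⟨k, rfl⟩ := single_coset H.good H.wsp_ne hl
  obtain ⟨m, hm, x, rfl⟩ := H.exists_eq k
  exact Submodule.mem_iSup_of_mem x (wsp_le_lev ⟨m, hm⟩ x hv)

theorem disjoint (H : R.Top M β μ) (y : ℤ) : Disjoint (R.lev M β μ y) (⨆ x < y, R.lev M β μ x) := by
  have h := R.indep.disjoint_biSup_biSup (s := {l | ∃ m ∈ M, l = μ + A.ic (m + y • β)})
    (t := {l | ∃ m ∈ M, ∃ x < y, l = μ + A.ic (m + x • β)}) ?_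
  · refine h.mono ?_ ?_
    · exact iSup_le fun m => le_iSup₂_of_le (μ + A.ic (m + y • β)) ⟨m, m.2, rfl⟩ le_rfl
    · refine iSup₂_le fun x hx => iSup_le fun m => ?_
      exact le_iSup₂_of_le (μ + A.ic (m + x • β)) ⟨m, m.2, x, hx, rfl⟩ le_rfl
  · rw [Set.disjoint_left]
    rintro l ⟨m, hm, rfl⟩ ⟨k, hk, x, hx, h⟩
    have := H.eq_of hm hk (A.ic_inj (add_left_cancel h))
    omega

theorem isCompl (H : R.Top M β μ) : IsCompl (R.lev M β μ 0) (⨆ x < (0 : ℤ), R.lev M β μ x) := by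
  refine ⟨H.disjoint 0, codisjoint_iff.2 (eq_top_iff.2 ?_)⟩
  rw [← H.iSup_lev]
  refine iSup_le fun y => ?_
  rcases lt_trichotomy y 0 with h | rfl | h
  · exact le_sup_of_le_right (le_iSup₂_of_le y h le_rfl)
  · exact le_sup_left
  · rw [H.lev_eq_bot h]
    exact bot_le

theorem act_biSup {m X} (hm : m ∈ M) {x y : ℤ} (hx : x ≤ 0) (hX : X ∈ A.g (m + x • β)) {v : V}
    (hv : v ∈ ⨆ z < y, R.lev M β μ z) (b : B) : R.ρ b X v ∈ ⨆ z < y, R.lev M β μ z := by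
  have : (⨆ z < y, R.lev M β μ z) ≤ (⨆ z < y, R.lev M β μ z).comap (R.ρ b X) := by
    refine iSup₂_le fun z hz v hv => ?_
    exact Submodule.mem_iSup_of_mem (z + x) (Submodule.mem_iSup_of_mem (by omega) (R.act_lev hm hX hv rfl b))
  exact this hv

/-- A subspace of one level which is singular and stable under level zero generates at most itself and lower levels. -/
theorem eq_bot_or_sup_eq_top (H : R.Top M β μ) {y : ℤ} {N : Submodule ℂ V} (hN : N ≤ R.lev M β μ y)
    (h0 : ∀ m ∈ M, ∀ X ∈ A.g m, ∀ b, ∀ v ∈ N, R.ρ b X v ∈ N)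
    (hp : ∀ m ∈ M, ∀ x : ℤ, 0 < x → ∀ X ∈ A.g (m + x • β), ∀ b, ∀ v ∈ N, R.ρ b X v = 0) :
    N = ⊥ ∨ N ⊔ ⨆ x < y, R.lev M β μ x = ⊤ := by
  let S : Set (Submodule ℂ V) := {P | N ≤ P ∧ ∀ m ∈ M, ∀ x : ℤ, x ≤ 0 → ∀ X ∈ A.g (m + x • β), ∀ b, ∀ v ∈ P,
    R.ρ b X v ∈ P}
  have hNQ : N ≤ sInf S := le_sInf fun P hP => hP.1
  have hQ : ∀ m ∈ M, ∀ x : ℤ, x ≤ 0 → ∀ X ∈ A.g (m + x • β), ∀ b, ∀ v ∈ sInf S, R.ρ b X v ∈ sInf S := by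
    intro m hm x hx X hX b v hv
    refine (Submodule.mem_sInf).2 fun P hP => hP.2 m hm x hx X hX b v ((Submodule.mem_sInf).1 hv P hP)
  have hQS : sInf S ≤ N ⊔ ⨆ x < y, R.lev M β μ x := by
    refine sInf_le ⟨le_sup_left, fun m hm x hx X hX b v hv => ?_⟩
    obtain ⟨v1, h1, v2, h2, rfl⟩ := Submodule.mem_sup.1 hv
    rw [map_add]
    refine Submodule.add_mem _ ?_ (Submodule.mem_sup_right (act_biSup hm hx hX h2 b))
    rcases hx.lt_or_eq with h | rfl
    · exact Submodule.mem_sup_right (Submodule.mem_iSup_of_mem (y + x)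
        (Submodule.mem_iSup_of_mem (by omega) (R.act_lev hm hX (hN h1) rfl b)))
    · rw [zero_smul, add_zero] at hX
      exact Submodule.mem_sup_left (h0 m hm X hX b v1 h1)
  let Q' : Submodule ℂ V := sInf S ⊓ ⨅ b, ⨅ k, ⨅ Z ∈ A.g k, (sInf S).comap (R.ρ b Z)
  have hQ' : ∀ v, v ∈ Q' ↔ v ∈ sInf S ∧ ∀ b k, ∀ Z ∈ A.g k, R.ρ b Z v ∈ sInf S := by
    intro v
    simp [Q', Submodule.mem_iInf, -Submodule.mem_sInf]
  have hle : sInf S ≤ Q' := by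
    refine sInf_le ⟨fun v hv => (hQ' v).2 ⟨hNQ hv, fun b k Z hZ => ?_⟩, fun m hm x hx X hX b v hv => ?_⟩
    · obtain ⟨m, hm, x, rfl⟩ := H.exists_eq k
      rcases le_or_gt x 0 with h | h
      · exact hQ m hm x h Z hZ b v (hNQ hv)
      · rw [hp m hm x h Z hZ b v hv]
        exact zero_mem _
    · rw [hQ'] at hv ⊢
      refine ⟨hQ m hm x hx X hX b v hv.1, fun c k Z hZ => ?_⟩
      rw [R.comm hZ hX]
      exact Submodule.add_mem _ (hQ m hm x hx X hX b _ (hv.2 c k Z hZ)) (hv.2 _ _ _ (A.lie_mem hZ hX))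
  rcases H.good.irr (sInf S) (fun b m X hX v hv => ((hQ' v).1 (hle hv)).2 b m X hX) with h | h
  · exact Or.inl (eq_bot_iff.2 (h ▸ hNQ))
  · exact Or.inr (eq_top_iff.2 (h ▸ hQS))

theorem kills_of_pos (H : R.Top M β μ) {m X} (hm : m ∈ M) {x y : ℤ} (hxy : 0 < y + x) (hX : X ∈ A.g (m + x • β)) {v : V}
    (hv : v ∈ R.lev M β μ y) (b : B) : R.ρ b X v = 0 := by
  have := R.act_lev hm hX hv rfl b
  rwa [H.lev_eq_bot hxy, Submodule.mem_bot] at this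

theorem irr (H : R.Top M β μ) {N : Submodule ℂ V} (hN : N ≤ R.lev M β μ 0)
    (h0 : ∀ m ∈ M, ∀ X ∈ A.g m, ∀ b, ∀ v ∈ N, R.ρ b X v ∈ N) : N = ⊥ ∨ N = R.lev M β μ 0 := by
  refine (H.eq_bot_or_sup_eq_top hN h0 fun m hm x hx X hX b v hv =>
    H.kills_of_pos hm (by omega) hX (hN hv) b).imp_right fun h => ?_
  have h1 := sup_inf_assoc_of_le (⨆ x < (0 : ℤ), R.lev M β μ x) hN
  rwa [h, top_inf_eq, inf_comm, H.isCompl.inf_eq_bot, sup_bot_eq, eq_comm] at h1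

theorem kill_all (H : R.Top M β μ) (J : Ideal B)
    (hJ : ∀ b ∈ J, ∀ m ∈ M, ∀ X ∈ A.g m, ∀ v ∈ R.lev M β μ 0, R.ρ b X v = 0) {b : B} (hb : b ∈ J)
    {k X} (hX : X ∈ A.g k) {v : V} (hv : v ∈ R.lev M β μ 0) : R.ρ b X v = 0 := by
  have key : ∀ s : ℕ, ∀ b ∈ J, ∀ m ∈ M, ∀ X ∈ A.g (m + (-(s : ℤ)) • β), ∀ v ∈ R.lev M β μ 0, R.ρ b X v = 0 := by
    intro s
    induction s using Nat.strong_induction_on with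
    | _ s ih =>
    rcases Nat.eq_zero_or_pos s with rfl | hs
    · intro b hb m hm X hX
      rw [Nat.cast_zero, neg_zero, zero_smul, add_zero] at hX
      exact hJ b hb m hm X hX
    let G : Set V := {w | ∃ b ∈ J, ∃ m ∈ M, ∃ X ∈ A.g (m + (-(s : ℤ)) • β), ∃ v ∈ R.lev M β μ 0, w = R.ρ b X v}
    have hG : Submodule.span ℂ G ≤ R.lev M β μ (-s) := by
      refine Submodule.span_le.2 ?_
      rintro _ ⟨b, hb, m, hm, X, hX, v, hv, rfl⟩
      exact R.act_lev hm hX hv (by omega) b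
    have hbot : Submodule.span ℂ G = ⊥ := by
      refine (H.eq_bot_or_sup_eq_top hG ?_ ?_).resolve_right fun h => ?_
      · intro p hp Z hZ c w hw
        have : Submodule.span ℂ G ≤ (Submodule.span ℂ G).comap (R.ρ c Z) := by
          refine Submodule.span_le.2 ?_
          rintro _ ⟨b, hb, m, hm, X, hX, v, hv, rfl⟩
          rw [SetLike.mem_coe, Submodule.mem_comap, R.comm hZ hX]
          have hZ' : Z ∈ A.g (p + (0 : ℤ) • β) := by rwa [zero_smul, add_zero]
          refine Submodule.add_mem _ (Submodule.subset_span ⟨b, hb, m, hm, X, hX, _,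
            R.act_lev hp hZ' hv (by omega) c, rfl⟩)
            (Submodule.subset_span ⟨c * b, J.mul_mem_left c hb, p + m, add_mem hp hm, _, ?_, v, hv, rfl⟩)
          rw [add_assoc]
          exact A.lie_mem hZ hX
        exact this hw
      · intro p hp x hx Z hZ c w hw
        have : Submodule.span ℂ G ≤ LinearMap.ker (R.ρ c Z) := by
          refine Submodule.span_le.2 ?_
          rintro _ ⟨b, hb, m, hm, X, hX, v, hv, rfl⟩
          rw [SetLike.mem_coe, LinearMap.mem_ker, R.comm hZ hX, H.kills_of_pos hp (by omega) hZ hv, map_zero, zero_add]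
          have h1 := A.lie_mem hZ hX
          rcases le_or_gt x s with h | h
          · refine ih (s - x).toNat (by omega) _ (J.mul_mem_left c hb) (p + m) (add_mem hp hm) _ ?_ v hv
            rwa [show p + m + (-((s - x).toNat : ℤ)) • β = p + x • β + (m + (-(s : ℤ)) • β) by
              rw [Int.toNat_of_nonneg (by omega)]; module]
          · refine H.kills_of_pos (add_mem hp hm) (x := x - s) (y := 0) (by omega) ?_ hv _
            rwa [show p + m + (x - s) • β = p + x • β + (m + (-(s : ℤ)) • β) by module]
        exact this hw
      · have h2 : (⊤ : Submodule ℂ V) ≤ ⨆ x < (0 : ℤ), R.lev M β μ x := by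
          rw [← h]
          refine sup_le (hG.trans (le_iSup₂_of_le (-(s : ℤ)) (by omega) le_rfl)) (iSup₂_le fun x hx => ?_)
          exact le_iSup₂_of_le x (by omega) le_rfl
        refine H.wsp_ne (eq_bot_iff.2 ((wsp_le_self (M := M) (β := β)).trans ?_))
        have := H.isCompl.inf_eq_bot
        rw [top_le_iff.1 h2, inf_top_eq] at this
        exact this.le
    intro b hb m hm X hX v hv
    have : R.ρ b X v ∈ Submodule.span ℂ G := Submodule.subset_span ⟨b, hb, m, hm, X, hX, v, hv, rfl⟩
    rwa [hbot, Submodule.mem_bot] at this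
  obtain ⟨m, hm, x, rfl⟩ := H.exists_eq k
  rcases le_or_gt x 0 with h | h
  · refine key (-x).toNat b hb m hm X ?_ v hv
    rwa [Int.toNat_of_nonneg (by omega), neg_neg]
  · exact H.kills_of_pos hm (by omega) hX hv b

end GRep.Top
end Tor

namespace Tor

/-- Restriction of the grading to a sublattice. -/
def GAlg.sub {r s n : ℕ} {τ : Type} [LieRing τ] [LieAlgebra ℂ τ] (A : GAlg r n τ) (f : (Fin s → ℤ) →+ (Fin r → ℤ))
    (hf : Function.Injective f) : GAlg s n τ where
  g k := A.g (f k)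
  D := A.D
  ι := A.ι.comp f
  q := A.q
  inj := A.inj.comp hf
  fd m := A.fd (f m)
  lie_mem hX hY := by rw [map_add]; exact A.lie_mem hX hY
  gen N hmk h := by rw [map_add]; exact A.gen N (fun h' => hmk (hf h')) h
  D_mem i := by rw [map_zero]; exact A.D_mem i
  lie_D i hX := A.lie_D i hX

section
variable {r s n : ℕ} {τ : Type} [LieRing τ] [LieAlgebra ℂ τ] {A : GAlg r n τ} {B : Type}
    [CommRing B] [Algebra ℂ B] {V : Type} [AddCommGroup V] [Module ℂ V]
variable {R : GRep A B V} {M : AddSubgroup (Fin r → ℤ)} {β : Fin r → ℤ} {μ : Fin n → ℂ}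

theorem GAlg.ic_sub {f : (Fin s → ℤ) →+ (Fin r → ℤ)} {hf : Function.Injective f} (k) :
    (A.sub f hf).ic k = A.ic (f k) := rfl

theorem GRep.act_lev_zero {m X} (hm : m ∈ M) (hX : X ∈ A.g m) {v : V} (hv : v ∈ R.lev M β μ 0) (b : B) :
    R.ρ b X v ∈ R.lev M β μ 0 :=
  R.act_lev hm (x := 0) (by rwa [zero_smul, add_zero]) hv (by simp) b

namespace GRep.Top

/-- The operators on the top level. -/
noncomputable def rep (H : R.Top M β μ) (f : (Fin s → ℤ) →+ (Fin r → ℤ)) (hf : Function.Injective f)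
    (hM : ∀ m, m ∈ M ↔ ∃ k, f k = m) : GRep (A.sub f hf) B (R.lev M β μ 0) where
  ρ := LinearMap.mk₂ ℂ (fun b X => (R.lev M β μ 0).projectionOnto _ H.isCompl ∘ₗ R.ρ b X ∘ₗ (R.lev M β μ 0).subtype)
    (by intros; ext; simp) (by intros; ext; simp) (by intros; ext; simp) (by intros; ext; simp)
  comm {m k X Y} hX hY b c v := by
    have hm : f m ∈ M := (hM _).2 ⟨m, rfl⟩
    have hk : f k ∈ M := (hM _).2 ⟨k, rfl⟩
    apply Subtype.ext
    simp only [LinearMap.mk₂_apply, LinearMap.comp_apply, Submodule.subtype_apply, Submodule.coe_add]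
    rw [Submodule.projectionOnto_apply_of_mem_left _ (R.act_lev_zero hk hY v.2 c),
      Submodule.projectionOnto_apply_of_mem_left _ (R.act_lev_zero hm hX v.2 b),
      Submodule.projectionOnto_apply_of_mem_left _ (R.act_lev_zero (add_mem hm hk) (A.lie_mem hX hY) v.2 (b * c)),
      Submodule.projectionOnto_apply_of_mem_left _ (R.act_lev_zero hm hX (R.act_lev_zero hk hY v.2 c) b),
      Submodule.projectionOnto_apply_of_mem_left _ (R.act_lev_zero hk hY (R.act_lev_zero hm hX v.2 b) c)]
    exact R.comm hX hY b c v

variable {f : (Fin s → ℤ) →+ (Fin r → ℤ)} {hf : Function.Injective f}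

theorem coe_rep (H : R.Top M β μ) (hM : ∀ m, m ∈ M ↔ ∃ k, f k = m) {m X} (hX : X ∈ A.g (f m)) (b : B)
    (v : R.lev M β μ 0) : ((H.rep f hf hM).ρ b X v : V) = R.ρ b X v := by
  change (((R.lev M β μ 0).projectionOnto _ H.isCompl (R.ρ b X v) : R.lev M β μ 0) : V) = _
  rw [Submodule.projectionOnto_apply_of_mem_left _ (R.act_lev_zero ((hM _).2 ⟨m, rfl⟩) hX v.2 b)]

theorem wsp_rep (H : R.Top M β μ) (hM : ∀ m, m ∈ M ↔ ∃ k, f k = m) (l) :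
    (H.rep f hf hM).wsp l = (R.wsp l).comap (R.lev M β μ 0).subtype := by
  ext v
  rw [Submodule.mem_comap, mem_wsp, mem_wsp]
  refine forall_congr' fun i => ?_
  rw [← Subtype.coe_inj, coe_rep (m := 0) H hM (by rw [map_zero]; exact A.D_mem i)]
  rfl

theorem wsp_rep_eq_bot (H : R.Top M β μ) (hM : ∀ m, m ∈ M ↔ ∃ k, f k = m) {m} (hm : m ∈ M) :
    (H.rep f hf hM).wsp (μ + A.ic m) = ⊥ ↔ R.wsp (μ + A.ic m) = ⊥ := by
  rw [H.wsp_rep hM, ← (Submodule.map_injective_of_injective (R.lev M β μ 0).injective_subtype).eq_iff,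
    Submodule.map_comap_subtype, Submodule.map_bot, inf_eq_right.2 (wsp_le ⟨m, hm⟩)]

end GRep.Top
end

section
variable {s n : ℕ} {τ : Type} [LieRing τ] [LieAlgebra ℂ τ] {A : GAlg n n τ} {B : Type}
    [CommRing B] [Algebra ℂ B] {V : Type} [AddCommGroup V] [Module ℂ V]
variable {R : GRep A B V} {M : AddSubgroup (Fin n → ℤ)} {β : Fin n → ℤ} {μ : Fin n → ℂ}
  {f : (Fin s → ℤ) →+ (Fin n → ℤ)} {hf : Function.Injective f} {W : (Fin n → ℤ) → (Fin n → ℂ) → τ}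

namespace GRep.Top

theorem rep_good (H : R.Top M β μ) (w : R.WAct W) (hn : 1 ≤ n) (hM : ∀ m, m ∈ M ↔ ∃ k, f k = m) :
    (H.rep f hf hM).Good where
  irr N hN := by
    have h := H.irr (N := N.map (R.lev M β μ 0).subtype) (Submodule.map_subtype_le _ _) ?_
    · have hi := Submodule.map_injective_of_injective (R.lev M β μ 0).injective_subtype
      refine h.imp (fun h => hi ?_) (fun h => hi ?_)
      · rw [h, Submodule.map_bot]
      · rw [h, Submodule.map_subtype_top]
    · rintro m hm X hX b _ ⟨v, hv, rfl⟩
      obtain ⟨k, rfl⟩ := (hM m).1 hm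
      exact ⟨_, hN b k X hX v hv, H.coe_rep hM hX b v⟩
  top := by
    refine Submodule.map_injective_of_injective (R.lev M β μ 0).injective_subtype ?_
    rw [Submodule.map_subtype_top, Submodule.map_iSup]
    refine le_antisymm (iSup_le fun l => Submodule.map_subtype_le _ _) ?_
    conv_lhs => rw [GRep.lev]
    refine iSup_le fun m => ?_
    refine le_iSup_of_le (μ + A.ic m) ?_
    rw [zero_smul, add_zero, H.wsp_rep hM, Submodule.map_comap_subtype, inf_eq_right.2 (wsp_le m)]
  fin l := by
    have := H.good.fin l
    rw [H.wsp_rep hM]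
    exact Module.Finite.of_injective
      ((R.lev M β μ 0).subtype.restrict (p := (R.wsp l).comap (R.lev M β μ 0).subtype) (q := R.wsp l) fun _ h => h)
      fun a b h => by
        have h := congrArg (Subtype.val (p := fun x => x ∈ R.wsp l)) h
        exact Subtype.ext (Subtype.ext h)
  nt := by
    by_contra! hcon
    obtain ⟨v, hv, hv0⟩ := (Submodule.ne_bot_iff _).1 H.wsp_ne
    have h := ann_of_kill H.good hn ⊤ hv0 fun b hb m X hX =>
      H.kill_all ⊤ (fun b _ m hm X hX v hv => by
        obtain ⟨k, rfl⟩ := (hM m).1 hm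
        rw [← H.coe_rep (hf := hf) hM hX b ⟨v, hv⟩, hcon b k X hX ⟨v, hv⟩]
        rfl) hb hX (wsp_le_self hv)
    exact ann_ne_top H.good hn (top_le_iff.1 h)
  sl2 k hk ν := by
    have hfk : f k ≠ 0 := fun h => hk (hf (h.trans (map_zero f).symm))
    obtain ⟨z, hz⟩ := w.sl2 (f k)
    obtain ⟨u, -, hu⟩ := exists_dual_vec ⊥ (fun h => GAlg.ic_ne (A := A) hfk ((Submodule.mem_bot ℂ).1 h))
    refine ⟨W (f k) u, w.mem _ _, W (f (-k)) u, w.mem _ _, 2 * (u ⬝ᵥ ν) + z, fun x v hv => ?_⟩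
    have h1 := A.lie_mem (w.mem (f k) u) (w.mem (-f k) u)
    rw [add_neg_cancel, ← map_zero f] at h1
    apply Subtype.ext
    rw [map_neg, H.coe_rep hM h1]
    rw [H.wsp_rep hM] at hv
    rw [Submodule.mem_comap, Submodule.subtype_apply] at hv
    rw [hz u hu _ _ hv, GAlg.ic_sub, map_zsmul, map_zsmul, dotProduct_add, dotProduct_smul, hu, zsmul_eq_mul, mul_one]
    rw [Submodule.coe_smul]
    congr 1
    ring

end GRep.Top
end
end Tor

namespace Tor

variable {n : ℕ} {τ : Type} [LieRing τ] [LieAlgebra ℂ τ] {A : GAlg n n τ} {B : Type}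
    [CommRing B] [Algebra ℂ B] {V : Type} [AddCommGroup V] [Module ℂ V]

namespace GRep.Cone
variable {R : GRep A B V} {W : (Fin n → ℤ) → (Fin n → ℂ) → τ} {m₀ : Fin n → ℤ}

theorem mem_cone_self {r : ℕ} (m : Fin r → ℤ) : (2 : ℤ) • m ∈ cone m := ⟨2, 0, by simp, by norm_num, by simp⟩

theorem mem_cone_single {r : ℕ} (m : Fin r → ℤ) (i : Fin r) : (2 : ℤ) • m + Pi.single i 1 ∈ cone m := by
  refine ⟨2, Pi.single i 1, rfl, by norm_num, fun j => ?_⟩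
  rw [Pi.single_apply]
  split_ifs <;> simp

theorem rep_no_cone (H : R.Cone W m₀) {β : Fin n → ℤ} {μ : Fin n → ℂ} (T : R.Top H.lin β μ) {r : ℕ}
    (hr : 2 ≤ r) {f : (Fin r → ℤ) →+ (Fin n → ℤ)} (hf : Function.Injective f)
    (hM : ∀ m, m ∈ H.lin ↔ ∃ k, f k = m) (m : Fin r → ℤ) : ¬ cone m ⊆ (T.rep f hf hM).Bd := by
  intro hsub
  have hT : (T.rep f hf hM).Good := T.rep_good H.w (by have := H.hn; omega) hM
  obtain ⟨ν, hν0, hν⟩ := exists_weight_ne_zero hT (by omega)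
  have hμT : (T.rep f hf hM).wsp μ ≠ ⊥ := by
    have h := T.wsp_rep_eq_bot (hf := hf) hM (zero_mem H.lin)
    rw [map_zero, add_zero] at h
    exact fun h' => T.wsp_ne (h.1 h')
  obtain ⟨p, rfl⟩ := single_coset hT hμT hν
  rw [GAlg.ic_sub] at hν hν0
  obtain ⟨k, hk, hkν⟩ : ∃ k ∈ cone m, μ + A.ic (f p) ∉ Submodule.span ℂ {A.ic (f k)} := by
    by_contra! hcon
    have h1 : ∀ k ∈ cone m, A.ic (f k) ∈ Submodule.span ℂ {μ + A.ic (f p)} := by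
      intro k hk
      obtain ⟨c, hc⟩ := Submodule.mem_span_singleton.1 (hcon k hk)
      refine Submodule.mem_span_singleton.2 ⟨c⁻¹, ?_⟩
      rw [← hc, inv_smul_smul₀]
      rintro rfl
      exact hν0 (by rw [← hc, zero_smul])
    have h2 : ∀ i, A.ic (f (Pi.single i 1)) ∈ Submodule.span ℂ {μ + A.ic (f p)} := by
      intro i
      have := Submodule.sub_mem _ (h1 _ (mem_cone_single m i)) (h1 _ (mem_cone_self m))
      rwa [← map_sub, ← map_sub, add_sub_cancel_left] at this
    have hne : f (Pi.single (⟨0, by omega⟩ : Fin r) 1) ≠ 0 := by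
      intro h
      have := congrFun (hf (h.trans (map_zero f).symm)) ⟨0, by omega⟩
      simp at this
    have h3 : A.ic (f (Pi.single (⟨1, by omega⟩ : Fin r) 1)) ∈
        Submodule.span ℂ {A.ic (f (Pi.single (⟨0, by omega⟩ : Fin r) 1))} := by
      obtain ⟨a, ha⟩ := Submodule.mem_span_singleton.1 (h2 ⟨0, by omega⟩)
      obtain ⟨b, hb⟩ := Submodule.mem_span_singleton.1 (h2 ⟨1, by omega⟩)
      have ha0 : a ≠ 0 := by
        rintro rfl
        rw [zero_smul] at ha
        exact GAlg.ic_ne hne ha.symm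
      exact Submodule.mem_span_singleton.2 ⟨b * a⁻¹, by rw [← ha, ← hb, mul_smul, inv_smul_smul₀ ha0]⟩
    obtain ⟨i, hi, h4⟩ := H.exists_smul_eq hne h3
    rw [← map_zsmul, ← map_zsmul] at h4
    have := congrFun (hf h4) ⟨1, by omega⟩
    simp at this
    exact hi this
  have hkM : f k ∈ H.lin := (hM _).2 ⟨k, rfl⟩
  have hpM : f p ∈ H.lin := (hM _).2 ⟨p, rfl⟩
  have hk0 : f k ≠ 0 := by
    intro h
    obtain ⟨x, hx⟩ := hsub hk (μ + A.ic (f p))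
    have := hx x le_rfl
    rw [hf (h.trans (map_zero f).symm), smul_zero, map_zero, add_zero] at this
    exact hν this
  obtain ⟨x0, hx0⟩ := hsub hk (μ + A.ic (f p))
  obtain ⟨x, hx, hne⟩ := H.exists_ge (H.mem_lin.1 hkM).1 hk0
    (fun h => hν ((T.wsp_rep_eq_bot hM hpM).2 h)) hkν x0
  apply hne
  have h := hx0 x hx
  rw [GAlg.ic_sub, map_zsmul, add_assoc, ← map_add] at h
  rw [add_assoc, ← map_add]
  exact (T.wsp_rep_eq_bot hM (AddSubgroup.add_mem _ hpM (zsmul_mem hkM x))).1 h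

/-- The structure of representations with a bounded cone. -/
theorem exists_highest (H : R.Cone W m₀) : ∃ (M : AddSubgroup (Fin n → ℤ)) (β : Fin n → ℤ) (v : V),
    IsCompl M (AddSubgroup.zmultiples β) ∧ v ≠ 0 ∧
    (∀ m ∈ M, ∀ x : ℤ, 0 < x → ∀ b, ∀ X ∈ A.g (m + x • β), R.ρ b X v = 0) ∧
    ∃ J : Ideal B, J.IsMaximal ∧ ∀ b ∈ J, ∀ m, ∀ X ∈ A.g m, R.ρ b X = 0 := by
  have hn := H.hn
  obtain ⟨β, hβ, hc, hK⟩ := H.exists_decomp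
  obtain ⟨μ, hμ, hbot⟩ := H.exists_top_level hβ hc hK
  have T : R.Top H.lin β μ := ⟨H.good, hc, H.ne_zero hβ, hμ, hbot⟩
  obtain ⟨v, hv, hv0⟩ := (Submodule.ne_bot_iff _).1 hμ
  have hvT : v ∈ R.lev H.lin β μ 0 := GRep.Top.wsp_le_self hv
  obtain ⟨r, hr, f, hf, hM⟩ := exists_embedding H.hn hc
  have hr1 : 1 ≤ r := by omega
  have hT : (T.rep f hf hM).Good := T.rep_good H.w (by omega) hM
  refine ⟨H.lin, β, v, hc, hv0, fun m hm x hx b X hX => T.kills_of_pos hm (by omega) hX hvT b,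
    (T.rep f hf hM).ann hr1, ann_maximal hT hr (fun m _ => H.rep_no_cone T hr hf hM m) hr1, ?_⟩
  intro b hb
  exact ann_of_kill H.good (by omega) ((T.rep f hf hM).ann hr1) hv0 (fun b hb m X hX =>
    T.kill_all _ (fun b hb m hm X hX v hv => by
      obtain ⟨k, rfl⟩ := (hM m).1 hm
      rw [← T.coe_rep (hf := hf) hM hX b ⟨v, hv⟩, hb k X hX]
      rfl) hb hX hvT) hb

end GRep.Cone
end Tor

namespace Tor

open MT

section
variable {n : ℕ} {𝔤 : Type} [LieRing 𝔤] [LieAlgebra ℂ 𝔤] {τ : Type} [LieRing τ] [LieAlgebra ℂ τ]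
  {κ : 𝔤 →ₗ[ℂ] 𝔤 →ₗ[ℂ] ℂ} {c₁ c₂ : ℂ} {E : (Fin n → ℤ) → 𝔤 →ₗ[ℂ] τ} {K W : (Fin n → ℤ) → Fin n → τ}

theorem E_mem (m x) : E m x ∈ gradedPiece E K W m := Submodule.subset_span (Or.inl (Or.inl ⟨x, rfl⟩))

theorem K_mem (m i) : K m i ∈ gradedPiece E K W m := Submodule.subset_span (Or.inl (Or.inr ⟨i, rfl⟩))

theorem W_mem (m i) : W m i ∈ gradedPiece E K W m := Submodule.subset_span (Or.inr ⟨i, rfl⟩)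

theorem gradedPiece_le {m} {N : Submodule ℂ τ} (hE : ∀ x, E m x ∈ N) (hK : ∀ i, K m i ∈ N) (hW : ∀ i, W m i ∈ N) :
    gradedPiece E K W m ≤ N := by
  refine Submodule.span_le.2 ?_
  rintro _ ((⟨x, rfl⟩ | ⟨i, rfl⟩) | ⟨i, rfl⟩)
  exacts [hE x, hK i, hW i]

theorem iSup_gradedPiece (hτ : IsFullToroidal n 𝔤 τ κ c₁ c₂ E K W) : ⨆ m, gradedPiece E K W m = ⊤ := by
  rw [eq_top_iff, ← hτ.span_eq_top]
  refine Submodule.span_le.2 ?_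
  rintro _ ((⟨m, x, rfl⟩ | ⟨m, i, rfl⟩) | ⟨m, i, rfl⟩)
  exacts [Submodule.mem_iSup_of_mem m (E_mem m x), Submodule.mem_iSup_of_mem m (K_mem m i),
    Submodule.mem_iSup_of_mem m (W_mem m i)]

theorem eq_of_homogeneous {N : Type} [AddCommGroup N] [Module ℂ N] {f g : τ →ₗ[ℂ] N}
    (hτ : IsFullToroidal n 𝔤 τ κ c₁ c₂ E K W) (h : ∀ m, ∀ X ∈ gradedPiece E K W m, f X = g X) : f = g := by
  have : ⨆ m, gradedPiece E K W m ≤ LinearMap.eqLocus f g := iSup_le fun m X hX => h m X hX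
  rw [iSup_gradedPiece hτ] at this
  exact LinearMap.ext fun X => this Submodule.mem_top

theorem lie_mem_of_gens {m k} {N : Submodule ℂ τ}
    (h : ∀ X ∈ genOfDeg E K W m, ∀ Y ∈ genOfDeg E K W k, ⁅X, Y⁆ ∈ N) {X Y} (hX : X ∈ gradedPiece E K W m)
    (hY : Y ∈ gradedPiece E K W k) : ⁅X, Y⁆ ∈ N := by
  induction hX, hY using Submodule.span_induction₂ with
  | mem_mem x y hx hy => exact h x hx y hy
  | zero_left y hy => rw [zero_lie]; exact zero_mem _
  | zero_right x hx => rw [lie_zero]; exact zero_mem _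
  | add_left x y z _ _ _ h1 h2 => rw [add_lie]; exact N.add_mem h1 h2
  | add_right x y z _ _ _ h1 h2 => rw [lie_add]; exact N.add_mem h1 h2
  | smul_left c x y _ _ h => rw [smul_lie]; exact N.smul_mem c h
  | smul_right c x y _ _ h => rw [lie_smul]; exact N.smul_mem c h

theorem lie_gradedPiece (hτ : IsFullToroidal n 𝔤 τ κ c₁ c₂ E K W) {m k X Y} (hX : X ∈ gradedPiece E K W m)
    (hY : Y ∈ gradedPiece E K W k) : ⁅X, Y⁆ ∈ gradedPiece E K W (m + k) := by
  have hKs : ∀ (p : Fin n → ℤ) q, ∑ i, (p i : ℂ) • K q i ∈ gradedPiece E K W q :=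
    fun p q => Submodule.sum_mem _ fun i _ => Submodule.smul_mem _ _ (K_mem q i)
  have hWE : ∀ m k i x, ⁅W m i, E k x⁆ ∈ gradedPiece E K W (m + k) := fun m k i x => by
    rw [hτ.lie_W_E]; exact Submodule.smul_mem _ _ (E_mem _ _)
  have hWK : ∀ m k i j, ⁅W m i, K k j⁆ ∈ gradedPiece E K W (m + k) := fun m k i j => by
    rw [hτ.lie_W_K]
    refine Submodule.add_mem _ (Submodule.smul_mem _ _ (K_mem _ _)) ?_
    split_ifs
    exacts [hKs _ _, zero_mem _]
  refine lie_mem_of_gens ?_ hX hY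
  rintro _ ((⟨x, rfl⟩ | ⟨i, rfl⟩) | ⟨i, rfl⟩) _ ((⟨y, rfl⟩ | ⟨j, rfl⟩) | ⟨j, rfl⟩)
  · rw [hτ.lie_E_E]
    exact Submodule.add_mem _ (E_mem _ _) (Submodule.smul_mem _ _ (hKs _ _))
  · rw [hτ.lie_E_K]; exact zero_mem _
  · rw [← lie_skew, add_comm]; exact Submodule.neg_mem _ (hWE _ _ _ _)
  · rw [← lie_skew, hτ.lie_E_K, neg_zero]; exact zero_mem _
  · rw [hτ.lie_K_K]; exact zero_mem _
  · rw [← lie_skew, add_comm]; exact Submodule.neg_mem _ (hWK _ _ _ _)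
  · exact hWE _ _ _ _
  · exact hWK _ _ _ _
  · rw [hτ.lie_W_W]
    exact Submodule.add_mem _ (Submodule.sub_mem _ (Submodule.smul_mem _ _ (W_mem _ _))
      (Submodule.smul_mem _ _ (W_mem _ _))) (Submodule.smul_mem _ _ (hKs _ _))

theorem exists_form_ne [LieAlgebra.IsSimple ℂ 𝔤] (hτ : IsFullToroidal n 𝔤 τ κ c₁ c₂ E K W) :
    ∃ x y, κ x y ≠ 0 := by
  by_contra! h
  refine LieAlgebra.IsSimple.non_abelian (R := ℂ) (L := 𝔤) ⟨fun x y => ?_⟩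
  rw [hτ.κ_nondeg x (h x), zero_lie]

theorem gradedPiece_le_of_lie [LieAlgebra.IsSimple ℂ 𝔤] (hτ : IsFullToroidal n 𝔤 τ κ c₁ c₂ E K W)
    {m k : Fin n → ℤ} (N : Submodule ℂ τ) (hmk : m ≠ k)
    (h : ∀ X ∈ gradedPiece E K W m, ∀ Y ∈ gradedPiece E K W k, ⁅X, Y⁆ ∈ N) : gradedPiece E K W (m + k) ≤ N := by
  obtain ⟨i0, hi0⟩ := Function.ne_iff.1 hmk
  have hne : (k i0 : ℂ) - (m i0 : ℂ) ≠ 0 := by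
    rw [sub_ne_zero]
    exact fun h => hi0 (by exact_mod_cast h.symm)
  have key : ∀ X : τ, (k i0 : ℂ) • X ∈ N → (m i0 : ℂ) • X ∈ N → X ∈ N := by
    intro X h1 h2
    have := N.sub_mem h1 h2
    rw [← sub_smul] at this
    exact (N.smul_mem_iff hne).1 this
  have hE : ∀ x, E (m + k) x ∈ N := by
    intro x
    refine key _ ?_ ?_
    · rw [← hτ.lie_W_E]; exact h _ (W_mem _ _) _ (E_mem _ _)
    · rw [add_comm, ← hτ.lie_W_E, ← lie_skew]; exact N.neg_mem (h _ (E_mem _ _) _ (W_mem _ _))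
  have hP : ∑ p, (m p : ℂ) • K (m + k) p ∈ N := by
    obtain ⟨x, y, hxy⟩ := exists_form_ne hτ
    have := h _ (E_mem _ x) _ (E_mem _ y)
    rw [hτ.lie_E_E, N.add_mem_iff_right (hE _)] at this
    exact (N.smul_mem_iff hxy).1 this
  have hP' : ∑ p, (k p : ℂ) • K (m + k) p ∈ N := by
    have h1 := hτ.K_rel (m + k)
    simp only [Pi.add_apply, Int.cast_add, add_smul, Finset.sum_add_distrib] at h1
    rw [add_comm] at h1
    rw [eq_neg_of_add_eq_zero_left h1]
    exact N.neg_mem hP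
  have hK : ∀ j, K (m + k) j ∈ N := by
    intro j
    refine key _ ?_ ?_
    · have := h _ (W_mem _ i0) _ (K_mem _ j)
      rw [hτ.lie_W_K] at this
      refine (N.add_mem_iff_left ?_).1 this
      split_ifs
      exacts [hP, zero_mem _]
    · have := N.neg_mem (h _ (K_mem _ j) _ (W_mem _ i0))
      rw [lie_skew, hτ.lie_W_K, add_comm k m] at this
      refine (N.add_mem_iff_left ?_).1 this
      split_ifs
      exacts [hP', zero_mem _]
  have hWW : ∀ i j, (k i : ℂ) • W (m + k) j - (m j : ℂ) • W (m + k) i ∈ N := by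
    intro i j
    have := h _ (W_mem _ i) _ (W_mem _ j)
    rw [hτ.lie_W_W] at this
    exact (N.add_mem_iff_left (N.smul_mem _ hP)).1 this
  have hW0 : W (m + k) i0 ∈ N := by
    have := hWW i0 i0
    rw [← sub_smul] at this
    exact (N.smul_mem_iff hne).1 this
  refine gradedPiece_le hE hK fun j => key _ ?_ ?_
  · have := N.add_mem (hWW i0 j) (N.smul_mem (m j : ℂ) hW0)
    rwa [sub_add_cancel] at this
  · have := N.sub_mem (N.smul_mem (k j : ℂ) hW0) (hWW j i0)
    rwa [sub_sub_cancel] at this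

theorem span_gens [FiniteDimensional ℂ 𝔤] (m : Fin n → ℤ) :
    ∃ s : Fin (Fintype.card (Fin (Module.finrank ℂ 𝔤) ⊕ Fin n ⊕ Fin n)) → τ,
      Submodule.span ℂ (Set.range s) = gradedPiece E K W m := by
  let b := Module.finBasis ℂ 𝔤
  refine ⟨Sum.elim (fun i => E m (b i)) (Sum.elim (K m) (W m)) ∘ (Fintype.equivFin _).symm, ?_⟩
  rw [(Fintype.equivFin _).symm.surjective.range_comp, Set.Sum.elim_range, Set.Sum.elim_range]
  refine le_antisymm (Submodule.span_le.2 ?_) (gradedPiece_le (fun x => ?_)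
    (fun i => Submodule.subset_span (Or.inr (Or.inl ⟨i, rfl⟩)))
    (fun i => Submodule.subset_span (Or.inr (Or.inr ⟨i, rfl⟩))))
  · rintro _ (⟨i, rfl⟩ | ⟨i, rfl⟩ | ⟨i, rfl⟩)
    exacts [E_mem _ _, K_mem _ _, W_mem _ _]
  · rw [← b.sum_repr x, map_sum]
    refine Submodule.sum_mem _ fun i _ => ?_
    rw [map_smul]
    exact Submodule.smul_mem _ _ (Submodule.subset_span (Or.inl ⟨i, rfl⟩))

/-- The full toroidal Lie algebra as a graded Lie algebra. -/
noncomputable def toroidal [LieAlgebra.IsSimple ℂ 𝔤] [FiniteDimensional ℂ 𝔤]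
    (hτ : IsFullToroidal n 𝔤 τ κ c₁ c₂ E K W) : GAlg n n τ where
  g := gradedPiece E K W
  D := W 0
  ι := AddMonoidHom.id _
  q := Fintype.card (Fin (Module.finrank ℂ 𝔤) ⊕ Fin n ⊕ Fin n)
  inj := Function.injective_id
  fd := span_gens
  lie_mem hX hY := lie_gradedPiece hτ hX hY
  gen N hmk h := gradedPiece_le_of_lie hτ N hmk h
  D_mem i := W_mem 0 i
  lie_D {m X} i hX := by
    have : gradedPiece E K W m ≤ LinearMap.ker ((LieAlgebra.ad ℂ τ (W 0 i)) - (m i : ℂ) • LinearMap.id) := by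
      refine gradedPiece_le (fun x => ?_) (fun j => ?_) (fun j => ?_)
      · simp [hτ.lie_W_E]
      · simp [hτ.lie_W_K]
      · simp [hτ.lie_W_W]
    have := this hX
    simpa [sub_eq_zero] using this

theorem lie_W_sum (hτ : IsFullToroidal n 𝔤 τ κ c₁ c₂ E K W) (m k : Fin n → ℤ) (u y : Fin n → ℂ) :
    ⁅∑ i, u i • W m i, ∑ j, y j • W k j⁆ = (u ⬝ᵥ fun i => (k i : ℂ)) • ∑ j, y j • W (m + k) j
      - (y ⬝ᵥ fun i => (m i : ℂ)) • ∑ j, u j • W (m + k) j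
      + (-(c₁ * (u ⬝ᵥ fun i => (k i : ℂ)) * (y ⬝ᵥ fun i => (m i : ℂ)))
        + c₂ * (u ⬝ᵥ fun i => (m i : ℂ)) * (y ⬝ᵥ fun i => (k i : ℂ))) • ∑ p, (m p : ℂ) • K (m + k) p := by
  generalize hS : ∑ p, (m p : ℂ) • K (m + k) p = S
  have h : ∀ i j, ⁅u i • W m i, y j • W k j⁆ = (u i * k i) • y j • W (m + k) j - (y j * m j) • u i • W (m + k) i
      + (-(c₁ * ((u i * k i) * (y j * m j))) + c₂ * ((u i * m i) * (y j * k j))) • S := by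
    intro i j
    rw [smul_lie, lie_smul, hτ.lie_W_W, hS]
    module
  rw [mul_assoc, mul_assoc]
  simp only [sum_lie, lie_sum, h, Finset.sum_add_distrib, Finset.sum_sub_distrib, Finset.sum_neg_distrib,
    ← Finset.sum_smul, ← Finset.smul_sum, ← Finset.mul_sum, ← Finset.sum_mul, dotProduct]

end
end Tor

namespace Tor

open MT

section
variable {n : ℕ} {𝔤 : Type} [LieRing 𝔤] [LieAlgebra ℂ 𝔤] {τ : Type} [LieRing τ] [LieAlgebra ℂ τ]
  {κ : 𝔤 →ₗ[ℂ] 𝔤 →ₗ[ℂ] ℂ} {c₁ c₂ : ℂ} {E : (Fin n → ℤ) → 𝔤 →ₗ[ℂ] τ} {K W : (Fin n → ℤ) → Fin n → τ}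
  [LieAlgebra.IsSimple ℂ 𝔤] [FiniteDimensional ℂ 𝔤] {B : Type} [CommRing B] [Algebra ℂ B]
  {V : Type} [AddCommGroup V] [Module ℂ V] [LieRingModule (B ⊗[ℂ] τ) V] [LieModule ℂ (B ⊗[ℂ] τ) V]

variable (B V) in
/-- A module over the map algebra as a representation of the graded Lie algebra. -/
noncomputable def mapRep (hτ : IsFullToroidal n 𝔤 τ κ c₁ c₂ E K W) : GRep (toroidal hτ) B V where
  ρ := (TensorProduct.mk ℂ B τ).compr₂ (LieModule.toEnd ℂ (B ⊗[ℂ] τ) V : (B ⊗[ℂ] τ) →ₗ[ℂ] Module.End ℂ V)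
  comm {m k X Y} _ _ b c v := by
    have h : (b * c) ⊗ₜ[ℂ] ⁅X, Y⁆ = ⁅b ⊗ₜ[ℂ] X, c ⊗ₜ[ℂ] Y⁆ := rfl
    simp only [LinearMap.compr₂_apply, TensorProduct.mk_apply, LieHom.coe_toLinearMap,
      LieModule.toEnd_apply_apply, h]
    rw [leibniz_lie, add_comm]

variable (hτ : IsFullToroidal n 𝔤 τ κ c₁ c₂ E K W)

@[simp]
theorem mapRep_apply (b : B) (X : τ) (v : V) : (mapRep B V hτ).ρ b X v = ⁅b ⊗ₜ[ℂ] X, v⁆ := rfl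

theorem wsp_mapRep (l : Fin n → ℂ) : (mapRep B V hτ).wsp l = weightSpace (V := V) (dOp B W) l :=
  Submodule.ext fun _ => GRep.mem_wsp

theorem annTensor_of_homogeneous {I : Ideal B}
    (h : ∀ b ∈ I, ∀ m, ∀ X ∈ gradedPiece E K W m, (mapRep B V hτ).ρ b X = 0) : annTensor τ B I V := by
  intro X a ha v
  have h := eq_of_homogeneous (f := (mapRep B V hτ).ρ a) (g := 0) hτ (h a ha)
  rw [← mapRep_apply hτ, h]
  rfl

theorem irr_mapRep (hirr : LieModule.IsIrreducible ℂ (B ⊗[ℂ] τ) V) (N : Submodule ℂ V)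
    (h : ∀ b m, ∀ X ∈ gradedPiece E K W m, ∀ v ∈ N, (mapRep B V hτ).ρ b X v ∈ N) : N = ⊥ ∨ N = ⊤ := by
  have key : ∀ (z : B ⊗[ℂ] τ) (v : V), v ∈ N → ⁅z, v⁆ ∈ N := by
    intro z v hv
    induction z with
    | zero => rw [zero_lie]; exact zero_mem _
    | add x y hx hy => rw [add_lie]; exact N.add_mem hx hy
    | tmul b X =>
      have : ⨆ m, gradedPiece E K W m ≤ N.comap (((mapRep B V hτ).ρ b).flip v) :=
        iSup_le fun m X hX => h b m X hX v hv
      rw [iSup_gradedPiece hτ] at this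
      exact this (Submodule.mem_top (x := X))
  let N' : LieSubmodule ℂ (B ⊗[ℂ] τ) V := { N with lie_mem := fun {z v} hv => key z v hv }
  have hN : (N' : Submodule ℂ V) = N := rfl
  rcases eq_bot_or_eq_top N' with h | h
  · left; rw [← hN, h, LieSubmodule.bot_toSubmodule]
  · right; rw [← hN, h, LieSubmodule.top_toSubmodule]

theorem exists_central_char (hirr : LieModule.IsIrreducible ℂ (B ⊗[ℂ] τ) V)
    (hHC : IsHarishChandra (V := V) (dOp B W)) (hnt : ∃ (z : B ⊗[ℂ] τ) (v : V), ⁅z, v⁆ ≠ 0) (p : Fin n) :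
    ∃ χ : ℂ, ∀ v, (mapRep B V hτ).ρ 1 (K 0 p) v = χ • v := by
  set R := mapRep B V hτ
  have hK : K 0 p ∈ gradedPiece E K W 0 := K_mem 0 p
  have hcom : ∀ b m, ∀ X ∈ gradedPiece E K W m, ∀ v, R.ρ 1 (K 0 p) (R.ρ b X v) = R.ρ b X (R.ρ 1 (K 0 p) v) := by
    intro b m X hX v
    have hz : gradedPiece E K W m ≤ LinearMap.ker (LieAlgebra.ad ℂ τ (K 0 p)) := by
      refine gradedPiece_le (fun x => ?_) (fun j => ?_) (fun j => ?_) <;>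
        rw [LinearMap.mem_ker, LieAlgebra.ad_apply]
      · rw [← lie_skew, hτ.lie_E_K, neg_zero]
      · exact hτ.lie_K_K _ _ _ _
      · have := hτ.K_rel m
        rw [← lie_skew, hτ.lie_W_K]
        simp [this]
    have hz : ⁅K 0 p, X⁆ = 0 := hz hX
    rw [R.comm hK hX, hz, map_zero, LinearMap.zero_apply, add_zero]
  obtain ⟨z, v₀, hzv⟩ := hnt
  have hv₀ : v₀ ≠ 0 := fun h => hzv (by rw [h, lie_zero])
  obtain ⟨l, hl⟩ : ∃ l, weightSpace (V := V) (dOp B W) l ≠ ⊥ := by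
    by_contra! h
    have h1 := hHC.1
    simp only [h, iSup_bot] at h1
    exact hv₀ ((Submodule.mem_bot ℂ).1 (h1 ▸ Submodule.mem_top))
  rw [← wsp_mapRep hτ] at hl
  have : FiniteDimensional ℂ (R.wsp l) := by
    have := hHC.2 l
    rwa [← wsp_mapRep hτ] at this
  have : Nontrivial (R.wsp l) := Submodule.nontrivial_iff_ne_bot.2 hl
  have hmap : ∀ v ∈ R.wsp l, R.ρ 1 (K 0 p) v ∈ R.wsp l := fun v hv => by
    have := R.shift hv (m := 0) hK 1
    rwa [map_zero, add_zero] at this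
  obtain ⟨χ, hχ⟩ := Module.End.exists_eigenvalue ((R.ρ 1 (K 0 p)).restrict hmap)
  obtain ⟨⟨v, hv⟩, hχv⟩ := hχ.exists_hasEigenvector
  have hχ1 := congrArg Subtype.val hχv.apply_eq_smul
  refine ⟨χ, fun w => ?_⟩
  let N := LinearMap.ker (R.ρ 1 (K 0 p) - χ • LinearMap.id)
  have hmem : ∀ w, w ∈ N ↔ R.ρ 1 (K 0 p) w = χ • w := fun w => by
    simp only [N, LinearMap.mem_ker, LinearMap.sub_apply, LinearMap.smul_apply, LinearMap.id_apply, sub_eq_zero]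
  rcases irr_mapRep hτ hirr N (fun b m X hX w hw => by
    rw [hmem] at hw ⊢
    rw [hcom b m X hX, hw, map_smul]) with h | h
  · exact absurd (Subtype.ext ((Submodule.mem_bot ℂ).1 (h ▸ (hmem v).2 hχ1))) hχv.2
  · exact (hmem w).1 (h ▸ Submodule.mem_top)

variable (W) in
/-- The vector field `t^m ∑ uᵢ dᵢ`. -/
def field (m : Fin n → ℤ) (u : Fin n → ℂ) : τ := ∑ i, u i • W m i

theorem field_zero_apply (u : Fin n → ℂ) {l : Fin n → ℂ} {v : V} (hv : v ∈ (mapRep B V hτ).wsp l) :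
    (mapRep B V hτ).ρ 1 (field W 0 u) v = (u ⬝ᵥ l) • v := by
  rw [GRep.mem_wsp] at hv
  have hv : ∀ i, (mapRep B V hτ).ρ 1 (W 0 i) v = l i • v := hv
  simp only [field, map_sum, map_smul, LinearMap.sum_apply, LinearMap.smul_apply, hv]
  rw [dotProduct, Finset.sum_smul]
  simp only [smul_smul]

theorem mapRep_wAct (hirr : LieModule.IsIrreducible ℂ (B ⊗[ℂ] τ) V)
    (hHC : IsHarishChandra (V := V) (dOp B W)) (hnt : ∃ (z : B ⊗[ℂ] τ) (v : V), ⁅z, v⁆ ≠ 0) :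
    (mapRep B V hτ).WAct (field W) where
  mem m u := Submodule.sum_mem _ fun i _ => Submodule.smul_mem _ _ (W_mem m i)
  zero u _ _ hv := field_zero_apply hτ u hv
  lie m k u y hm hk := by
    have hm : (y ⬝ᵥ fun i => (m i : ℂ)) = 0 := hm
    have hk : (y ⬝ᵥ fun i => (k i : ℂ)) = 0 := hk
    rw [field, field, lie_W_sum hτ, hm, hk]
    simp only [mul_zero, neg_zero, add_zero, zero_smul, sub_zero]
    rfl
  sl2 k := by
    choose χ hχ using exists_central_char hτ hirr hHC hnt
    refine ⟨(c₂ - c₁) * ∑ p, (k p : ℂ) * χ p, fun u hu l v hv => ?_⟩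
    have hu : (u ⬝ᵥ fun i => (k i : ℂ)) = 1 := hu
    have hu' : (u ⬝ᵥ fun i => ((-k) i : ℂ)) = -1 := by
      rw [← hu, ← dotProduct_neg]
      congr 1
      ext i
      simp
    have h0 : (mapRep B V hτ).ρ 1 (∑ j, u j • W 0 j) v = (u ⬝ᵥ l) • v := field_zero_apply hτ u hv
    have hS : (mapRep B V hτ).ρ 1 (∑ p, (k p : ℂ) • K 0 p) v = (∑ p, (k p : ℂ) * χ p) • v := by
      simp only [map_sum, map_smul, LinearMap.sum_apply, LinearMap.smul_apply, hχ, Finset.sum_smul, smul_smul]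
    rw [field, field, lie_W_sum hτ, hu, hu', add_neg_cancel, map_add, map_sub, map_smul, map_smul, map_smul,
      LinearMap.add_apply, LinearMap.sub_apply, LinearMap.smul_apply, LinearMap.smul_apply, LinearMap.smul_apply,
      h0, hS]
    module

theorem mapRep_good (hirr : LieModule.IsIrreducible ℂ (B ⊗[ℂ] τ) V)
    (hHC : IsHarishChandra (V := V) (dOp B W)) (hnt : ∃ (z : B ⊗[ℂ] τ) (v : V), ⁅z, v⁆ ≠ 0) :
    (mapRep B V hτ).Good where
  irr N h := irr_mapRep hτ hirr N h
  top := by simp only [wsp_mapRep]; exact hHC.1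
  fin l := by rw [wsp_mapRep]; exact hHC.2 l
  nt := by
    by_contra! h
    obtain ⟨z, v, hz⟩ := hnt
    have ha : annTensor τ B ⊤ V := annTensor_of_homogeneous hτ fun b _ m X hX => LinearMap.ext (h b m X hX)
    refine hz ?_
    induction z with
    | zero => exact zero_lie _
    | add x y hx hy =>
      by_cases h1 : ⁅x, v⁆ = 0
      · by_cases h2 : ⁅y, v⁆ = 0
        · rw [add_lie, h1, h2, add_zero]
        · exact absurd (hy h2) h2
      · exact absurd (hx h1) h1
    | tmul b X => exact ha X b trivial v
  sl2 k hk ν := by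
    have w := mapRep_wAct hτ hirr hHC hnt
    obtain ⟨z, hz⟩ := w.sl2 k
    obtain ⟨u, -, hu⟩ := exists_dual_vec ⊥ (fun h => GAlg.ic_ne (A := toroidal hτ) hk ((Submodule.mem_bot ℂ).1 h))
    refine ⟨field W k u, w.mem _ _, field W (-k) u, w.mem _ _, 2 * (u ⬝ᵥ ν) + z, fun x v hv => ?_⟩
    rw [hz u hu _ _ hv, map_zsmul, dotProduct_add, dotProduct_smul, hu, zsmul_eq_mul, mul_one]
    congr 1
    ring

end
end Tor

namespace MT
theorem statement_0
    (n : ℕ) (hn : 3 ≤ n)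
    (𝔤 : Type) [LieRing 𝔤] [LieAlgebra ℂ 𝔤] [LieAlgebra.IsSimple ℂ 𝔤]
    [FiniteDimensional ℂ 𝔤]
    (τ : Type) [LieRing τ] [LieAlgebra ℂ τ]
    (κ : 𝔤 →ₗ[ℂ] 𝔤 →ₗ[ℂ] ℂ) (c₁ c₂ : ℂ)
    (E : (Fin n → ℤ) → 𝔤 →ₗ[ℂ] τ) (K W : (Fin n → ℤ) → Fin n → τ)
    (hτ : IsFullToroidal n 𝔤 τ κ c₁ c₂ E K W)
    (B : Type) [CommRing B] [Algebra ℂ B] [Nontrivial B]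
    (hB : Algebra.FiniteType ℂ B)
    (V : Type) [AddCommGroup V] [Module ℂ V]
    [LieRingModule (B ⊗[ℂ] τ) V] [LieModule ℂ (B ⊗[ℂ] τ) V]
    (hirr : LieModule.IsIrreducible ℂ (B ⊗[ℂ] τ) V)
    (hHC : IsHarishChandra (V := V) (dOp B W))
    (hnontriv : ∃ (z : B ⊗[ℂ] τ) (v : V), ⁅z, v⁆ ≠ 0) :
    (IsCuspidal (V := V) (dOp B W) ∨ IsHighestWeightModule B E K W V) ∧
      ∃ 𝔐 : Ideal B, 𝔐.IsMaximal ∧ annTensor τ B 𝔐 V := by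
  have hR := Tor.mapRep_good hτ hirr hHC hnontriv
  by_cases hno : ∀ m : Fin n → ℤ, m ≠ 0 → ¬Tor.cone m ⊆ (Tor.mapRep B V hτ).Bd
  · obtain ⟨N, hN⟩ := Tor.GRep.bounded_of_no_cone hR (by omega) hno
    refine ⟨Or.inl ⟨hHC, N, fun l => ?_⟩, _, Tor.GRep.ann_maximal hR (by omega) hno (by omega),
      Tor.annTensor_of_homogeneous hτ fun b hb => Tor.GRep.mem_ann.1 hb⟩
    rw [← Tor.wsp_mapRep hτ]
    exact hN l
  · push Not at hno
    obtain ⟨m₀, hne, hsub⟩ := hno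
    have H : (Tor.mapRep B V hτ).Cone (Tor.field W) m₀ :=
      ⟨hR, Tor.mapRep_wAct hτ hirr hHC hnontriv, hn, fun _ => rfl, hne, hsub⟩
    obtain ⟨M, β, v, hM, hv, hkill, J, hJ, hJann⟩ := H.exists_highest
    refine ⟨Or.inr ⟨M, β, hM, v, hv, fun m hm r hr a => ⟨fun x => ?_, fun i => ?_, fun i => ?_⟩, ?_⟩, J, hJ,
      Tor.annTensor_of_homogeneous hτ hJann⟩
    · exact hkill m hm r (by exact_mod_cast hr) a _ (Tor.E_mem _ _)
    · exact hkill m hm r (by exact_mod_cast hr) a _ (Tor.K_mem _ _)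
    · exact hkill m hm r (by exact_mod_cast hr) a _ (Tor.W_mem _ _)
    · refine (eq_bot_or_eq_top _).resolve_left fun h => hv ?_
      have := LieSubmodule.subset_lieSpan (R := ℂ) (L := B ⊗[ℂ] τ) (M := V) (Set.mem_singleton v)
      rw [h] at this
      exact (LieSubmodule.mem_bot v).1 this
end MT
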